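/- arXiv:1003.1156 — 2 statements merged into one kernel-verified Lean document; each statement's English description precedes it below -/
import Mathlib

section
/- Let γ be a smooth family of nondegenerate classical paths over an open set O ⊆ ℝ_{>0} × ℝ^n × ℝ^n with Hamilton function S_γ and Green's kernel G_γ. Fix (t,q_0,q_1) ∈ O, a ∈ {0,1}, m ∈ {1,…,n}, write G = G_γ and let φ(ρ) = ∂γ(ρ;t,q_0,q_1)/∂q_a^m. Then for all ς, τ ∈ (0,t) with ς ≠ τ and all i, j: ∂G^{ij}(ς,τ)/∂q_a^m = ∫_0^t G^{il}(ς,ρ) · (δD)[G^{·j}(·,τ)]^l(ρ) dρ, where (δD) is the first-order differential operator obtained by differentiating the coefficients of D_γ with respect to q_a^m, namely (δD)[ξ]^l(ρ) = ∂/∂q^p[(∂B_l/∂q^r − ∂B_r/∂q^l)](γ(ρ)) φ^p(ρ) ξ̇^r(ρ) + { ∂²/∂q^p∂q^r[(∂B_l/∂q^k − ∂B_k/∂q^l)](γ(ρ)) φ^p(ρ) γ̇^k(ρ) + ∂/∂q^r[(∂B_l/∂q^k − ∂B_k/∂q^l)](γ(ρ)) φ̇^k(ρ) + (∂³C/∂q^p∂q^l∂q^r)(γ(ρ))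 φ^p(ρ) } ξ^r(ρ), applied to the path ρ ↦ G^{rj}(ρ,τ) (whose ρ-derivative exists off the kink ρ = τ, a set of measure zero). -/
open MeasureTheory Set
open scoped BigOperators

noncomputable section

/-- Partial derivative of `f : ℝⁿ → ℝ` in the `j`-th coordinate direction. -/
def pd {n : ℕ} (f : (Fin n → ℝ) → ℝ) (j : Fin n) (q : Fin n → ℝ) : ℝ :=
  fderiv ℝ f q (Pi.single j 1)

/-- The classical equation of motion on the time interval `[0, t]`. -/
def IsClassical {n : ℕ} (B : Fin n → (Fin n → ℝ) → ℝ) (C : (Fin n → ℝ) → ℝ)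
    (t : ℝ) (γ : ℝ → Fin n → ℝ) : Prop :=
  ∀ τ ∈ Icc (0:ℝ) t, ∀ i,
    deriv (deriv γ) τ i
      + (∑ j, (pd (B i) j (γ τ) - pd (B j) i (γ τ)) * deriv γ τ j)
      + pd C i (γ τ) = 0

/-- The Jacobi operator `D_γ` (linearization of the equation of motion along `γ`). -/
def Jacobi {n : ℕ} (B : Fin n → (Fin n → ℝ) → ℝ) (C : (Fin n → ℝ) → ℝ)
    (γ ξ : ℝ → Fin n → ℝ) (τ : ℝ) (i : Fin n) : ℝ :=
  deriv (deriv ξ) τ i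
    + (∑ j, (pd (B i) j (γ τ) - pd (B j) i (γ τ)) * deriv ξ τ j)
    + ∑ j, ((∑ k, pd (fun q => pd (B i) k q - pd (B k) i q) j (γ τ) * deriv γ τ k)
        + pd (pd C i) j (γ τ)) * ξ τ j

/-- A classical path of duration `t` is nondegenerate if the only smooth based loop
annihilated by the Jacobi operator vanishes identically on `[0,t]`. -/
def Nondegenerate {n : ℕ} (B : Fin n → (Fin n → ℝ) → ℝ) (C : (Fin n → ℝ) → ℝ)
    (t : ℝ) (γ : ℝ → Fin n → ℝ) : Prop :=
  ∀ ξ : ℝ → Fin n → ℝ, ContDiff ℝ (⊤ : ℕ∞) ξ → ξ 0 = 0 → ξ t = 0 →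
    (∀ τ ∈ Icc (0:ℝ) t, ∀ i, Jacobi B C γ ξ τ i = 0) →
    ∀ τ ∈ Icc (0:ℝ) t, ξ τ = 0

/-- The action of a path of duration `t`. -/
def action {n : ℕ} (B : Fin n → (Fin n → ℝ) → ℝ) (C : (Fin n → ℝ) → ℝ)
    (t : ℝ) (γ : ℝ → Fin n → ℝ) : ℝ :=
  ∫ τ in (0:ℝ)..t,
    ((1:ℝ)/2 * ∑ i, deriv γ τ i ^ 2 + ∑ i, B i (γ τ) * deriv γ τ i - C (γ τ))

/-- A smooth family of nondegenerate classical paths with boundary values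
`(t, q₀, q₁)` ranging over an open set `O ⊆ ℝ_{>0} × ℝⁿ × ℝⁿ`. -/
structure SmoothFamily {n : ℕ} (B : Fin n → (Fin n → ℝ) → ℝ) (C : (Fin n → ℝ) → ℝ)
    (O : Set (ℝ × (Fin n → ℝ) × (Fin n → ℝ))) where
  f : ℝ → ℝ → (Fin n → ℝ) → (Fin n → ℝ) → Fin n → ℝ
  isOpen : IsOpen O
  pos : ∀ p ∈ O, 0 < p.1
  smooth : ContDiffOn ℝ (⊤ : ℕ∞)
      (fun p : ℝ × ℝ × (Fin n → ℝ) × (Fin n → ℝ) => f p.1 p.2.1 p.2.2.1 p.2.2.2)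
      {p : ℝ × ℝ × (Fin n → ℝ) × (Fin n → ℝ) | p.2 ∈ O ∧ p.1 ∈ Icc 0 p.2.1}
  pathSmooth : ∀ p ∈ O, ContDiff ℝ (⊤ : ℕ∞) fun τ => f τ p.1 p.2.1 p.2.2
  isClassical : ∀ p ∈ O, IsClassical B C p.1 fun τ => f τ p.1 p.2.1 p.2.2
  nondeg : ∀ p ∈ O, Nondegenerate B C p.1 fun τ => f τ p.1 p.2.1 p.2.2
  bdry0 : ∀ p ∈ O, f 0 p.1 p.2.1 p.2.2 = p.2.1
  bdry1 : ∀ p ∈ O, f p.1 p.1 p.2.1 p.2.2 = p.2.2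

/-- The Hamilton function of a smooth family of classical paths. -/
def famS {n : ℕ} {B : Fin n → (Fin n → ℝ) → ℝ} {C : (Fin n → ℝ) → ℝ}
    {O : Set (ℝ × (Fin n → ℝ) × (Fin n → ℝ))} (F : SmoothFamily B C O)
    (t : ℝ) (q0 q1 : Fin n → ℝ) : ℝ :=
  action B C t fun τ => F.f τ t q0 q1

/-- The mixed Hessian `(l, m) ↦ ∂²S/∂q₀^l∂q₁^m`. -/
def Hess01 {n : ℕ} (S : ℝ → (Fin n → ℝ) → (Fin n → ℝ) → ℝ)
    (t : ℝ) (q0 q1 : Fin n → ℝ) : Matrix (Fin n) (Fin n) ℝ :=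
  Matrix.of fun l m =>
    fderiv ℝ (fun q0' => fderiv ℝ (fun q1' => S t q0' q1') q1 (Pi.single m 1)) q0
      (Pi.single l 1)

/-- Heaviside's step function, with `Θ 0 = 1/2`. -/
def Heav (x : ℝ) : ℝ := if x < 0 then 0 else if x = 0 then 1/2 else 1

/-- The Green's kernel `G_γ` of a smooth family of nondegenerate classical paths. -/
def Green {n : ℕ} {B : Fin n → (Fin n → ℝ) → ℝ} {C : (Fin n → ℝ) → ℝ}
    {O : Set (ℝ × (Fin n → ℝ) × (Fin n → ℝ))} (F : SmoothFamily B C O)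
    (t : ℝ) (q0 q1 : Fin n → ℝ) (ς τ : ℝ) (i j : Fin n) : ℝ :=
  Heav (ς - τ) * ∑ k, ∑ l,
      fderiv ℝ (fun q => F.f ς t q q1 i) q0 (Pi.single k 1)
        * ((Hess01 (fun a b c => -(famS F a b c)) t q0 q1).transpose)⁻¹ k l
        * fderiv ℝ (fun q => F.f τ t q0 q j) q1 (Pi.single l 1)
  + Heav (τ - ς) * ∑ k, ∑ l,
      fderiv ℝ (fun q => F.f ς t q0 q i) q1 (Pi.single k 1)
        * (Hess01 (fun a b c => -(famS F a b c)) t q0 q1)⁻¹ k l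
        * fderiv ℝ (fun q => F.f τ t q q1 j) q0 (Pi.single l 1)

/-- The Hessian of the action at a path `γ` of duration `t`, as a bilinear form. -/
def hess {n : ℕ} (B : Fin n → (Fin n → ℝ) → ℝ) (C : (Fin n → ℝ) → ℝ)
    (t : ℝ) (γ ξ ζ : ℝ → Fin n → ℝ) : ℝ :=
  ∫ τ in (0:ℝ)..t,
    ((∑ i, deriv ξ τ i * deriv ζ τ i)
      + (∑ i, ∑ j, pd (B i) j (γ τ) * (deriv ξ τ i * ζ τ j + deriv ζ τ i * ξ τ j))
      + ∑ j, ∑ k,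
          ((∑ i, pd (pd (B i) j) k (γ τ) * deriv γ τ i) - pd (pd C j) k (γ τ))
            * (ξ τ j * ζ τ k))

/-- The Jacobi fields `∂γ/∂q_a^j` of a smooth family (`a = 0` or `a = 1`). -/
def jfield {n : ℕ} {B : Fin n → (Fin n → ℝ) → ℝ} {C : (Fin n → ℝ) → ℝ}
    {O : Set (ℝ × (Fin n → ℝ) × (Fin n → ℝ))} (F : SmoothFamily B C O)
    (t : ℝ) (q0 q1 : Fin n → ℝ) (a : Fin 2) (j : Fin n) : ℝ → Fin n → ℝ :=
  fun τ i =>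
    if a = 0 then fderiv ℝ (fun q => F.f τ t q q1 i) q0 (Pi.single j 1)
    else fderiv ℝ (fun q => F.f τ t q0 q i) q1 (Pi.single j 1)

/-- Partial derivative of a function of `(t, q₀, q₁)` in the direction `q_a^j`. -/
def pdS {n : ℕ} (S : ℝ → (Fin n → ℝ) → (Fin n → ℝ) → ℝ) (a : Fin 2) (j : Fin n)
    (t : ℝ) (q0 q1 : Fin n → ℝ) : ℝ :=
  if a = 0 then fderiv ℝ (fun q => S t q q1) q0 (Pi.single j 1)
  else fderiv ℝ (fun q => S t q0 q) q1 (Pi.single j 1)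

set_option linter.unusedSectionVars false

lemma two_le_aux : minSmoothness ℝ 2 ≤ ((⊤ : ℕ∞) : WithTop ℕ∞) := by
  rw [minSmoothness_of_isRCLikeNormedField]
  exact WithTop.coe_le_coe.2 (le_top : (2:ℕ∞) ≤ ⊤)

section calculus
variable {E : Type*} [NormedAddCommGroup E] [NormedSpace ℝ E]

/-- The space-time domain. -/
def KK (t : ℝ) (U : Set E) : Set (ℝ × E) := Icc 0 t ×ˢ U

/-- Time derivative within the domain. -/
def dT (t : ℝ) (U : Set E) (f : ℝ × E → ℝ) (p : ℝ × E) : ℝ :=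
  fderivWithin ℝ f (KK t U) p (1, 0)

/-- Parameter derivative within the domain. -/
def dE (t : ℝ) (U : Set E) (e : E) (f : ℝ × E → ℝ) (p : ℝ × E) : ℝ :=
  fderivWithin ℝ f (KK t U) p (0, e)

/-- Smoothness on the domain. -/
def Sm (t : ℝ) (U : Set E) (f : ℝ × E → ℝ) : Prop :=
  ContDiffOn ℝ (⊤ : ℕ∞) f (KK t U)

variable {t : ℝ} {U : Set E} {f g : ℝ × E → ℝ}

lemma KK_unique (ht : 0 < t) (hU : IsOpen U) : UniqueDiffOn ℝ (KK t U) :=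
  (uniqueDiffOn_Icc ht).prod hU.uniqueDiffOn

lemma KK_closure (ht : 0 < t) (hU : IsOpen U) {p : ℝ × E} (hp : p ∈ KK t U) :
    p ∈ closure (interior (KK t U)) := by
  unfold KK
  rw [interior_prod_eq, closure_prod_eq, interior_Icc, closure_Ioo ht.ne, hU.interior_eq]
  exact ⟨hp.1, subset_closure hp.2⟩

lemma Sm.dT (ht : 0 < t) (hU : IsOpen U) (hf : Sm t U f) : Sm t U (dT t U f) := by
  have h : ContDiffOn ℝ (⊤ : ℕ∞) (fderivWithin ℝ f (KK t U)) (KK t U) :=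
    hf.fderivWithin (KK_unique ht hU) (by simp)
  exact h.clm_apply contDiffOn_const

lemma Sm.dE (ht : 0 < t) (hU : IsOpen U) (e : E) (hf : Sm t U f) : Sm t U (dE t U e f) := by
  have h : ContDiffOn ℝ (⊤ : ℕ∞) (fderivWithin ℝ f (KK t U)) (KK t U) :=
    hf.fderivWithin (KK_unique ht hU) (by simp)
  exact h.clm_apply contDiffOn_const

lemma Sm.hasF (hf : Sm t U f) {p : ℝ × E} (hp : p ∈ KK t U) :
    HasFDerivWithinAt f (fderivWithin ℝ f (KK t U) p) (KK t U) p :=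
  (hf.differentiableOn (by simp) p hp).hasFDerivWithinAt

lemma Sm.hasT (hf : Sm t U f) {τ : ℝ} (hτ : τ ∈ Icc 0 t) {x : E} (hx : x ∈ U) :
    HasDerivWithinAt (fun s => f (s, x)) (_root_.dT t U f (τ, x)) (Icc 0 t) τ := by
  have h1 : HasDerivWithinAt (fun s : ℝ => (s, x)) ((1 : ℝ), (0 : E)) (Icc 0 t) τ :=
    (hasDerivWithinAt_id τ _).prodMk (hasDerivWithinAt_const τ _ x)
  have h2 : MapsTo (fun s : ℝ => (s, x)) (Icc 0 t) (KK t U) := fun s hs => ⟨hs, hx⟩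
  exact (hf.hasF (p := (τ, x)) ⟨hτ, hx⟩).comp_hasDerivWithinAt τ h1 h2

lemma Sm.hasTI (hf : Sm t U f) {τ : ℝ} (hτ : τ ∈ Ioo 0 t) {x : E} (hx : x ∈ U) :
    HasDerivAt (fun s => f (s, x)) (_root_.dT t U f (τ, x)) τ :=
  (hf.hasT (Ioo_subset_Icc_self hτ) hx).hasDerivAt (Icc_mem_nhds hτ.1 hτ.2)

lemma Sm.hasFE (hU : IsOpen U) (hf : Sm t U f) {τ : ℝ} (hτ : τ ∈ Icc 0 t) {x : E} (hx : x ∈ U) :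
    HasFDerivAt (fun y => f (τ, y))
      ((fderivWithin ℝ f (KK t U) (τ, x)).comp (ContinuousLinearMap.inr ℝ ℝ E)) x := by
  have h1 : HasFDerivWithinAt (fun y : E => (τ, y)) (ContinuousLinearMap.inr ℝ ℝ E) U x :=
    ((hasFDerivAt_prodMk_right τ x)).hasFDerivWithinAt
  exact ((hf.hasF (p := (τ, x)) ⟨hτ, hx⟩).comp x h1 (fun s hs => ⟨hτ, hs⟩)).hasFDerivAt
    (hU.mem_nhds hx)

lemma Sm.hasE (hU : IsOpen U) (hf : Sm t U f) {τ : ℝ} (hτ : τ ∈ Icc 0 t) {x : E} (hx : x ∈ U)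
    (e : E) :
    HasDerivAt (fun s : ℝ => f (τ, x + s • e)) (_root_.dE t U e f (τ, x)) 0 := by
  have h1 : HasDerivAt (fun s : ℝ => x + s • e) e 0 := by
    simpa using ((hasDerivAt_id (0:ℝ)).smul_const e).const_add x
  have h2 := hf.hasFE hU hτ hx
  have h2' : HasFDerivAt (fun y => f (τ, y))
      ((fderivWithin ℝ f (KK t U) (τ, x)).comp (ContinuousLinearMap.inr ℝ ℝ E))
      (x + (0:ℝ) • e) := by simpa using h2
  have h3 := h2'.comp_hasDerivAt (0:ℝ) h1
  exact h3

lemma dT_eq (ht : 0 < t) (hf : Sm t U f) {τ : ℝ} (hτ : τ ∈ Icc 0 t) {x : E} (hx : x ∈ U)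
    {d : ℝ} (h : HasDerivWithinAt (fun s => f (s, x)) d (Icc 0 t) τ) : dT t U f (τ, x) = d :=
  (uniqueDiffOn_Icc ht τ hτ).eq_deriv _ (hf.hasT hτ hx) h

lemma dE_eq (hU : IsOpen U) (hf : Sm t U f) {τ : ℝ} (hτ : τ ∈ Icc 0 t) {x : E} (hx : x ∈ U)
    {e : E} {d : ℝ} (h : HasDerivAt (fun s : ℝ => f (τ, x + s • e)) d 0) :
    dE t U e f (τ, x) = d :=
  (hf.hasE hU hτ hx e).unique h

lemma dT_congr (h : EqOn f g (KK t U)) {p : ℝ × E} (hp : p ∈ KK t U) :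
    dT t U f p = dT t U g p := by
  unfold dT; rw [fderivWithin_congr h (h hp)]

lemma dE_congr (e : E) (h : EqOn f g (KK t U)) {p : ℝ × E} (hp : p ∈ KK t U) :
    dE t U e f p = dE t U e g p := by
  unfold dE; rw [fderivWithin_congr h (h hp)]

lemma dT_dE (ht : 0 < t) (hU : IsOpen U) (e : E) (hf : Sm t U f) {p : ℝ × E} (hp : p ∈ KK t U) :
    dT t U (dE t U e f) p = dE t U e (dT t U f) p := by
  have hs := (hf p hp).isSymmSndFDerivWithinAt two_le_aux (KK_unique ht hU)
    (KK_closure ht hU hp) hp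
  have h : ContDiffOn ℝ (⊤ : ℕ∞) (fderivWithin ℝ f (KK t U)) (KK t U) :=
    hf.fderivWithin (KK_unique ht hU) (by simp)
  have hd := h.differentiableOn (by simp) p hp
  have hu := KK_unique ht hU p hp
  have := hs (1, 0) (0, e)
  unfold dT dE
  rw [fderivWithin_clm_apply hu hd (differentiableWithinAt_const _),
    fderivWithin_clm_apply hu hd (differentiableWithinAt_const _)]
  simpa using this

lemma Sm.contT (hf : Sm t U f) {x : E} (hx : x ∈ U) :
    ContinuousOn (fun s => f (s, x)) (Icc 0 t) :=
  fun _ hτ => (hf.hasT hτ hx).continuousWithinAt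

lemma Sm.freeze (hf : Sm t U f) {σ : ℝ} (hσ : σ ∈ Icc 0 t) : Sm t U (fun p => f (σ, p.2)) := by
  refine ContDiffOn.comp (t := KK t U) hf (f := fun p : ℝ × E => (σ, p.2)) ?_ ?_
  · exact (contDiff_const.prodMk contDiff_snd).contDiffOn
  · exact fun p hp => ⟨hσ, hp.2⟩

lemma Sm.mul (hf : Sm t U f) (hg : Sm t U g) : Sm t U (fun p => f p * g p) := ContDiffOn.mul hf hg
lemma Sm.add (hf : Sm t U f) (hg : Sm t U g) : Sm t U (fun p => f p + g p) := ContDiffOn.add hf hg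
lemma Sm.sub (hf : Sm t U f) (hg : Sm t U g) : Sm t U (fun p => f p - g p) := ContDiffOn.sub hf hg
lemma Sm.neg (hf : Sm t U f) : Sm t U (fun p => - f p) := ContDiffOn.neg hf
lemma Sm.sum {ι : Type*} {s : Finset ι} {f : ι → ℝ × E → ℝ} (hf : ∀ i, Sm t U (f i)) :
    Sm t U (fun p => ∑ i ∈ s, f i p) := ContDiffOn.sum fun i _ => hf i
lemma Sm.const (c : ℝ) : Sm t U (fun _ => c) := contDiffOn_const
lemma Sm.comp {n : ℕ} {F : (Fin n → ℝ) → ℝ} (hF : ContDiff ℝ (⊤ : ℕ∞) F)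
    {f : Fin n → ℝ × E → ℝ} (hf : ∀ i, Sm t U (f i)) : Sm t U (fun p => F (fun i => f i p)) :=
  hF.comp_contDiffOn (contDiffOn_pi.2 hf)

end calculus

lemma pd_smooth {n : ℕ} {F : (Fin n → ℝ) → ℝ} (hF : ContDiff ℝ (⊤ : ℕ∞) F) (j : Fin n) :
    ContDiff ℝ (⊤ : ℕ∞) (pd F j) := by
  have h : ContDiff ℝ (⊤ : ℕ∞) (fderiv ℝ F) := hF.fderiv_right (by simp)
  exact h.clm_apply contDiff_const

lemma chain {n : ℕ} {F : (Fin n → ℝ) → ℝ} (hF : ContDiff ℝ (⊤ : ℕ∞) F)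
    {c : Fin n → ℝ → ℝ} {c' : Fin n → ℝ} {s : Set ℝ} {τ : ℝ}
    (hc : ∀ i, HasDerivWithinAt (c i) (c' i) s τ) :
    HasDerivWithinAt (fun r => F (fun i => c i r)) (∑ p, pd F p (fun i => c i τ) * c' p) s τ := by
  have h1 : HasDerivWithinAt (fun r i => c i r) c' s τ := hasDerivWithinAt_pi.2 hc
  have h2 : HasFDerivAt F (fderiv ℝ F (fun i => c i τ)) (fun i => c i τ) :=
    (hF.differentiable (by simp) _).hasFDerivAt
  have h3 := h2.comp_hasDerivWithinAt τ h1
  have h4 : (fderiv ℝ F fun i => c i τ) c' = ∑ p, pd F p (fun i => c i τ) * c' p := by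
    conv_lhs => rw [pi_eq_sum_univ' c', map_sum]
    refine Finset.sum_congr rfl fun p _ => ?_
    rw [map_smul, smul_eq_mul, mul_comm]
    rfl
  rw [← h4]
  exact h3

lemma pd_comm {n : ℕ} {F : (Fin n → ℝ) → ℝ} (hF : ContDiff ℝ (⊤ : ℕ∞) F) (i j : Fin n)
    (q : Fin n → ℝ) : pd (pd F i) j q = pd (pd F j) i q := by
  have hs := (hF.contDiffAt (x := q)).isSymmSndFDerivAt two_le_aux
  have h : ContDiff ℝ (⊤ : ℕ∞) (fderiv ℝ F) := hF.fderiv_right (by simp)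
  have hd := h.differentiable (by simp) q
  have := hs (Pi.single j 1) (Pi.single i 1)
  unfold pd
  rw [fderiv_clm_apply hd (differentiableAt_const _),
    fderiv_clm_apply hd (differentiableAt_const _)]
  simpa using this

section rules
variable {E : Type*} [NormedAddCommGroup E] [NormedSpace ℝ E]
variable {t : ℝ} {U : Set E} {f g : ℝ × E → ℝ}

lemma dW_mul (ht : 0 < t) (hU : IsOpen U) (hf : Sm t U f) (hg : Sm t U g) {p : ℝ × E}
    (hp : p ∈ KK t U) (w : ℝ × E) :
    fderivWithin ℝ (fun p => f p * g p) (KK t U) p w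
      = fderivWithin ℝ f (KK t U) p w * g p + f p * fderivWithin ℝ g (KK t U) p w := by
  rw [fderivWithin_fun_mul (KK_unique ht hU p hp) (hf.differentiableOn (by simp) p hp)
    (hg.differentiableOn (by simp) p hp)]
  simp; ring

lemma dW_add (ht : 0 < t) (hU : IsOpen U) (hf : Sm t U f) (hg : Sm t U g) {p : ℝ × E}
    (hp : p ∈ KK t U) (w : ℝ × E) :
    fderivWithin ℝ (fun p => f p + g p) (KK t U) p w
      = fderivWithin ℝ f (KK t U) p w + fderivWithin ℝ g (KK t U) p w := by
  rw [fderivWithin_fun_add (KK_unique ht hU p hp) (hf.differentiableOn (by simp) p hp)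
    (hg.differentiableOn (by simp) p hp)]
  simp

lemma dW_neg (ht : 0 < t) (hU : IsOpen U) {p : ℝ × E}
    (hp : p ∈ KK t U) (w : ℝ × E) :
    fderivWithin ℝ (fun p => - f p) (KK t U) p w
      = - fderivWithin ℝ f (KK t U) p w := by
  rw [fderivWithin_fun_neg (KK_unique ht hU p hp)]
  simp

lemma dW_sum (ht : 0 < t) (hU : IsOpen U) {ι : Type*} {s : Finset ι} {f : ι → ℝ × E → ℝ}
    (hf : ∀ i, Sm t U (f i)) {p : ℝ × E}
    (hp : p ∈ KK t U) (w : ℝ × E) :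
    fderivWithin ℝ (fun p => ∑ i ∈ s, f i p) (KK t U) p w
      = ∑ i ∈ s, fderivWithin ℝ (f i) (KK t U) p w := by
  rw [fderivWithin_fun_sum (KK_unique ht hU p hp)
    (fun i _ => (hf i).differentiableOn (by simp) p hp)]
  simp

lemma dW_comp (ht : 0 < t) (hU : IsOpen U) {n : ℕ} {F : (Fin n → ℝ) → ℝ}
    (hF : ContDiff ℝ (⊤ : ℕ∞) F) {f : Fin n → ℝ × E → ℝ} (hf : ∀ i, Sm t U (f i)) {p : ℝ × E}
    (hp : p ∈ KK t U) (w : ℝ × E) :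
    fderivWithin ℝ (fun p => F (fun i => f i p)) (KK t U) p w
      = ∑ q, pd F q (fun i => f i p) * fderivWithin ℝ (f q) (KK t U) p w := by
  have h1 : HasFDerivWithinAt (fun p i => f i p)
      (ContinuousLinearMap.pi fun i => fderivWithin ℝ (f i) (KK t U) p) (KK t U) p :=
    hasFDerivWithinAt_pi.2 fun i => (hf i).hasF hp
  have h2 : HasFDerivAt F (fderiv ℝ F (fun i => f i p)) (fun i => f i p) :=
    (hF.differentiable (by simp) _).hasFDerivAt
  have h3 := (h2.comp_hasFDerivWithinAt p h1).fderivWithin (KK_unique ht hU p hp)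
  have h4 : (fun p => F (fun i => f i p)) = F ∘ (fun p i => f i p) := rfl
  rw [h4, h3]
  have h5 : ∀ c' : Fin n → ℝ, (fderiv ℝ F fun i => f i p) c'
      = ∑ q, pd F q (fun i => f i p) * c' q := by
    intro c'
    conv_lhs => rw [pi_eq_sum_univ' c', map_sum]
    refine Finset.sum_congr rfl fun q _ => ?_
    rw [map_smul, smul_eq_mul, mul_comm]
    rfl
  exact h5 _

lemma dT_mul (ht : 0 < t) (hU : IsOpen U) (hf : Sm t U f) (hg : Sm t U g) {p : ℝ × E}
    (hp : p ∈ KK t U) :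
    dT t U (fun p => f p * g p) p = dT t U f p * g p + f p * dT t U g p :=
  dW_mul ht hU hf hg hp _
lemma dE_mul (ht : 0 < t) (hU : IsOpen U) (hf : Sm t U f) (hg : Sm t U g) {p : ℝ × E}
    (hp : p ∈ KK t U) (e : E) :
    dE t U e (fun p => f p * g p) p = dE t U e f p * g p + f p * dE t U e g p :=
  dW_mul ht hU hf hg hp _
lemma dT_add (ht : 0 < t) (hU : IsOpen U) (hf : Sm t U f) (hg : Sm t U g) {p : ℝ × E}
    (hp : p ∈ KK t U) :
    dT t U (fun p => f p + g p) p = dT t U f p + dT t U g p :=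
  dW_add ht hU hf hg hp _
lemma dE_add (ht : 0 < t) (hU : IsOpen U) (hf : Sm t U f) (hg : Sm t U g) {p : ℝ × E}
    (hp : p ∈ KK t U) (e : E) :
    dE t U e (fun p => f p + g p) p = dE t U e f p + dE t U e g p :=
  dW_add ht hU hf hg hp _
lemma dE_neg (ht : 0 < t) (hU : IsOpen U) {p : ℝ × E}
    (hp : p ∈ KK t U) (e : E) :
    dE t U e (fun p => - f p) p = - dE t U e f p :=
  dW_neg ht hU hp _
lemma dT_sum (ht : 0 < t) (hU : IsOpen U) {ι : Type*} {s : Finset ι} {f : ι → ℝ × E → ℝ}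
    (hf : ∀ i, Sm t U (f i)) {p : ℝ × E} (hp : p ∈ KK t U) :
    dT t U (fun p => ∑ i ∈ s, f i p) p = ∑ i ∈ s, dT t U (f i) p :=
  dW_sum ht hU hf hp _
lemma dE_sum (ht : 0 < t) (hU : IsOpen U) {ι : Type*} {s : Finset ι} {f : ι → ℝ × E → ℝ}
    (hf : ∀ i, Sm t U (f i)) {p : ℝ × E} (hp : p ∈ KK t U) (e : E) :
    dE t U e (fun p => ∑ i ∈ s, f i p) p = ∑ i ∈ s, dE t U e (f i) p :=
  dW_sum ht hU hf hp _
lemma dT_comp (ht : 0 < t) (hU : IsOpen U) {n : ℕ} {F : (Fin n → ℝ) → ℝ}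
    (hF : ContDiff ℝ (⊤ : ℕ∞) F) {f : Fin n → ℝ × E → ℝ} (hf : ∀ i, Sm t U (f i)) {p : ℝ × E}
    (hp : p ∈ KK t U) :
    dT t U (fun p => F (fun i => f i p)) p = ∑ q, pd F q (fun i => f i p) * dT t U (f q) p :=
  dW_comp ht hU hF hf hp _
lemma dE_comp (ht : 0 < t) (hU : IsOpen U) {n : ℕ} {F : (Fin n → ℝ) → ℝ}
    (hF : ContDiff ℝ (⊤ : ℕ∞) F) {f : Fin n → ℝ × E → ℝ} (hf : ∀ i, Sm t U (f i)) {p : ℝ × E}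
    (hp : p ∈ KK t U) (e : E) :
    dE t U e (fun p => F (fun i => f i p)) p = ∑ q, pd F q (fun i => f i p) * dE t U e (f q) p :=
  dW_comp ht hU hF hf hp _

/-- A function of the parameter only has zero time derivative. -/
lemma dT_static (ht : 0 < t) {c : E → ℝ} (hc : Sm t U (fun p => c p.2)) {p : ℝ × E}
    (hp : p ∈ KK t U) : dT t U (fun p => c p.2) p = 0 :=
  dT_eq (f := fun p => c p.2) (x := p.2) (τ := p.1) ht hc hp.1 hp.2
    (hasDerivWithinAt_const p.1 _ (c p.2))

end rules

section jac
variable {E : Type*} [NormedAddCommGroup E] [NormedSpace ℝ E]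
variable {n : ℕ}

/-- The magnetic field. -/
def AA (B : Fin n → (Fin n → ℝ) → ℝ) (i j : Fin n) : (Fin n → ℝ) → ℝ :=
  fun q => pd (B i) j q - pd (B j) i q

/-- The zeroth order coefficient of the Jacobi operator. -/
def RR (B : Fin n → (Fin n → ℝ) → ℝ) (C : (Fin n → ℝ) → ℝ) (t : ℝ) (U : Set E)
    (g : Fin n → ℝ × E → ℝ) (i j : Fin n) (p : ℝ × E) : ℝ :=
  (∑ k, pd (AA B i k) j (fun i => g i p) * dT t U (g k) p) + pd (pd C i) j (fun i => g i p)

/-- Families of Jacobi fields. -/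
structure IsJac (B : Fin n → (Fin n → ℝ) → ℝ) (C : (Fin n → ℝ) → ℝ) (t : ℝ) (U : Set E)
    (g : Fin n → ℝ × E → ℝ) (ζ : Fin n → ℝ × E → ℝ) : Prop where
  sm : ∀ i, Sm t U (ζ i)
  eq : ∀ p ∈ KK t U, ∀ i, dT t U (dT t U (ζ i)) p =
    -((∑ j, AA B i j (fun i => g i p) * dT t U (ζ j) p) + ∑ j, RR B C t U g i j p * ζ j p)

/-- The data of a classical family. -/
structure IsCl (B : Fin n → (Fin n → ℝ) → ℝ) (C : (Fin n → ℝ) → ℝ) (t : ℝ) (U : Set E)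
    (g : Fin n → ℝ × E → ℝ) : Prop where
  ht : 0 < t
  hU : IsOpen U
  hB : ∀ i, ContDiff ℝ (⊤ : ℕ∞) (B i)
  hC : ContDiff ℝ (⊤ : ℕ∞) C
  sm : ∀ i, Sm t U (g i)
  eq : ∀ p ∈ KK t U, ∀ i, dT t U (dT t U (g i)) p =
    -((∑ j, AA B i j (fun i => g i p) * dT t U (g j) p) + pd C i (fun i => g i p))

/-- The differentiated Jacobi operator. -/
def dD (B : Fin n → (Fin n → ℝ) → ℝ) (C : (Fin n → ℝ) → ℝ) (t : ℝ) (U : Set E)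
    (g : Fin n → ℝ × E → ℝ) (e : E) (ζ : Fin n → ℝ × E → ℝ) (l : Fin n) (x : ℝ × E) : ℝ :=
  (∑ p, ∑ r, pd (AA B l r) p (fun i => g i x) * dE t U e (g p) x * dT t U (ζ r) x)
    + ∑ r, ((∑ p, ∑ k, pd (pd (AA B l k) p) r (fun i => g i x) * dE t U e (g p) x
                * dT t U (g k) x)
        + (∑ k, pd (AA B l k) r (fun i => g i x) * dT t U (dE t U e (g k)) x)
        + ∑ p, pd (pd (pd C p) l) r (fun i => g i x) * dE t U e (g p) x) * ζ r x

variable {B : Fin n → (Fin n → ℝ) → ℝ} {C : (Fin n → ℝ) → ℝ} {t : ℝ} {U : Set E}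
  {g : Fin n → ℝ × E → ℝ} {ζ : Fin n → ℝ × E → ℝ}

lemma AA_smooth (hB : ∀ i, ContDiff ℝ (⊤ : ℕ∞) (B i)) (i j : Fin n) :
    ContDiff ℝ (⊤ : ℕ∞) (AA B i j) := (pd_smooth (hB i) j).sub (pd_smooth (hB j) i)

lemma IsCl.smAA (h : IsCl B C t U g) (i j : Fin n) : Sm t U (fun p => AA B i j (fun i => g i p)) :=
  Sm.comp (AA_smooth h.hB i j) h.sm

lemma IsCl.smRR (h : IsCl B C t U g) (i j : Fin n) : Sm t U (RR B C t U g i j) :=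
  (Sm.sum fun k => (Sm.comp (pd_smooth (AA_smooth h.hB i k) j) h.sm).mul
    ((h.sm k).dT h.ht h.hU)).add (Sm.comp (pd_smooth (pd_smooth h.hC i) j) h.sm)

lemma dT2_dE (h : IsCl B C t U g) {f : ℝ × E → ℝ} (hf : Sm t U f) (e : E) {p : ℝ × E}
    (hp : p ∈ KK t U) :
    dT t U (dT t U (dE t U e f)) p = dE t U e (dT t U (dT t U f)) p := by
  rw [dT_congr (fun q hq => dT_dE h.ht h.hU e hf hq) hp, dT_dE h.ht h.hU e (hf.dT h.ht h.hU) hp]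

lemma IsCl.jac (h : IsCl B C t U g) (e : E) : IsJac B C t U g (fun i => dE t U e (g i)) := by
  have ht := h.ht
  have hU := h.hU
  refine ⟨fun i => (h.sm i).dE ht hU e, fun p hp i => ?_⟩
  have hv := fun j => (h.sm j).dT ht hU
  rw [dT2_dE h (h.sm i) e hp, dE_congr e (fun q hq => h.eq q hq i) hp, dE_neg ht hU hp,
    dE_add ht hU (Sm.sum fun j => (h.smAA i j).mul (hv j)) (Sm.comp (pd_smooth h.hC i) h.sm) hp,
    dE_sum ht hU (fun j => (h.smAA i j).mul (hv j)) hp,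
    dE_comp ht hU (pd_smooth h.hC i) h.sm hp]
  congr 1
  have h1 : ∀ j, dE t U e (fun p => AA B i j (fun i => g i p) * dT t U (g j) p) p
      = (∑ q, pd (AA B i j) q (fun i => g i p) * dE t U e (g q) p) * dT t U (g j) p
        + AA B i j (fun i => g i p) * dT t U (dE t U e (g j)) p := by
    intro j
    rw [dE_mul ht hU (h.smAA i j) (hv j) hp, dE_comp ht hU (AA_smooth h.hB i j) h.sm hp,
      dT_dE ht hU e (h.sm j) hp]
  rw [Finset.sum_congr rfl fun j _ => h1 j, Finset.sum_add_distrib]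
  unfold RR
  simp only [add_mul, Finset.sum_add_distrib, Finset.sum_mul]
  rw [Finset.sum_comm (γ := Fin n)]
  have : ∀ a b : Fin n, pd (AA B i b) a (fun i => g i p) * dE t U e (g a) p * dT t U (g b) p =
    pd (AA B i b) a (fun i => g i p) * dT t U (g b) p * dE t U e (g a) p := fun a b => by ring
  simp only [this]
  ring

lemma IsJac.var (h : IsCl B C t U g) (hζ : IsJac B C t U g ζ) (e : E) {p : ℝ × E}
    (hp : p ∈ KK t U) (i : Fin n) :
    dT t U (dT t U (dE t U e (ζ i))) p =
      -((∑ j, AA B i j (fun i => g i p) * dT t U (dE t U e (ζ j)) p)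
          + ∑ j, RR B C t U g i j p * dE t U e (ζ j) p) - dD B C t U g e ζ i p := by
  have ht := h.ht
  have hU := h.hU
  have hv := fun j => (h.sm j).dT ht hU
  have hz := fun j => (hζ.sm j).dT ht hU
  rw [dT2_dE h (hζ.sm i) e hp, dE_congr e (fun q hq => hζ.eq q hq i) hp, dE_neg ht hU hp,
    dE_add ht hU (Sm.sum fun j => (h.smAA i j).mul (hz j))
      (Sm.sum fun j => (h.smRR i j).mul (hζ.sm j)) hp,
    dE_sum ht hU (fun j => (h.smAA i j).mul (hz j)) hp,
    dE_sum ht hU (fun j => (h.smRR i j).mul (hζ.sm j)) hp]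
  have h1 : ∀ j, dE t U e (fun p => AA B i j (fun i => g i p) * dT t U (ζ j) p) p
      = (∑ q, pd (AA B i j) q (fun i => g i p) * dE t U e (g q) p) * dT t U (ζ j) p
        + AA B i j (fun i => g i p) * dT t U (dE t U e (ζ j)) p := by
    intro j
    rw [dE_mul ht hU (h.smAA i j) (hz j) hp, dE_comp ht hU (AA_smooth h.hB i j) h.sm hp,
      dT_dE ht hU e (hζ.sm j) hp]
  have h3 : ∀ j, dE t U e (RR B C t U g i j) p
      = (∑ q, ∑ k, pd (pd (AA B i k) q) j (fun i => g i p) * dE t U e (g q) p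
                * dT t U (g k) p)
        + (∑ k, pd (AA B i k) j (fun i => g i p) * dT t U (dE t U e (g k)) p)
        + ∑ q, pd (pd (pd C q) i) j (fun i => g i p) * dE t U e (g q) p := by
    intro j
    have hk := fun k => Sm.comp (pd_smooth (AA_smooth h.hB i k) j) h.sm
    unfold RR
    rw [dE_add ht hU (Sm.sum fun k => (hk k).mul (hv k))
      (Sm.comp (pd_smooth (pd_smooth h.hC i) j) h.sm) hp,
      dE_sum ht hU (fun k => (hk k).mul (hv k)) hp,
      dE_comp ht hU (pd_smooth (pd_smooth h.hC i) j) h.sm hp]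
    have h4 : ∀ k, dE t U e (fun p => pd (AA B i k) j (fun i => g i p) * dT t U (g k) p) p
      = (∑ q, pd (pd (AA B i k) q) j (fun i => g i p) * dE t U e (g q) p) * dT t U (g k) p
        + pd (AA B i k) j (fun i => g i p) * dT t U (dE t U e (g k)) p := by
      intro k
      rw [dE_mul ht hU (hk k) (hv k) hp, dE_comp ht hU (pd_smooth (AA_smooth h.hB i k) j) h.sm hp,
        dT_dE ht hU e (h.sm k) hp]
      congr 2
      exact Finset.sum_congr rfl fun q _ => by rw [pd_comm (AA_smooth h.hB i k)]
    rw [Finset.sum_congr rfl fun j _ => h4 j, Finset.sum_add_distrib]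
    simp only [Finset.sum_mul]
    rw [Finset.sum_comm (γ := Fin n)]
    congr 1
    refine Finset.sum_congr rfl fun q _ => ?_
    have h5 : pd (pd C i) q = pd (pd C q) i := funext fun x => pd_comm h.hC i q x
    rw [pd_comm (pd_smooth h.hC i) j q, h5]
  have h2 : ∀ j, dE t U e (fun p => RR B C t U g i j p * ζ j p) p
      = dE t U e (RR B C t U g i j) p * ζ j p + RR B C t U g i j p * dE t U e (ζ j) p :=
    fun j => dE_mul ht hU (h.smRR i j) (hζ.sm j) hp e
  rw [Finset.sum_congr rfl fun j _ => h1 j, Finset.sum_congr rfl fun j _ => h2 j,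
    Finset.sum_add_distrib, Finset.sum_add_distrib]
  simp only [h3]
  unfold dD
  have h6 : ∑ j, (∑ q, pd (AA B i j) q (fun i => g i p) * dE t U e (g q) p) * dT t U (ζ j) p
    = ∑ q, ∑ r, pd (AA B i r) q (fun i => g i p) * dE t U e (g q) p * dT t U (ζ r) p := by
    simp only [Finset.sum_mul]
    rw [Finset.sum_comm (γ := Fin n)]
  rw [h6]
  ring

lemma jac_lin (h : IsCl B C t U g) {ι : Type*} [Fintype ι] {φ : ι → Fin n → ℝ × E → ℝ}
    (hφ : ∀ k, IsJac B C t U g (φ k)) {c : ι → E → ℝ} (hc : ∀ k, Sm t U (fun p => c k p.2)) :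
    IsJac B C t U g (fun i p => ∑ k, c k p.2 * φ k i p) := by
  have ht := h.ht
  have hU := h.hU
  have key : ∀ f : ι → ℝ × E → ℝ, (∀ k, Sm t U (f k)) → ∀ p ∈ KK t U,
      dT t U (fun p => ∑ k, c k p.2 * f k p) p = ∑ k, c k p.2 * dT t U (f k) p := by
    intro f hf p hp
    rw [dT_sum ht hU (fun k => (hc k).mul (hf k)) hp]
    refine Finset.sum_congr rfl fun k _ => ?_
    rw [dT_mul ht hU (hc k) (hf k) hp, dT_static ht (hc k) hp]; ring
  refine ⟨fun i => Sm.sum fun k => (hc k).mul ((hφ k).sm i), fun p hp i => ?_⟩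
  rw [dT_congr (fun q hq => key (fun k => φ k i) (fun k => (hφ k).sm i) q hq) hp,
    key (fun k => dT t U (φ k i)) (fun k => ((hφ k).sm i).dT ht hU) p hp,
    Finset.sum_congr rfl fun k _ => congrArg (c k p.2 * ·) ((hφ k).eq p hp i)]
  have k2 : ∀ j, dT t U (fun p => ∑ k, c k p.2 * φ k j p) p = ∑ k, c k p.2 * dT t U (φ k j) p :=
    fun j => key (fun k => φ k j) (fun k => (hφ k).sm j) p hp
  simp only [k2]
  simp only [mul_neg, mul_add, Finset.mul_sum, Finset.sum_neg_distrib, Finset.sum_add_distrib]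
  congr 2
  · rw [Finset.sum_comm]
    exact Finset.sum_congr rfl fun j _ => Finset.sum_congr rfl fun k _ => by ring
  · rw [Finset.sum_comm]
    exact Finset.sum_congr rfl fun j _ => Finset.sum_congr rfl fun k _ => by ring

lemma dT_lin (h : IsCl B C t U g) {ι : Type*} [Fintype ι] {f : ι → ℝ × E → ℝ}
    (hf : ∀ k, Sm t U (f k)) {c : ι → E → ℝ} (hc : ∀ k, Sm t U (fun p => c k p.2))
    {p : ℝ × E} (hp : p ∈ KK t U) :
    dT t U (fun p => ∑ k, c k p.2 * f k p) p = ∑ k, c k p.2 * dT t U (f k) p := by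
  rw [dT_sum h.ht h.hU (fun k => (hc k).mul (hf k)) hp]
  refine Finset.sum_congr rfl fun k _ => ?_
  rw [dT_mul h.ht h.hU (hc k) (hf k) hp, dT_static h.ht (hc k) hp]; ring

end jac

section wr
variable {E : Type*} [NormedAddCommGroup E] [NormedSpace ℝ E]
variable {n : ℕ}

/-- The Wronskian pairing. -/
def Wr (B : Fin n → (Fin n → ℝ) → ℝ) (t : ℝ) (U : Set E)
    (g ξ ζ : Fin n → ℝ × E → ℝ) (p : ℝ × E) : ℝ :=
  (∑ i, (ξ i p * dT t U (ζ i) p + -(dT t U (ξ i) p * ζ i p)))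
    + ∑ i, ∑ j, ξ i p * (AA B i j (fun i => g i p) * ζ j p)

variable {B : Fin n → (Fin n → ℝ) → ℝ} {C : (Fin n → ℝ) → ℝ} {t : ℝ} {U : Set E}
  {g : Fin n → ℝ × E → ℝ} {ξ ζ : Fin n → ℝ × E → ℝ}

lemma Wr_sm (h : IsCl B C t U g) (hξ : ∀ i, Sm t U (ξ i)) (hζ : ∀ i, Sm t U (ζ i)) :
    Sm t U (Wr B t U g ξ ζ) := by
  refine Sm.add (Sm.sum fun i => Sm.add ((hξ i).mul ((hζ i).dT h.ht h.hU))
    (((hξ i).dT h.ht h.hU).mul (hζ i)).neg) ?_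
  exact Sm.sum fun i => Sm.sum fun j => (hξ i).mul ((h.smAA i j).mul (hζ j))

lemma dT_neg (ht : 0 < t) (hU : IsOpen U) {f : ℝ × E → ℝ} {p : ℝ × E}
    (hp : p ∈ KK t U) :
    dT t U (fun p => - f p) p = - dT t U f p :=
  dW_neg ht hU hp _

lemma pd_sub {F G : (Fin n → ℝ) → ℝ} (hF : ContDiff ℝ (⊤ : ℕ∞) F) (hG : ContDiff ℝ (⊤ : ℕ∞) G)
    (j : Fin n) (q : Fin n → ℝ) : pd (fun q => F q - G q) j q = pd F j q - pd G j q := by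
  unfold pd
  rw [fderiv_fun_sub (hF.differentiable (by simp) q) (hG.differentiable (by simp) q)]
  simp

lemma bianchi (hB : ∀ i, ContDiff ℝ (⊤ : ℕ∞) (B i)) (i j k : Fin n) (q : Fin n → ℝ) :
    pd (AA B i k) j q - pd (AA B j k) i q = pd (AA B i j) k q := by
  unfold AA
  rw [pd_sub (pd_smooth (hB i) k) (pd_smooth (hB k) i),
    pd_sub (pd_smooth (hB j) k) (pd_smooth (hB k) j),
    pd_sub (pd_smooth (hB i) j) (pd_smooth (hB j) i),
    pd_comm (hB i) k j, pd_comm (hB k) j i, pd_comm (hB j) k i]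
  ring

lemma RR_sub (h : IsCl B C t U g) (i j : Fin n) (p : ℝ × E) :
    RR B C t U g i j p - RR B C t U g j i p
      = ∑ k, pd (AA B i j) k (fun i => g i p) * dT t U (g k) p := by
  unfold RR
  rw [pd_comm h.hC i j]
  have : ∀ a b c : ℝ, a + b - (c + b) = a - c := fun a b c => by ring
  rw [this, ← Finset.sum_sub_distrib]
  refine Finset.sum_congr rfl fun k _ => ?_
  rw [← bianchi h.hB i j k]
  ring

lemma dT_Wr (h : IsCl B C t U g) (hξ : IsJac B C t U g ξ) (hζ : ∀ i, Sm t U (ζ i))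
    {p : ℝ × E} (hp : p ∈ KK t U) {F : Fin n → ℝ}
    (hF : ∀ i, dT t U (dT t U (ζ i)) p =
      -((∑ j, AA B i j (fun i => g i p) * dT t U (ζ j) p)
          + ∑ j, RR B C t U g i j p * ζ j p) - F i) :
    dT t U (Wr B t U g ξ ζ) p = -∑ i, ξ i p * F i := by
  have ht := h.ht
  have hU := h.hU
  have s1 : ∀ i, Sm t U (fun p => ξ i p * dT t U (ζ i) p) :=
    fun i => (hξ.sm i).mul ((hζ i).dT ht hU)
  have s2 : ∀ i, Sm t U (fun p => dT t U (ξ i) p * ζ i p) :=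
    fun i => ((hξ.sm i).dT ht hU).mul (hζ i)
  have s3 : ∀ i j, Sm t U (fun p => ξ i p * (AA B i j (fun i => g i p) * ζ j p)) :=
    fun i j => (hξ.sm i).mul ((h.smAA i j).mul (hζ j))
  have e1 : ∀ i, dT t U (fun p => ξ i p * dT t U (ζ i) p + -(dT t U (ξ i) p * ζ i p)) p
      = ξ i p * dT t U (dT t U (ζ i)) p - dT t U (dT t U (ξ i)) p * ζ i p := by
    intro i
    rw [dT_add ht hU (s1 i) (s2 i).neg hp, dT_neg ht hU hp,
      dT_mul ht hU (hξ.sm i) ((hζ i).dT ht hU) hp, dT_mul ht hU ((hξ.sm i).dT ht hU) (hζ i) hp]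
    ring
  have e2 : ∀ i j, dT t U (fun p => ξ i p * (AA B i j (fun i => g i p) * ζ j p)) p
      = dT t U (ξ i) p * (AA B i j (fun i => g i p) * ζ j p)
        + ξ i p * ((RR B C t U g i j p - RR B C t U g j i p) * ζ j p
          + AA B i j (fun i => g i p) * dT t U (ζ j) p) := by
    intro i j
    rw [dT_mul ht hU (hξ.sm i) ((h.smAA i j).mul (hζ j)) hp, dT_mul ht hU (h.smAA i j) (hζ j) hp,
      dT_comp ht hU (AA_smooth h.hB i j) h.sm hp, RR_sub h]
  have anti : ∀ i j q, AA B j i q = - AA B i j q := fun i j q => by unfold AA; ring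
  have e0 : dT t U (Wr B t U g ξ ζ) p
      = (∑ i, (ξ i p * dT t U (dT t U (ζ i)) p - dT t U (dT t U (ξ i)) p * ζ i p))
        + ∑ i, ∑ j, (dT t U (ξ i) p * (AA B i j (fun i => g i p) * ζ j p)
        + ξ i p * ((RR B C t U g i j p - RR B C t U g j i p) * ζ j p
          + AA B i j (fun i => g i p) * dT t U (ζ j) p)) := by
    unfold Wr
    rw [dT_add ht hU (Sm.sum fun i => (s1 i).add (s2 i).neg)
      (Sm.sum fun i => Sm.sum fun j => s3 i j) hp,
      dT_sum ht hU (fun i => (s1 i).add (s2 i).neg) hp,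
      dT_sum ht hU (fun i => Sm.sum fun j => s3 i j) hp,
      Finset.sum_congr rfl fun i _ => e1 i,
      Finset.sum_congr rfl fun i _ => dT_sum ht hU (fun j => s3 i j) hp,
      Finset.sum_congr rfl fun i _ => Finset.sum_congr rfl fun j _ => e2 i j]
  rw [e0]
  have e3 : ∑ i, dT t U (dT t U (ξ i)) p * ζ i p
      = ∑ i, ∑ j, -(AA B j i (fun i => g i p) * dT t U (ξ i) p
          + RR B C t U g j i p * ξ i p) * ζ j p := by
    rw [Finset.sum_comm]
    refine Finset.sum_congr rfl fun i _ => ?_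
    rw [hξ.eq p hp i, ← Finset.sum_add_distrib, ← Finset.sum_neg_distrib, Finset.sum_mul]
  have e4 : ∑ i, ξ i p * dT t U (dT t U (ζ i)) p
      = (∑ i, ∑ j, ξ i p * -(AA B i j (fun i => g i p) * dT t U (ζ j) p
          + RR B C t U g i j p * ζ j p)) - ∑ i, ξ i p * F i := by
    rw [← Finset.sum_sub_distrib]
    refine Finset.sum_congr rfl fun i _ => ?_
    rw [hF i, ← Finset.sum_add_distrib, ← Finset.sum_neg_distrib, mul_sub, Finset.mul_sum]
  rw [Finset.sum_sub_distrib, e3, e4]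
  have e6 : (∑ i, ∑ j, ξ i p * -(AA B i j (fun i => g i p) * dT t U (ζ j) p
          + RR B C t U g i j p * ζ j p))
      - (∑ i, ∑ j, -(AA B j i (fun i => g i p) * dT t U (ξ i) p
          + RR B C t U g j i p * ξ i p) * ζ j p)
      + (∑ i, ∑ j, (dT t U (ξ i) p * (AA B i j (fun i => g i p) * ζ j p)
        + ξ i p * ((RR B C t U g i j p - RR B C t U g j i p) * ζ j p
          + AA B i j (fun i => g i p) * dT t U (ζ j) p))) = 0 := by
    simp only [← Finset.sum_sub_distrib, ← Finset.sum_add_distrib]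
    refine Finset.sum_eq_zero fun i _ => Finset.sum_eq_zero fun j _ => ?_
    rw [anti i j]
    ring
  linarith

lemma ftc (ht : 0 < t) (hU : IsOpen U) {f : ℝ × E → ℝ} (hf : Sm t U f) {x : E} (hx : x ∈ U)
    {α β : ℝ} (hα : 0 ≤ α) (hαβ : α ≤ β) (hβ : β ≤ t) :
    ∫ ρ in α..β, dT t U f (ρ, x) = f (β, x) - f (α, x) := by
  have hsub : Icc α β ⊆ Icc 0 t := Icc_subset_Icc hα hβ
  refine intervalIntegral.integral_eq_sub_of_hasDerivAt_of_le (f := fun s => f (s, x)) hαβ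
    ((hf.contT hx).mono hsub) (fun s hs => ?_) ?_
  · exact hf.hasTI ⟨hα.trans_lt hs.1, hs.2.trans_le hβ⟩ hx
  · refine ContinuousOn.intervalIntegrable ?_
    rw [uIcc_of_le hαβ]
    exact ((hf.dT ht hU).contT hx).mono hsub

lemma Wr_const (h : IsCl B C t U g) (hξ : IsJac B C t U g ξ) (hζ : IsJac B C t U g ζ)
    {x : E} (hx : x ∈ U) {α β : ℝ} (hα : 0 ≤ α) (hαβ : α ≤ β) (hβ : β ≤ t) :
    Wr B t U g ξ ζ (α, x) = Wr B t U g ξ ζ (β, x) := by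
  have h1 := ftc h.ht h.hU (Wr_sm h hξ.sm hζ.sm) hx hα hαβ hβ
  have h2 : ∫ ρ in α..β, dT t U (Wr B t U g ξ ζ) (ρ, x) = ∫ ρ in α..β, (0:ℝ) := by
    refine intervalIntegral.integral_congr fun s hs => ?_
    rw [uIcc_of_le hαβ] at hs
    have hp : (s, x) ∈ KK t U := ⟨⟨hα.trans hs.1, hs.2.trans hβ⟩, hx⟩
    show dT t U (Wr B t U g ξ ζ) (s, x) = 0
    rw [dT_Wr (F := 0) h hξ hζ.sm hp (fun i => by simpa using hζ.eq _ hp i)]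
    simp
  rw [h2] at h1
  simp at h1
  linarith

lemma int_dD (h : IsCl B C t U g) (hξ : IsJac B C t U g ξ) (hζ : IsJac B C t U g ζ) (e : E)
    {x : E} (hx : x ∈ U) {α β : ℝ} (hα : 0 ≤ α) (hαβ : α ≤ β) (hβ : β ≤ t) :
    ∫ ρ in α..β, ∑ l, ξ l (ρ, x) * dD B C t U g e ζ l (ρ, x)
      = Wr B t U g ξ (fun i => dE t U e (ζ i)) (α, x)
        - Wr B t U g ξ (fun i => dE t U e (ζ i)) (β, x) := by
  have hs := fun i => (hζ.sm i).dE h.ht h.hU e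
  have h1 := ftc h.ht h.hU (Wr_sm h hξ.sm hs) hx hα hαβ hβ
  have h2 : ∫ ρ in α..β, dT t U (Wr B t U g ξ (fun i => dE t U e (ζ i))) (ρ, x)
      = ∫ ρ in α..β, -∑ l, ξ l (ρ, x) * dD B C t U g e ζ l (ρ, x) := by
    refine intervalIntegral.integral_congr fun s hs' => ?_
    rw [uIcc_of_le hαβ] at hs'
    have hp : (s, x) ∈ KK t U := ⟨⟨hα.trans hs'.1, hs'.2.trans hβ⟩, hx⟩
    exact dT_Wr h hξ hs hp (fun i => hζ.var h e hp i)
  rw [h2, intervalIntegral.integral_neg] at h1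
  linarith

lemma intble_dD (h : IsCl B C t U g) (hξ : IsJac B C t U g ξ) (hζ : IsJac B C t U g ζ) (e : E)
    {x : E} (hx : x ∈ U) {α β : ℝ} (hα : 0 ≤ α) (hαβ : α ≤ β) (hβ : β ≤ t) :
    IntervalIntegrable (fun ρ => ∑ l, ξ l (ρ, x) * dD B C t U g e ζ l (ρ, x)) volume α β := by
  have hs := fun i => (hζ.sm i).dE h.ht h.hU e
  have h1 := (((Wr_sm h hξ.sm hs).dT h.ht h.hU).contT hx).neg.mono (Icc_subset_Icc hα hβ)
  refine ContinuousOn.intervalIntegrable ?_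
  rw [uIcc_of_le hαβ]
  refine h1.congr fun s hs' => ?_
  have hp : (s, x) ∈ KK t U := ⟨⟨hα.trans hs'.1, hs'.2.trans hβ⟩, hx⟩
  simp only [Pi.neg_apply]
  rw [dT_Wr h hξ hs hp (fun i => hζ.var h e hp i), neg_neg]

lemma dE_fderiv (hU : IsOpen U) {f : ℝ × E → ℝ} (hf : Sm t U f) {τ : ℝ} (hτ : τ ∈ Icc 0 t) {x : E}
    (hx : x ∈ U) (e : E) : fderiv ℝ (fun y => f (τ, y)) x e = dE t U e f (τ, x) := by
  rw [(hf.hasFE hU hτ hx).fderiv]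
  simp [dE]

lemma dE_slice (hU : IsOpen U) {f f' : ℝ × E → ℝ} (hf : Sm t U f) (hf' : Sm t U f') {τ : ℝ}
    (hτ : τ ∈ Icc 0 t) {x : E} (hx : x ∈ U) (e : E) (c : ℝ)
    (heq : ∀ y ∈ U, f (τ, y) = f' (τ, y) + c) : dE t U e f (τ, x) = dE t U e f' (τ, x) := by
  rw [← dE_fderiv hU hf hτ hx, ← dE_fderiv hU hf' hτ hx]
  have : (fun y => f (τ, y)) =ᶠ[nhds x] fun y => f' (τ, y) + c := by
    filter_upwards [hU.mem_nhds hx] with y hy using heq y hy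
  rw [this.fderiv_eq, fderiv_add_const]

/-- The two branches of a Green's kernel column. -/
structure IsGr (B : Fin n → (Fin n → ℝ) → ℝ) (C : (Fin n → ℝ) → ℝ) (t : ℝ) (U : Set E)
    (g : Fin n → ℝ × E → ℝ) (σ : ℝ) (i : Fin n) (Zp Zm : Fin n → ℝ × E → ℝ) : Prop where
  jp : IsJac B C t U g Zp
  jm : IsJac B C t U g Zm
  zm : ∀ x ∈ U, ∀ r, Zm r (0, x) = 0
  zp : ∀ x ∈ U, ∀ r, Zp r (t, x) = 0
  cont : ∀ x ∈ U, ∀ r, Zp r (σ, x) = Zm r (σ, x)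
  jump : ∀ x ∈ U, ∀ r, dT t U (Zp r) (σ, x) = dT t U (Zm r) (σ, x) + -(if r = i then 1 else 0)

variable {σ : ℝ} {i : Fin n} {Zp Zm u : Fin n → ℝ × E → ℝ}

lemma Wr_source (hZ : IsGr B C t U g σ i Zp Zm) {x : E} (hx : x ∈ U) :
    Wr B t U g Zp u (σ, x) - Wr B t U g Zm u (σ, x) = u i (σ, x) := by
  unfold Wr
  simp only [hZ.cont x hx, hZ.jump x hx]
  rw [add_sub_add_right_eq_sub, ← Finset.sum_sub_distrib]
  rw [Finset.sum_eq_single i]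
  · simp; ring
  · intro b _ hb
    simp [hb]
  · simp

lemma Wr_target (h : IsCl B C t U g) (hZ : IsGr B C t U g σ i Zp Zm) (hσ : σ ∈ Icc 0 t) (e : E)
    {x : E} (hx : x ∈ U) :
    Wr B t U g u (fun i => dE t U e (Zp i)) (σ, x)
      = Wr B t U g u (fun i => dE t U e (Zm i)) (σ, x) := by
  have h1 : ∀ r, dE t U e (Zp r) (σ, x) = dE t U e (Zm r) (σ, x) := fun r =>
    dE_slice h.hU (hZ.jp.sm r) (hZ.jm.sm r) hσ hx e 0 (fun y hy => by simpa using hZ.cont y hy r)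
  have h2 : ∀ r, dT t U (dE t U e (Zp r)) (σ, x) = dT t U (dE t U e (Zm r)) (σ, x) := fun r => by
    have hp : (σ, x) ∈ KK t U := ⟨hσ, hx⟩
    rw [dT_dE h.ht h.hU e (hZ.jp.sm r) hp, dT_dE h.ht h.hU e (hZ.jm.sm r) hp]
    exact dE_slice h.hU ((hZ.jp.sm r).dT h.ht h.hU) ((hZ.jm.sm r).dT h.ht h.hU) hσ hx e _
      (fun y hy => hZ.jump y hy r)
  unfold Wr
  simp only [h1, h2]

lemma Wr_zero {p : ℝ × E} {ξ u : Fin n → ℝ × E → ℝ} (h1 : ∀ r, ξ r p = 0) (h2 : ∀ r, u r p = 0) :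
    Wr B t U g ξ u p = 0 := by
  unfold Wr
  simp [h1, h2]

lemma Wr_left (h : IsCl B C t U g) {τ : ℝ} {j : Fin n} {Yp Ym : Fin n → ℝ × E → ℝ}
    (hZ : IsGr B C t U g σ i Zp Zm) (hY : IsGr B C t U g τ j Yp Ym) (e : E)
    {x : E} (hx : x ∈ U) :
    Wr B t U g Zm (fun i => dE t U e (Ym i)) (0, x) = 0 :=
  Wr_zero (hZ.zm x hx) fun r => by
    have := dE_slice h.hU (hY.jm.sm r) (Sm.const 0) (left_mem_Icc.2 h.ht.le) hx e 0
      (fun y hy => by simpa using hY.zm y hy r)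
    rw [this]; simp [dE]

lemma Wr_right (h : IsCl B C t U g) {τ : ℝ} {j : Fin n} {Yp Ym : Fin n → ℝ × E → ℝ}
    (hZ : IsGr B C t U g σ i Zp Zm) (hY : IsGr B C t U g τ j Yp Ym) (e : E)
    {x : E} (hx : x ∈ U) :
    Wr B t U g Zp (fun i => dE t U e (Yp i)) (t, x) = 0 :=
  Wr_zero (hZ.zp x hx) fun r => by
    have := dE_slice h.hU (hY.jp.sm r) (Sm.const 0) (right_mem_Icc.2 h.ht.le) hx e 0
      (fun y hy => by simpa using hY.zp y hy r)
    rw [this]; simp [dE]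

lemma main_lt (h : IsCl B C t U g) {τ : ℝ} {j : Fin n} {Yp Ym : Fin n → ℝ × E → ℝ}
    (hZ : IsGr B C t U g σ i Zp Zm) (hY : IsGr B C t U g τ j Yp Ym) (e : E)
    {x : E} (hx : x ∈ U) (h0 : 0 < σ) (h1 : σ < τ) (h2 : τ < t) :
    (∫ ρ in (0:ℝ)..σ, ∑ l, Zm l (ρ, x) * dD B C t U g e Ym l (ρ, x))
    + (∫ ρ in σ..τ, ∑ l, Zp l (ρ, x) * dD B C t U g e Ym l (ρ, x))
    + (∫ ρ in τ..t, ∑ l, Zp l (ρ, x) * dD B C t U g e Yp l (ρ, x))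
      = dE t U e (Ym i) (σ, x) := by
  rw [int_dD h hZ.jm hY.jm e hx le_rfl h0.le (h1.trans h2).le,
    int_dD h hZ.jp hY.jm e hx h0.le h1.le h2.le,
    int_dD h hZ.jp hY.jp e hx (h0.trans h1).le h2.le le_rfl,
    Wr_left h hZ hY e hx, Wr_right h hZ hY e hx, Wr_target h hY ⟨(h0.trans h1).le, h2.le⟩ e hx,
    ← Wr_source (u := fun i => dE t U e (Ym i)) hZ hx]
  ring

lemma main_gt (h : IsCl B C t U g) {τ : ℝ} {j : Fin n} {Yp Ym : Fin n → ℝ × E → ℝ}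
    (hZ : IsGr B C t U g σ i Zp Zm) (hY : IsGr B C t U g τ j Yp Ym) (e : E)
    {x : E} (hx : x ∈ U) (h0 : 0 < τ) (h1 : τ < σ) (h2 : σ < t) :
    (∫ ρ in (0:ℝ)..τ, ∑ l, Zm l (ρ, x) * dD B C t U g e Ym l (ρ, x))
    + (∫ ρ in τ..σ, ∑ l, Zm l (ρ, x) * dD B C t U g e Yp l (ρ, x))
    + (∫ ρ in σ..t, ∑ l, Zp l (ρ, x) * dD B C t U g e Yp l (ρ, x))
      = dE t U e (Yp i) (σ, x) := by
  rw [int_dD h hZ.jm hY.jm e hx le_rfl h0.le (h1.trans h2).le,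
    int_dD h hZ.jm hY.jp e hx h0.le h1.le h2.le,
    int_dD h hZ.jp hY.jp e hx (h0.trans h1).le h2.le le_rfl,
    Wr_left h hZ hY e hx, Wr_right h hZ hY e hx, Wr_target h hY ⟨h0.le, (h1.trans h2).le⟩ e hx,
    ← Wr_source (u := fun i => dE t U e (Yp i)) hZ hx]
  ring

end wr

section linalg
open Matrix
variable {n : ℕ}

lemma lagrangian (P0 P1 Q0 Q1 A H : Matrix (Fin n) (Fin n) ℝ) (hH : IsUnit H.det)
    (h00 : P0 * A * P0ᵀ + P0 * Q0ᵀ - Q0 * P0ᵀ = 0)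
    (h11 : P1 * A * P1ᵀ + P1 * Q1ᵀ - Q1 * P1ᵀ = 0)
    (h01 : P0 * A * P1ᵀ + P0 * Q1ᵀ - Q0 * P1ᵀ = H) (hA : Aᵀ = -A) :
    P0ᵀ * Hᵀ⁻¹ * P1 = P1ᵀ * H⁻¹ * P0 ∧ Q0ᵀ * Hᵀ⁻¹ * P1 = Q1ᵀ * H⁻¹ * P0 - 1 := by
  have h10 : P1 * A * P0ᵀ + P1 * Q0ᵀ - Q1 * P0ᵀ = -Hᵀ := by
    rw [← h01]
    simp only [transpose_sub, transpose_add, transpose_mul, transpose_transpose, hA,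
      Matrix.mul_neg, Matrix.neg_mul, Matrix.mul_assoc]
    abel
  have hHT : IsUnit Hᵀ.det := by rwa [det_transpose]
  let X : Matrix (Fin n ⊕ Fin n) (Fin n ⊕ Fin n) ℝ := fromBlocks P0 Q0 P1 Q1
  let J : Matrix (Fin n ⊕ Fin n) (Fin n ⊕ Fin n) ℝ := fromBlocks A 1 (-1) 0
  let J' : Matrix (Fin n ⊕ Fin n) (Fin n ⊕ Fin n) ℝ := fromBlocks 0 (-1) 1 A
  let K : Matrix (Fin n ⊕ Fin n) (Fin n ⊕ Fin n) ℝ := fromBlocks 0 (-Hᵀ⁻¹) H⁻¹ 0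
  have hJ : J' * J = 1 := by
    simp [J, J', fromBlocks_multiply, ← fromBlocks_one]
  have hX : X * J * Xᵀ * K = 1 := by
    have : X * J * Xᵀ = fromBlocks 0 H (-Hᵀ) 0 := by
      simp only [X, J, fromBlocks_multiply, fromBlocks_transpose, Matrix.mul_one, Matrix.mul_neg,
        Matrix.mul_zero, add_zero, Matrix.add_mul, Matrix.neg_mul]
      rw [fromBlocks_inj]
      refine ⟨?_, ?_, ?_, ?_⟩
      · rw [← h00]; abel
      · rw [← h01]; abel
      · rw [← h10]; abel
      · rw [← h11]; abel
    rw [this]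
    simp [K, fromBlocks_multiply, ← fromBlocks_one, mul_nonsing_inv _ hH, mul_nonsing_inv _ hHT]
  have h2 : J * Xᵀ * K * X = 1 := by
    have : X * (J * Xᵀ * K) = 1 := by rw [← hX]; simp only [Matrix.mul_assoc]
    exact mul_eq_one_comm.1 this
  have h3 : Xᵀ * K * X = J' := by
    calc Xᵀ * K * X = (J' * J) * (Xᵀ * K * X) := by rw [hJ, Matrix.one_mul]
      _ = J' * (J * Xᵀ * K * X) := by simp only [Matrix.mul_assoc]
      _ = J' := by rw [h2, Matrix.mul_one]
  simp only [X, K, J', fromBlocks_transpose, fromBlocks_multiply, fromBlocks_inj, Matrix.mul_zero,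
    zero_add, add_zero, Matrix.mul_neg, Matrix.neg_mul] at h3
  constructor
  · have := h3.1
    rw [add_neg_eq_zero] at this
    exact this.symm
  · have := h3.2.2.1
    rw [← this]; abel

end linalg

section ode
variable {n : ℕ}

lemma ode_zero {t : ℝ} (ht : 0 < t) (A R : Fin n → Fin n → ℝ → ℝ)
    (hA : ∀ i j, ContinuousOn (A i j) (Icc 0 t)) (hR : ∀ i j, ContinuousOn (R i j) (Icc 0 t))
    (ξ η : Fin n → ℝ → ℝ)
    (h1 : ∀ i, ∀ s ∈ Icc 0 t, HasDerivWithinAt (ξ i) (η i s) (Icc 0 t) s)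
    (h2 : ∀ i, ∀ s ∈ Icc 0 t, HasDerivWithinAt (η i)
      (-((∑ j, A i j s * η j s) + ∑ j, R i j s * ξ j s)) (Icc 0 t) s)
    (hξ : ∀ i, ξ i t = 0) (hη : ∀ i, η i t = 0) : ∀ i, ξ i 0 = 0 := by
  have bd : ∀ F : Fin n → Fin n → ℝ → ℝ, (∀ i j, ContinuousOn (F i j) (Icc 0 t)) →
      ∃ M : ℝ, 0 ≤ M ∧ ∀ i j, ∀ s ∈ Icc 0 t, |F i j s| ≤ M := by
    intro F hF
    have : ∀ i j, ∃ M, ∀ s ∈ Icc 0 t, ‖F i j s‖ ≤ M := fun i j =>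
      isCompact_Icc.exists_bound_of_continuousOn (hF i j)
    choose M hM using this
    refine ⟨∑ i, ∑ j, |M i j|, by positivity, fun i j s hs => ?_⟩
    calc |F i j s| ≤ |M i j| := (hM i j s hs).trans (le_abs_self _)
      _ ≤ ∑ j, |M i j| := Finset.single_le_sum (f := fun j => |M i j|)
          (fun _ _ => abs_nonneg _) (Finset.mem_univ j)
      _ ≤ _ := Finset.single_le_sum (f := fun i => ∑ j, |M i j|)
          (fun _ _ => by positivity) (Finset.mem_univ i)
  obtain ⟨MA, hMA0, hMA⟩ := bd A hA
  obtain ⟨MR, hMR0, hMR⟩ := bd R hR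
  let v : ℝ → (Fin n → ℝ) × (Fin n → ℝ) → (Fin n → ℝ) × (Fin n → ℝ) := fun s y =>
    (y.2, fun i => -((∑ j, A i j s * y.2 j) + ∑ j, R i j s * y.1 j))
  let Kc : ℝ := 1 + n * MA + n * MR
  have hK : 0 ≤ Kc := by positivity
  have hv : ∀ s ∈ Ioc 0 t, LipschitzOnWith ⟨Kc, hK⟩ (v s) univ := by
    intro s hs
    have hs' : s ∈ Icc 0 t := Ioc_subset_Icc_self hs
    refine LipschitzOnWith.of_dist_le_mul fun y _ z _ => ?_
    have hd : 0 ≤ dist y z := dist_nonneg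
    have d1 : ∀ j, |y.1 j - z.1 j| ≤ dist y z := fun j =>
      (dist_le_pi_dist y.1 z.1 j).trans (le_max_left _ _)
    have d2 : ∀ j, |y.2 j - z.2 j| ≤ dist y z := fun j =>
      (dist_le_pi_dist y.2 z.2 j).trans (le_max_right _ _)
    have hKc : (0:ℝ) ≤ n * MA * dist y z := by positivity
    have hKc' : (0:ℝ) ≤ n * MR * dist y z := by positivity
    show dist (v s y) (v s z) ≤ Kc * dist y z
    have hle : dist y.2 z.2 ≤ dist y z := le_max_right _ _
    have hKe : Kc * dist y z = dist y z + n * MA * dist y z + n * MR * dist y z := by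
      simp only [Kc]; ring
    refine (max_le ?_ ?_ : max (dist (v s y).1 (v s z).1) (dist (v s y).2 (v s z).2) ≤ _)
    · refine hle.trans ?_
      rw [hKe]; linarith
    · refine (dist_pi_le_iff (by positivity)).2 fun i => ?_
      have e : dist ((v s y).2 i) ((v s z).2 i)
          = |(∑ j, A i j s * (y.2 j - z.2 j)) + ∑ j, R i j s * (y.1 j - z.1 j)| := by
        rw [Real.dist_eq, ← abs_neg]
        congr 1
        simp only [v, mul_sub, Finset.sum_sub_distrib]
        ring
      rw [e]
      have b1 : |∑ j, A i j s * (y.2 j - z.2 j)| ≤ n * MA * dist y z := by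
        refine (Finset.abs_sum_le_sum_abs _ _).trans ?_
        refine (Finset.sum_le_sum (g := fun _ => MA * dist y z) fun j _ => ?_).trans ?_
        · rw [abs_mul]; exact mul_le_mul (hMA i j s hs') (d2 j) (abs_nonneg _) hMA0
        · simp [mul_assoc]
      have b2 : |∑ j, R i j s * (y.1 j - z.1 j)| ≤ n * MR * dist y z := by
        refine (Finset.abs_sum_le_sum_abs _ _).trans ?_
        refine (Finset.sum_le_sum (g := fun _ => MR * dist y z) fun j _ => ?_).trans ?_
        · rw [abs_mul]; exact mul_le_mul (hMR i j s hs') (d1 j) (abs_nonneg _) hMR0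
        · simp [mul_assoc]
      refine (abs_add_le _ _).trans ?_
      rw [hKe]; linarith
  let f : ℝ → (Fin n → ℝ) × (Fin n → ℝ) := fun s => (fun i => ξ i s, fun i => η i s)
  have hf' : ∀ s ∈ Icc 0 t, HasDerivWithinAt f (v s (f s)) (Icc 0 t) s := fun s hs =>
    (hasDerivWithinAt_pi.2 fun i => h1 i s hs).prodMk (hasDerivWithinAt_pi.2 fun i => h2 i s hs)
  have key : EqOn f (fun _ => 0) (Icc 0 t) := by
    refine ODE_solution_unique_of_mem_Icc_left (v := v) (s := fun _ => univ) hv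
      (fun s hs => (hf' s hs).continuousWithinAt) (fun s hs => ?_) (fun _ _ => trivial)
      continuousOn_const (fun s hs => ?_) (fun _ _ => trivial) ?_
    · refine (hf' s (Ioc_subset_Icc_self hs)).mono_of_mem_nhdsWithin ?_
      exact mem_nhdsWithin.2 ⟨Ioi 0, isOpen_Ioi, hs.1, fun r hr => ⟨le_of_lt hr.1, le_trans hr.2 hs.2⟩⟩
    · have : v s 0 = 0 := by
        ext i <;> simp [v]
      show HasDerivWithinAt (fun _ => (0 : (Fin n → ℝ) × (Fin n → ℝ))) (v s 0) _ _
      rw [this]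
      exact hasDerivWithinAt_const _ _ _
    · ext i <;> simp [f, hξ, hη]
  intro i
  have := key (left_mem_Icc.2 ht.le)
  exact congrFun (congrArg Prod.fst this) i

end ode

section green
open Matrix
variable {E : Type*} [NormedAddCommGroup E] [NormedSpace ℝ E]
variable {n : ℕ} {B : Fin n → (Fin n → ℝ) → ℝ} {C : (Fin n → ℝ) → ℝ} {t : ℝ} {U : Set E}
  {g : Fin n → ℝ × E → ℝ} {φ0 φ1 : Fin n → Fin n → ℝ × E → ℝ}

/-- A fundamental system of Jacobi fields adapted to the boundary conditions. -/
structure IsFund (B : Fin n → (Fin n → ℝ) → ℝ) (C : (Fin n → ℝ) → ℝ) (t : ℝ) (U : Set E)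
    (g : Fin n → ℝ × E → ℝ) (φ0 φ1 : Fin n → Fin n → ℝ × E → ℝ) : Prop where
  j0 : ∀ k, IsJac B C t U g (φ0 k)
  j1 : ∀ k, IsJac B C t U g (φ1 k)
  b00 : ∀ x ∈ U, ∀ k i, φ0 k i (0, x) = (1 : Matrix (Fin n) (Fin n) ℝ) k i
  b0t : ∀ x ∈ U, ∀ k i, φ0 k i (t, x) = 0
  b10 : ∀ x ∈ U, ∀ k i, φ1 k i (0, x) = 0
  b1t : ∀ x ∈ U, ∀ k i, φ1 k i (t, x) = (1 : Matrix (Fin n) (Fin n) ℝ) k i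

/-- The mixed Hessian, in terms of Jacobi fields. -/
def HH (t : ℝ) (U : Set E) (φ0 : Fin n → Fin n → ℝ × E → ℝ) (x : E) : Matrix (Fin n) (Fin n) ℝ :=
  Matrix.of fun k l => - dT t U (φ0 k l) (t, x)

lemma HH_unit (h : IsCl B C t U g) (hF : IsFund B C t U g φ0 φ1) {x : E} (hx : x ∈ U) :
    IsUnit (HH t U φ0 x).det := by
  have ht := h.ht
  have hU := h.hU
  rw [isUnit_iff_ne_zero]
  intro hdet
  obtain ⟨c, hc0, hc⟩ := exists_vecMul_eq_zero_iff.2 hdet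
  apply hc0
  have hsm : ∀ k, Sm t U (fun p => (fun (k : Fin n) (_ : E) => c k) k p.2) := fun k => Sm.const (c k)
  have hj := jac_lin (c := fun k _ => c k) h hF.j0 hsm
  let ζ : Fin n → ℝ × E → ℝ := fun i p => ∑ k, c k * φ0 k i p
  have hj : IsJac B C t U g ζ := hj
  have hz := ode_zero ht (fun i j s => AA B i j (fun i => g i (s, x)))
    (fun i j s => RR B C t U g i j (s, x))
    (fun i j => (h.smAA i j).contT hx) (fun i j => (h.smRR i j).contT hx)
    (fun i s => ζ i (s, x)) (fun i s => dT t U (ζ i) (s, x))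
    (fun i s hs => (hj.sm i).hasT hs hx)
    (fun i s hs => by
      have := ((hj.sm i).dT ht hU).hasT hs hx
      rwa [hj.eq (s, x) ⟨hs, hx⟩ i] at this)
    (fun i => by simp [ζ, hF.b0t x hx])
    (fun i => by
      have : dT t U (ζ i) (t, x) = ∑ k, c k * dT t U (φ0 k i) (t, x) :=
        dT_lin (c := fun k _ => c k) h (fun k => (hF.j0 k).sm i) hsm ⟨right_mem_Icc.2 ht.le, hx⟩
      show dT t U (ζ i) (t, x) = 0
      rw [this]
      have h3 := congrFun hc i
      simp only [vecMul, dotProduct, HH, of_apply, mul_neg, Finset.sum_neg_distrib,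
        Pi.zero_apply, neg_eq_zero] at h3
      exact h3)
  funext i
  have := hz i
  simpa [ζ, hF.b00 x hx, Matrix.one_apply] using this

lemma HH_sm (h : IsCl B C t U g) (hF : IsFund B C t U g φ0 φ1) (k l : Fin n) :
    Sm t U (fun p => HH t U φ0 p.2 k l) :=
  ((((hF.j0 k).sm l).dT h.ht h.hU).freeze (right_mem_Icc.2 h.ht.le)).neg

lemma det_sm {M : E → Matrix (Fin n) (Fin n) ℝ} (hM : ∀ k l, Sm t U (fun p => M p.2 k l)) :
    Sm t U (fun p => (M p.2).det) := by
  simp only [Matrix.det_apply']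
  refine Sm.sum fun s => (Sm.const _).mul ?_
  exact contDiffOn_prod fun i _ => hM _ _

lemma inv_sm {M : E → Matrix (Fin n) (Fin n) ℝ} (hM : ∀ k l, Sm t U (fun p => M p.2 k l))
    (hu : ∀ x ∈ U, IsUnit (M x).det) (k l : Fin n) : Sm t U (fun p => (M p.2)⁻¹ k l) := by
  have h1 : ∀ x, (M x)⁻¹ k l = ((M x).det)⁻¹ * ((M x).updateRow l (Pi.single k 1)).det := by
    intro x
    rw [Matrix.inv_def, Matrix.smul_apply, Ring.inverse_eq_inv', smul_eq_mul, Matrix.adjugate_apply]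
  simp only [h1]
  refine Sm.mul ?_ ?_
  · exact ContDiffOn.inv (det_sm hM) fun p hp => (hu p.2 hp.2).ne_zero
  · refine det_sm (M := fun x => (M x).updateRow l (Pi.single k 1)) fun i j => ?_
    by_cases hi : i = l
    · subst hi
      simp only [Matrix.updateRow_self]
      exact Sm.const _
    · simp only [Matrix.updateRow_ne hi]
      exact hM i j

/-- Upper branch. -/
def Zp (t : ℝ) (U : Set E) (φ0 φ1 : Fin n → Fin n → ℝ × E → ℝ) (σ : ℝ) (i r : Fin n)
    (p : ℝ × E) : ℝ :=
  ∑ k, (∑ l, (HH t U φ0 p.2)ᵀ⁻¹ k l * φ1 l i (σ, p.2)) * φ0 k r p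

/-- Lower branch. -/
def Zm (t : ℝ) (U : Set E) (φ0 φ1 : Fin n → Fin n → ℝ × E → ℝ) (σ : ℝ) (i r : Fin n)
    (p : ℝ × E) : ℝ :=
  ∑ k, (∑ l, (HH t U φ0 p.2)⁻¹ k l * φ0 l i (σ, p.2)) * φ1 k r p

lemma isGr (h : IsCl B C t U g) (hF : IsFund B C t U g φ0 φ1) {σ : ℝ} (hσ : σ ∈ Icc 0 t)
    (i : Fin n) : IsGr B C t U g σ i (Zp t U φ0 φ1 σ i) (Zm t U φ0 φ1 σ i) := by
  have ht := h.ht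
  have hU := h.hU
  have hH := HH_sm h hF
  have hu : ∀ x ∈ U, IsUnit (HH t U φ0 x).det := fun x hx => HH_unit h hF hx
  have cp : ∀ k, Sm t U (fun p => (fun (k : Fin n) (x : E) =>
      ∑ l, (HH t U φ0 x)ᵀ⁻¹ k l * φ1 l i (σ, x)) k p.2) := fun k =>
    Sm.sum fun l => Sm.mul (inv_sm (M := fun x => (HH t U φ0 x)ᵀ) (fun k l => hH l k)
      (fun x hx => by rw [det_transpose]; exact hu x hx) k l) (((hF.j1 l).sm i).freeze hσ)
  have cm : ∀ k, Sm t U (fun p => (fun (k : Fin n) (x : E) =>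
      ∑ l, (HH t U φ0 x)⁻¹ k l * φ0 l i (σ, x)) k p.2) := fun k =>
    Sm.sum fun l => Sm.mul (inv_sm (M := fun x => HH t U φ0 x) hH hu k l)
      (((hF.j0 l).sm i).freeze hσ)
  have key : ∀ x ∈ U, ∀ r, Zp t U φ0 φ1 σ i r (σ, x) = Zm t U φ0 φ1 σ i r (σ, x) ∧
      dT t U (Zp t U φ0 φ1 σ i r) (σ, x)
        = dT t U (Zm t U φ0 φ1 σ i r) (σ, x) + -(if r = i then 1 else 0) := by
    intro x hx r
    let P0 : Matrix (Fin n) (Fin n) ℝ := of fun k i => φ0 k i (σ, x)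
    let P1 : Matrix (Fin n) (Fin n) ℝ := of fun k i => φ1 k i (σ, x)
    let Q0 : Matrix (Fin n) (Fin n) ℝ := of fun k i => dT t U (φ0 k i) (σ, x)
    let Q1 : Matrix (Fin n) (Fin n) ℝ := of fun k i => dT t U (φ1 k i) (σ, x)
    let A : Matrix (Fin n) (Fin n) ℝ := of fun i j => AA B i j (fun i => g i (σ, x))
    have wr : ∀ (α β : Fin n → Fin n → ℝ × E → ℝ) (k l : Fin n),
        ((of fun k i => α k i (σ, x) : Matrix (Fin n) (Fin n) ℝ) * A
          * (of fun k i => β k i (σ, x) : Matrix (Fin n) (Fin n) ℝ)ᵀ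
        + (of fun k i => α k i (σ, x) : Matrix (Fin n) (Fin n) ℝ)
          * (of fun k i => dT t U (β k i) (σ, x) : Matrix (Fin n) (Fin n) ℝ)ᵀ
        - (of fun k i => dT t U (α k i) (σ, x) : Matrix (Fin n) (Fin n) ℝ)
          * (of fun k i => β k i (σ, x) : Matrix (Fin n) (Fin n) ℝ)ᵀ) k l
        = Wr B t U g (α k) (β l) (σ, x) := by
      intro α β k l
      rw [Matrix.mul_assoc]
      simp only [Wr, Matrix.sub_apply, Matrix.add_apply, Matrix.mul_apply, of_apply,
        transpose_apply, A, Finset.sum_add_distrib, Finset.sum_neg_distrib, Finset.mul_sum]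
      ring
    have h00 : P0 * A * P0ᵀ + P0 * Q0ᵀ - Q0 * P0ᵀ = 0 := by
      ext k l
      rw [wr φ0 φ0, Wr_const h (hF.j0 k) (hF.j0 l) hx hσ.1 hσ.2 le_rfl]
      exact Wr_zero (hF.b0t x hx k) (hF.b0t x hx l)
    have h11 : P1 * A * P1ᵀ + P1 * Q1ᵀ - Q1 * P1ᵀ = 0 := by
      ext k l
      rw [wr φ1 φ1, ← Wr_const h (hF.j1 k) (hF.j1 l) hx le_rfl hσ.1 hσ.2]
      exact Wr_zero (hF.b10 x hx k) (hF.b10 x hx l)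
    have h01 : P0 * A * P1ᵀ + P0 * Q1ᵀ - Q0 * P1ᵀ = HH t U φ0 x := by
      ext k l
      rw [wr φ0 φ1, Wr_const h (hF.j0 k) (hF.j1 l) hx hσ.1 hσ.2 le_rfl]
      simp [Wr, HH, hF.b0t x hx, hF.b1t x hx, Matrix.one_apply]
    have hA : Aᵀ = -A := by
      ext i j; simp [A, AA]
    obtain ⟨r1, r2⟩ := lagrangian P0 P1 Q0 Q1 A (HH t U φ0 x) (hu x hx) h00 h11 h01 hA
    have hp : (σ, x) ∈ KK t U := ⟨hσ, hx⟩
    have triple : ∀ (a b c : Matrix (Fin n) (Fin n) ℝ),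
        (aᵀ * b * c) r i = ∑ k, (∑ l, b k l * c l i) * a k r := by
      intro a b c
      rw [Matrix.mul_assoc]
      simp only [Matrix.mul_apply, transpose_apply]
      exact Finset.sum_congr rfl fun k _ => mul_comm _ _
    constructor
    · have := congrFun (congrFun r1 r) i
      rw [triple, triple] at this
      exact this
    · have := congrFun (congrFun r2 r) i
      rw [triple, Matrix.sub_apply, triple, Matrix.one_apply] at this
      have e1 : dT t U (Zp t U φ0 φ1 σ i r) (σ, x)
          = ∑ k, (∑ l, (HH t U φ0 x)ᵀ⁻¹ k l * φ1 l i (σ, x)) * dT t U (φ0 k r) (σ, x) :=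
        dT_lin (c := fun k x => ∑ l, (HH t U φ0 x)ᵀ⁻¹ k l * φ1 l i (σ, x)) h (fun k => (hF.j0 k).sm r) cp hp
      have e2 : dT t U (Zm t U φ0 φ1 σ i r) (σ, x)
          = ∑ k, (∑ l, (HH t U φ0 x)⁻¹ k l * φ0 l i (σ, x)) * dT t U (φ1 k r) (σ, x) :=
        dT_lin (c := fun k x => ∑ l, (HH t U φ0 x)⁻¹ k l * φ0 l i (σ, x)) h (fun k => (hF.j1 k).sm r) cm hp
      rw [e1, e2, ← sub_eq_add_neg]
      exact this
  refine ⟨jac_lin (c := fun k x => ∑ l, (HH t U φ0 x)ᵀ⁻¹ k l * φ1 l i (σ, x)) h hF.j0 cp, jac_lin (c := fun k x => ∑ l, (HH t U φ0 x)⁻¹ k l * φ0 l i (σ, x)) h hF.j1 cm, fun x hx r => ?_, fun x hx r => ?_,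
    fun x hx r => (key x hx r).1, fun x hx r => (key x hx r).2⟩
  · simp [Zm, hF.b10 x hx]
  · simp [Zp, hF.b0t x hx]

end green

section variation
variable {E : Type*} [NormedAddCommGroup E] [NormedSpace ℝ E]
variable {n : ℕ} {B : Fin n → (Fin n → ℝ) → ℝ} {C : (Fin n → ℝ) → ℝ} {t : ℝ} {U : Set E}
  {g : Fin n → ℝ × E → ℝ}

/-- Differentiation under the integral sign. -/
lemma fderiv_int [FiniteDimensional ℝ E] (ht : 0 < t) (hU : IsOpen U) {f : ℝ × E → ℝ}
    (hf : Sm t U f) {x : E} (hx : x ∈ U) :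
    ∃ S' : E →L[ℝ] ℝ, HasFDerivAt (fun y => ∫ ρ in (0:ℝ)..t, f (ρ, y)) S' x ∧
      ∀ e, S' e = ∫ ρ in (0:ℝ)..t, dE t U e f (ρ, x) := by
  have := FiniteDimensional.proper ℝ E
  obtain ⟨r, hr, hball⟩ := Metric.nhds_basis_closedBall.mem_iff.1 (hU.mem_nhds hx)
  have hcF : ContinuousOn (fderivWithin ℝ f (KK t U)) (KK t U) :=
    hf.continuousOn_fderivWithin (KK_unique ht hU) (by simp)
  have hcF' : ContinuousOn (fun p => (fderivWithin ℝ f (KK t U) p).comp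
      (ContinuousLinearMap.inr ℝ ℝ E)) (KK t U) := hcF.clm_comp continuousOn_const
  have hK : IsCompact (Icc 0 t ×ˢ Metric.closedBall x r) :=
    isCompact_Icc.prod (isCompact_closedBall x r)
  have hKs : Icc 0 t ×ˢ Metric.closedBall x r ⊆ KK t U := prod_mono subset_rfl hball
  obtain ⟨M, hM⟩ := hK.exists_bound_of_continuousOn (hcF'.mono hKs)
  have hIoc : uIoc 0 t ⊆ Icc 0 t := by
    rw [uIoc_of_le ht.le]; exact Ioc_subset_Icc_self
  have hsl : ∀ y ∈ U, ContinuousOn (fun ρ => (fderivWithin ℝ f (KK t U) (ρ, y)).comp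
      (ContinuousLinearMap.inr ℝ ℝ E)) (Icc 0 t) := fun y hy =>
    hcF'.comp (f := fun ρ => (ρ, y)) (by fun_prop) (fun ρ hρ => ⟨hρ, hy⟩)
  refine ⟨∫ ρ in (0:ℝ)..t, (fderivWithin ℝ f (KK t U) (ρ, x)).comp
      (ContinuousLinearMap.inr ℝ ℝ E), ?_, ?_⟩
  · refine intervalIntegral.hasFDerivAt_integral_of_dominated_of_fderiv_le
      (F := fun y ρ => f (ρ, y)) (F' := fun y ρ => (fderivWithin ℝ f (KK t U) (ρ, y)).comp
      (ContinuousLinearMap.inr ℝ ℝ E)) (bound := fun _ => M) (Metric.ball_mem_nhds x hr) ?_ ?_ ?_ ?_ ?_ ?_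
    · filter_upwards [hU.mem_nhds hx] with y hy
      exact ((hf.contT hy).mono hIoc).aestronglyMeasurable measurableSet_uIoc
    · refine ContinuousOn.intervalIntegrable ?_
      rw [uIcc_of_le ht.le]; exact hf.contT hx
    · exact ((hsl x hx).mono hIoc).aestronglyMeasurable measurableSet_uIoc
    · refine Filter.Eventually.of_forall fun ρ hρ y hy => ?_
      exact hM (ρ, y) ⟨hIoc hρ, Metric.ball_subset_closedBall hy⟩
    · exact intervalIntegrable_const
    · refine Filter.Eventually.of_forall fun ρ hρ y hy => ?_
      exact hf.hasFE hU (hIoc hρ) (hball (Metric.ball_subset_closedBall hy))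
  · intro e
    rw [ContinuousLinearMap.intervalIntegral_apply]
    · simp [dE]
    · refine ContinuousOn.intervalIntegrable ?_
      rw [uIcc_of_le ht.le]; exact hsl x hx

/-- The Lagrangian density. -/
def Lag (B : Fin n → (Fin n → ℝ) → ℝ) (C : (Fin n → ℝ) → ℝ) (t : ℝ) (U : Set E)
    (g : Fin n → ℝ × E → ℝ) (p : ℝ × E) : ℝ :=
  (∑ i, ((1:ℝ)/2 * (dT t U (g i) p * dT t U (g i) p) + B i (fun i => g i p) * dT t U (g i) p))
    + -C (fun i => g i p)

/-- The boundary term of the first variation. -/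
def Bdy (B : Fin n → (Fin n → ℝ) → ℝ) (t : ℝ) (U : Set E)
    (g : Fin n → ℝ × E → ℝ) (e : E) (p : ℝ × E) : ℝ :=
  ∑ i, (dT t U (g i) p + B i (fun i => g i p)) * dE t U e (g i) p

lemma Lag_sm (h : IsCl B C t U g) : Sm t U (Lag B C t U g) :=
  (Sm.sum fun i => ((Sm.const _).mul (((h.sm i).dT h.ht h.hU).mul ((h.sm i).dT h.ht h.hU))).add
    ((Sm.comp (h.hB i) h.sm).mul ((h.sm i).dT h.ht h.hU))).add (Sm.comp h.hC h.sm).neg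

lemma Bdy_sm (h : IsCl B C t U g) (e : E) : Sm t U (Bdy B t U g e) :=
  Sm.sum fun i => (((h.sm i).dT h.ht h.hU).add (Sm.comp (h.hB i) h.sm)).mul
    ((h.sm i).dE h.ht h.hU e)

lemma first_variation (h : IsCl B C t U g) (e : E) {p : ℝ × E} (hp : p ∈ KK t U) :
    dE t U e (Lag B C t U g) p = dT t U (Bdy B t U g e) p := by
  have ht := h.ht
  have hU := h.hU
  have hv := fun i => (h.sm i).dT ht hU
  have hw := fun i => (h.sm i).dE ht hU e
  have hb := fun i => Sm.comp (h.hB i) h.sm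
  have hc := Sm.comp h.hC h.sm
  have s1 := fun i => (Sm.const (1/2:ℝ)).mul ((hv i).mul (hv i))
  have s2 := fun i => (hb i).mul (hv i)
  unfold Lag Bdy
  rw [dE_add ht hU (Sm.sum fun i => (s1 i).add (s2 i)) hc.neg hp, dE_neg ht hU hp,
    dE_comp ht hU h.hC h.sm hp, dE_sum ht hU (fun i => (s1 i).add (s2 i)) hp,
    dT_sum ht hU (fun i => ((hv i).add (hb i)).mul (hw i)) hp]
  have l1 : ∀ i, dE t U e (fun p => (1:ℝ)/2 * (dT t U (g i) p * dT t U (g i) p)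
      + B i (fun i => g i p) * dT t U (g i) p) p
      = dT t U (g i) p * dT t U (dE t U e (g i)) p
        + ((∑ q, pd (B i) q (fun i => g i p) * dE t U e (g q) p) * dT t U (g i) p
        + B i (fun i => g i p) * dT t U (dE t U e (g i)) p) := by
    intro i
    rw [dE_add ht hU (s1 i) (s2 i) hp, dE_mul ht hU (Sm.const _) ((hv i).mul (hv i)) hp,
      dE_mul ht hU (hv i) (hv i) hp, dE_mul ht hU (hb i) (hv i) hp,
      dE_comp ht hU (h.hB i) h.sm hp, dT_dE ht hU e (h.sm i) hp]
    have : dE t U e (fun _ => (1/2:ℝ)) p = 0 := by simp [dE]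
    rw [this]; ring
  have l2 : ∀ i, dT t U (fun p => (dT t U (g i) p + B i (fun i => g i p)) * dE t U e (g i) p) p
      = (-((∑ j, AA B i j (fun i => g i p) * dT t U (g j) p) + pd C i (fun i => g i p))
        + ∑ q, pd (B i) q (fun i => g i p) * dT t U (g q) p) * dE t U e (g i) p
        + (dT t U (g i) p + B i (fun i => g i p)) * dT t U (dE t U e (g i)) p := by
    intro i
    rw [dT_mul ht hU ((hv i).add (hb i)) (hw i) hp, dT_add ht hU (hv i) (hb i) hp,
      dT_comp ht hU (h.hB i) h.sm hp, h.eq p hp i]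
  rw [Finset.sum_congr rfl fun i _ => l1 i, Finset.sum_congr rfl fun i _ => l2 i]
  have l3 : ∀ i, -((∑ j, AA B i j (fun i => g i p) * dT t U (g j) p) + pd C i (fun i => g i p))
        + ∑ q, pd (B i) q (fun i => g i p) * dT t U (g q) p
      = (∑ j, pd (B j) i (fun i => g i p) * dT t U (g j) p) - pd C i (fun i => g i p) := by
    intro i
    simp only [AA, sub_mul, Finset.sum_sub_distrib]; ring
  simp only [l3, Finset.sum_add_distrib, sub_mul, add_mul, Finset.sum_sub_distrib, Finset.sum_mul]
  rw [Finset.sum_comm (γ := Fin n)]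
  have l4 : ∀ x y : Fin n, pd (B y) x (fun i => g i p) * dE t U e (g x) p * dT t U (g y) p
    = pd (B y) x (fun i => g i p) * dT t U (g y) p * dE t U e (g x) p := fun x y => by ring
  simp only [l4]
  ring

lemma fderiv_action [FiniteDimensional ℝ E] (h : IsCl B C t U g) {x : E} (hx : x ∈ U) :
    ∃ S' : E →L[ℝ] ℝ, HasFDerivAt (fun y => ∫ ρ in (0:ℝ)..t, Lag B C t U g (ρ, y)) S' x ∧
      ∀ e, S' e = Bdy B t U g e (t, x) - Bdy B t U g e (0, x) := by
  obtain ⟨S', h1, h2⟩ := fderiv_int h.ht h.hU (Lag_sm h) hx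
  refine ⟨S', h1, fun e => ?_⟩
  rw [h2, ← ftc h.ht h.hU (Bdy_sm h e) hx le_rfl h.ht.le le_rfl]
  refine intervalIntegral.integral_congr fun ρ hρ => ?_
  rw [uIcc_of_le h.ht.le] at hρ
  exact first_variation h e ⟨hρ, hx⟩

end variation

section family
variable {n : ℕ} {B : Fin n → (Fin n → ℝ) → ℝ} {C : (Fin n → ℝ) → ℝ}
  {O : Set (ℝ × (Fin n → ℝ) × (Fin n → ℝ))}

/-- The boundary values at fixed duration. -/
def UU (O : Set (ℝ × (Fin n → ℝ) × (Fin n → ℝ))) (t : ℝ) : Set ((Fin n → ℝ) × (Fin n → ℝ)) :=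
  {x | (t, x.1, x.2) ∈ O}

/-- The components of the family at fixed duration. -/
def gg (F : SmoothFamily B C O) (t : ℝ) (i : Fin n) (p : ℝ × ((Fin n → ℝ) × (Fin n → ℝ))) : ℝ :=
  F.f p.1 t p.2.1 p.2.2 i

/-- The coordinate direction `q_a^m`. -/
def ee (a : Fin 2) (m : Fin n) : (Fin n → ℝ) × (Fin n → ℝ) :=
  if a = 0 then (Pi.single m 1, 0) else (0, Pi.single m 1)

lemma UU_open (F : SmoothFamily B C O) (t : ℝ) : IsOpen (UU O t) :=
  F.isOpen.preimage (f := fun x : (Fin n → ℝ) × (Fin n → ℝ) => (t, x.1, x.2)) (by fun_prop)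

lemma gg_sm (F : SmoothFamily B C O) (t : ℝ) (i : Fin n) : Sm t (UU O t) (gg F t i) := by
  have h1 : ContDiffOn ℝ (⊤ : ℕ∞)
      (fun p : ℝ × ℝ × (Fin n → ℝ) × (Fin n → ℝ) => F.f p.1 p.2.1 p.2.2.1 p.2.2.2 i)
      {p : ℝ × ℝ × (Fin n → ℝ) × (Fin n → ℝ) | p.2 ∈ O ∧ p.1 ∈ Icc 0 p.2.1} :=
    contDiffOn_pi.1 F.smooth i
  refine h1.comp (f := fun p : ℝ × ((Fin n → ℝ) × (Fin n → ℝ)) => (p.1, t, p.2.1, p.2.2)) ?_ ?_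
  · refine ContDiff.contDiffOn ?_
    fun_prop
  · exact fun p hp => ⟨hp.2, hp.1⟩

lemma path_has (F : SmoothFamily B C O) {t : ℝ} {x : (Fin n → ℝ) × (Fin n → ℝ)}
    (hx : x ∈ UU O t) (s : ℝ) (i : Fin n) :
    HasDerivAt (fun s => F.f s t x.1 x.2 i) (deriv (fun s => F.f s t x.1 x.2) s i) s ∧
    HasDerivAt (fun s => deriv (fun s => F.f s t x.1 x.2) s i)
      (deriv (deriv (fun s => F.f s t x.1 x.2)) s i) s := by
  have h := F.pathSmooth _ hx
  have h1 : ContDiff ℝ (⊤ : ℕ∞) (deriv (fun s => F.f s t x.1 x.2)) :=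
    (contDiff_infty_iff_deriv.1 h).2
  exact ⟨hasDerivAt_pi.1 (h.differentiable (by simp) s).hasDerivAt i,
    hasDerivAt_pi.1 (h1.differentiable (by simp) s).hasDerivAt i⟩

lemma dT_gg (F : SmoothFamily B C O) {t : ℝ} {x : (Fin n → ℝ) × (Fin n → ℝ)}
    (hx : x ∈ UU O t) {s : ℝ} (hs : s ∈ Icc 0 t) (i : Fin n) :
    dT t (UU O t) (gg F t i) (s, x) = deriv (fun s => F.f s t x.1 x.2) s i :=
  dT_eq (F.pos _ hx) (gg_sm F t i) hs hx (path_has F hx s i).1.hasDerivWithinAt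

lemma isCl (hB : ∀ i, ContDiff ℝ (⊤ : ℕ∞) (B i)) (hC : ContDiff ℝ (⊤ : ℕ∞) C)
    (F : SmoothFamily B C O) {t : ℝ} (ht : 0 < t) : IsCl B C t (UU O t) (gg F t) := by
  refine ⟨ht, UU_open F t, hB, hC, gg_sm F t, ?_⟩
  rintro ⟨s, x⟩ ⟨hs, hx⟩ i
  have h2 : dT t (UU O t) (dT t (UU O t) (gg F t i)) (s, x)
      = deriv (deriv (fun s => F.f s t x.1 x.2)) s i := by
    refine dT_eq ht ((gg_sm F t i).dT ht (UU_open F t)) hs hx ?_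
    exact (path_has F hx s i).2.hasDerivWithinAt.congr (fun r hr => dT_gg F hx hr i)
      (dT_gg F hx hs i)
  have h3 := F.isClassical _ hx s hs i
  rw [h2]
  have h4 : ∀ j, dT t (UU O t) (gg F t j) (s, x) = deriv (fun s => F.f s t x.1 x.2) s j :=
    fun j => dT_gg F hx hs j
  simp only [h4]
  have h5 : (fun i => gg F t i (s, x)) = F.f s t x.1 x.2 := rfl
  rw [h5]
  simp only [AA]
  linarith

/-- Partial derivatives in the boundary values of a smooth function. -/
lemma part0 {t : ℝ} {U : Set ((Fin n → ℝ) × (Fin n → ℝ))} (hU : IsOpen U)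
    {f : ℝ × ((Fin n → ℝ) × (Fin n → ℝ)) → ℝ} (hf : Sm t U f) {τ : ℝ} (hτ : τ ∈ Icc 0 t)
    {x : (Fin n → ℝ) × (Fin n → ℝ)} (hx : x ∈ U) (m : Fin n) :
    fderiv ℝ (fun q => f (τ, (q, x.2))) x.1 (Pi.single m 1) = dE t U (ee 0 m) f (τ, x) := by
  have h1 : HasFDerivAt (fun q : Fin n → ℝ => (q, x.2)) (ContinuousLinearMap.inl ℝ (Fin n → ℝ) (Fin n → ℝ)) x.1 :=
    hasFDerivAt_prodMk_left x.1 x.2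
  have h2 : HasFDerivAt (fun q => f (τ, (q, x.2))) _ x.1 :=
    HasFDerivAt.comp (g := fun y => f (τ, y)) x.1 (hf.hasFE hU hτ hx) h1
  rw [h2.fderiv]
  simp [dE, ee]

lemma part1 {t : ℝ} {U : Set ((Fin n → ℝ) × (Fin n → ℝ))} (hU : IsOpen U)
    {f : ℝ × ((Fin n → ℝ) × (Fin n → ℝ)) → ℝ} (hf : Sm t U f) {τ : ℝ} (hτ : τ ∈ Icc 0 t)
    {x : (Fin n → ℝ) × (Fin n → ℝ)} (hx : x ∈ U) (m : Fin n) :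
    fderiv ℝ (fun q => f (τ, (x.1, q))) x.2 (Pi.single m 1) = dE t U (ee 1 m) f (τ, x) := by
  have h1 : HasFDerivAt (fun q : Fin n → ℝ => (x.1, q)) (ContinuousLinearMap.inr ℝ (Fin n → ℝ) (Fin n → ℝ)) x.2 :=
    hasFDerivAt_prodMk_right x.1 x.2
  have h2 : HasFDerivAt (fun q => f (τ, (x.1, q))) _ x.2 :=
    HasFDerivAt.comp (g := fun y => f (τ, y)) x.2 (hf.hasFE hU hτ hx) h1
  rw [h2.fderiv]
  simp [dE, ee]

/-- The Jacobi fields in the boundary directions. -/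
def ff (F : SmoothFamily B C O) (t : ℝ) (a : Fin 2) (k i : Fin n) :
    ℝ × ((Fin n → ℝ) × (Fin n → ℝ)) → ℝ := dE t (UU O t) (ee a k) (gg F t i)

lemma isFund (hB : ∀ i, ContDiff ℝ (⊤ : ℕ∞) (B i)) (hC : ContDiff ℝ (⊤ : ℕ∞) C)
    (F : SmoothFamily B C O) {t : ℝ} (ht : 0 < t) :
    IsFund B C t (UU O t) (gg F t) (ff F t 0) (ff F t 1) := by
  have h := isCl hB hC F ht
  have hU := h.hU
  have m0 : (0:ℝ) ∈ Icc 0 t := left_mem_Icc.2 ht.le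
  have mt : t ∈ Icc 0 t := right_mem_Icc.2 ht.le
  have ln : ∀ x ∈ UU O t, ∀ e, ∀ᶠ s : ℝ in nhds 0, x + s • e ∈ UU O t := by
    intro x hx e
    have hc : Continuous fun s : ℝ => x + s • e := by fun_prop
    exact hc.continuousAt (hU.mem_nhds (by simpa using hx))
  have b0 : ∀ x ∈ UU O t, ∀ e i, dE t (UU O t) e (gg F t i) (0, x) = e.1 i := by
    intro x hx e i
    refine dE_eq hU (h.sm i) m0 hx ?_
    have h1 : HasDerivAt (fun s : ℝ => x.1 i + s * e.1 i) (e.1 i) 0 := by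
      simpa using ((hasDerivAt_id (0:ℝ)).mul_const (e.1 i)).const_add (x.1 i)
    refine h1.congr_of_eventuallyEq ?_
    filter_upwards [ln x hx e] with s hs
    have := congrFun (F.bdry0 _ hs) i
    simpa [gg] using this
  have bt : ∀ x ∈ UU O t, ∀ e i, dE t (UU O t) e (gg F t i) (t, x) = e.2 i := by
    intro x hx e i
    refine dE_eq hU (h.sm i) mt hx ?_
    have h1 : HasDerivAt (fun s : ℝ => x.2 i + s * e.2 i) (e.2 i) 0 := by
      simpa using ((hasDerivAt_id (0:ℝ)).mul_const (e.2 i)).const_add (x.2 i)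
    refine h1.congr_of_eventuallyEq ?_
    filter_upwards [ln x hx e] with s hs
    have := congrFun (F.bdry1 _ hs) i
    simpa [gg] using this
  refine ⟨fun k => h.jac _, fun k => h.jac _, ?_, ?_, ?_, ?_⟩ <;> intro x hx k i
  · simp [ff, b0 x hx, ee, Matrix.one_apply, Pi.single_apply, eq_comm]
  · simp [ff, bt x hx, ee]
  · simp [ff, b0 x hx, ee]
  · simp [ff, bt x hx, ee, Matrix.one_apply, Pi.single_apply, eq_comm]

lemma famS_eq (F : SmoothFamily B C O) {t : ℝ} (ht : 0 < t) {x : (Fin n → ℝ) × (Fin n → ℝ)}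
    (hx : x ∈ UU O t) :
    famS F t x.1 x.2 = ∫ ρ in (0:ℝ)..t, Lag B C t (UU O t) (gg F t) (ρ, x) := by
  refine intervalIntegral.integral_congr fun ρ hρ => ?_
  rw [uIcc_of_le ht.le] at hρ
  have h4 : ∀ j, dT t (UU O t) (gg F t j) (ρ, x) = deriv (fun s => F.f s t x.1 x.2) ρ j :=
    fun j => dT_gg F hx hρ j
  have h5 : (fun i => gg F t i (ρ, x)) = F.f ρ t x.1 x.2 := rfl
  simp only [Lag, h4, h5, Finset.sum_add_distrib, Finset.mul_sum, pow_two]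
  ring

lemma hess_eq (hB : ∀ i, ContDiff ℝ (⊤ : ℕ∞) (B i)) (hC : ContDiff ℝ (⊤ : ℕ∞) C)
    (F : SmoothFamily B C O) {t : ℝ} (ht : 0 < t) {x : (Fin n → ℝ) × (Fin n → ℝ)}
    (hx : x ∈ UU O t) :
    Hess01 (fun a b c => -(famS F a b c)) t x.1 x.2 = HH t (UU O t) (ff F t 0) x := by
  have h := isCl hB hC F ht
  have hF := isFund hB hC F ht
  have hU := h.hU
  have mt : t ∈ Icc 0 t := right_mem_Icc.2 ht.le
  have d1 : ∀ y ∈ UU O t, ∀ m, fderiv ℝ (fun q => -(famS F t y.1 q)) y.2 (Pi.single m 1)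
      = -(dT t (UU O t) (gg F t m) (t, y) + B m y.2) := by
    intro y hy m
    obtain ⟨S', h1, h2⟩ := fderiv_action h hy
    have h3 : HasFDerivAt (fun q : Fin n → ℝ => (y.1, q)) (ContinuousLinearMap.inr ℝ (Fin n → ℝ) (Fin n → ℝ)) y.2 :=
      hasFDerivAt_prodMk_right y.1 y.2
    have h4 : HasFDerivAt (fun q => -∫ ρ in (0:ℝ)..t, Lag B C t (UU O t) (gg F t) (ρ, (y.1, q)))
      _ y.2 := (h1.comp y.2 h3).neg
    have h5 : (fun q => -(famS F t y.1 q)) =ᶠ[nhds y.2]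
        (fun q => -∫ ρ in (0:ℝ)..t, Lag B C t (UU O t) (gg F t) (ρ, (y.1, q))) := by
      have hc : Continuous fun q : Fin n → ℝ => (y.1, q) := by fun_prop
      filter_upwards [hc.continuousAt (hU.mem_nhds (by simpa using hy))] with q hq
      rw [← famS_eq F ht hq]
    rw [h5.fderiv_eq, h4.fderiv]
    have h6 : S' (0, Pi.single m 1) = dT t (UU O t) (gg F t m) (t, y) + B m y.2 := by
      have e1 : ((0, Pi.single m 1) : (Fin n → ℝ) × (Fin n → ℝ)) = ee 1 m := by simp [ee]
      have b1 : ∀ i, dE t (UU O t) (ee 1 m) (gg F t i) (t, y) = (1 : Matrix _ _ ℝ) m i :=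
        hF.b1t y hy m
      have b2 : ∀ i, dE t (UU O t) (ee 1 m) (gg F t i) (0, y) = 0 := hF.b10 y hy m
      have b3 : (fun i => gg F t i (t, y)) = y.2 := F.bdry1 _ hy
      rw [e1, h2]
      simp [Bdy, b1, b2, b3, Matrix.one_apply]
    simp [h6]
  ext l m
  have hs : Sm t (UU O t) (fun p => -(dT t (UU O t) (gg F t m) (t, p.2) + B m p.2.2)) := by
    refine Sm.neg (Sm.add (((h.sm m).dT ht hU).freeze mt) ?_)
    exact ((hB m).comp (contDiff_snd.comp contDiff_snd)).contDiffOn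
  have e : (fun q0' => fderiv ℝ (fun q1' => -(famS F t q0' q1')) x.2 (Pi.single m 1))
      =ᶠ[nhds x.1] fun q => -(dT t (UU O t) (gg F t m) (t, (q, x.2)) + B m x.2) := by
    have hc : Continuous fun q : Fin n → ℝ => (q, x.2) := by fun_prop
    filter_upwards [hc.continuousAt (hU.mem_nhds (by simpa using hx))] with q hq
    exact d1 (q, x.2) hq m
  show fderiv ℝ (fun q0' => fderiv ℝ (fun q1' => -(famS F t q0' q1')) x.2 (Pi.single m 1)) x.1
    (Pi.single l 1) = - dT t (UU O t) (ff F t 0 l m) (t, x)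
  have hp : (t, x) ∈ KK t (UU O t) := ⟨mt, hx⟩
  have e2 : fderiv ℝ (fun q : Fin n → ℝ => -(dT t (UU O t) (gg F t m) (t, (q, x.2)) + B m x.2)) x.1
      (Pi.single l 1) = - fderiv ℝ (fun q => dT t (UU O t) (gg F t m) (t, (q, x.2))) x.1
      (Pi.single l 1) := by
    rw [fderiv_fun_neg, fderiv_add_const]; rfl
  rw [e.fderiv_eq, e2, part0 hU ((h.sm m).dT ht hU) mt hx l]
  unfold ff
  rw [dT_dE ht hU _ (h.sm m) hp]

end family

section final
variable {n : ℕ} {B : Fin n → (Fin n → ℝ) → ℝ} {C : (Fin n → ℝ) → ℝ}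
  {O : Set (ℝ × (Fin n → ℝ) × (Fin n → ℝ))}

lemma ff0_eq (F : SmoothFamily B C O) {t : ℝ} {x : (Fin n → ℝ) × (Fin n → ℝ)} (hx : x ∈ UU O t)
    {s : ℝ} (hs : s ∈ Icc 0 t) (k i : Fin n) :
    fderiv ℝ (fun q => F.f s t q x.2 i) x.1 (Pi.single k 1) = ff F t 0 k i (s, x) :=
  part0 (UU_open F t) (gg_sm F t i) hs hx k

lemma ff1_eq (F : SmoothFamily B C O) {t : ℝ} {x : (Fin n → ℝ) × (Fin n → ℝ)} (hx : x ∈ UU O t)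
    {s : ℝ} (hs : s ∈ Icc 0 t) (k i : Fin n) :
    fderiv ℝ (fun q => F.f s t x.1 q i) x.2 (Pi.single k 1) = ff F t 1 k i (s, x) :=
  part1 (UU_open F t) (gg_sm F t i) hs hx k

lemma Heav_pos {x : ℝ} (h : 0 < x) : Heav x = 1 := by
  unfold Heav; rw [if_neg (by linarith), if_neg h.ne']

lemma Heav_neg {x : ℝ} (h : x < 0) : Heav x = 0 := by
  unfold Heav; rw [if_pos h]

/-- Branches of the Green's kernel of the family. -/
def GP (F : SmoothFamily B C O) (t τ : ℝ) (j i : Fin n) :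
    ℝ × ((Fin n → ℝ) × (Fin n → ℝ)) → ℝ := Zp t (UU O t) (ff F t 0) (ff F t 1) τ j i

/-- Branches of the Green's kernel of the family. -/
def GM (F : SmoothFamily B C O) (t τ : ℝ) (j i : Fin n) :
    ℝ × ((Fin n → ℝ) × (Fin n → ℝ)) → ℝ := Zm t (UU O t) (ff F t 0) (ff F t 1) τ j i

lemma green_gt (hB : ∀ i, ContDiff ℝ (⊤ : ℕ∞) (B i)) (hC : ContDiff ℝ (⊤ : ℕ∞) C)
    (F : SmoothFamily B C O) {t : ℝ} {x : (Fin n → ℝ) × (Fin n → ℝ)}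
    (hx : x ∈ UU O t) {ς τ : ℝ} (hς : ς ∈ Icc 0 t) (hτ : τ ∈ Icc 0 t) (hlt : τ < ς) (i j : Fin n) :
    Green F t x.1 x.2 ς τ i j = GP F t τ j i (ς, x) := by
  unfold Green GP Zp
  rw [Heav_pos (sub_pos.2 hlt), Heav_neg (sub_neg.2 hlt), hess_eq hB hC F (F.pos _ hx) hx, zero_mul,
    add_zero, one_mul]
  refine Finset.sum_congr rfl fun k _ => ?_
  rw [Finset.sum_mul]
  refine Finset.sum_congr rfl fun l _ => ?_
  rw [ff0_eq F hx hς, ff1_eq F hx hτ]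
  ring

lemma green_lt (hB : ∀ i, ContDiff ℝ (⊤ : ℕ∞) (B i)) (hC : ContDiff ℝ (⊤ : ℕ∞) C)
    (F : SmoothFamily B C O) {t : ℝ} {x : (Fin n → ℝ) × (Fin n → ℝ)}
    (hx : x ∈ UU O t) {ς τ : ℝ} (hς : ς ∈ Icc 0 t) (hτ : τ ∈ Icc 0 t) (hlt : ς < τ) (i j : Fin n) :
    Green F t x.1 x.2 ς τ i j = GM F t τ j i (ς, x) := by
  unfold Green GM Zm
  rw [Heav_pos (sub_pos.2 hlt), Heav_neg (sub_neg.2 hlt), hess_eq hB hC F (F.pos _ hx) hx, zero_mul,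
    zero_add, one_mul]
  refine Finset.sum_congr rfl fun k _ => ?_
  rw [Finset.sum_mul]
  refine Finset.sum_congr rfl fun l _ => ?_
  rw [ff1_eq F hx hς, ff0_eq F hx hτ]
  ring

lemma GM_symm (F : SmoothFamily B C O) (t ς τ : ℝ) (i j : Fin n)
    (x : (Fin n → ℝ) × (Fin n → ℝ)) : GM F t τ j i (ς, x) = GP F t ς i j (τ, x) := by
  unfold GM GP Zm Zp
  simp only [Finset.sum_mul]
  rw [Finset.sum_comm]
  refine Finset.sum_congr rfl fun k _ => Finset.sum_congr rfl fun l _ => ?_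
  rw [← Matrix.transpose_nonsing_inv, Matrix.transpose_apply]
  ring

lemma jfield_eq (F : SmoothFamily B C O) {t : ℝ} {x : (Fin n → ℝ) × (Fin n → ℝ)} (hx : x ∈ UU O t)
    {s : ℝ} (hs : s ∈ Icc 0 t) (a : Fin 2) (m i : Fin n) :
    jfield F t x.1 x.2 a m s i = dE t (UU O t) (ee a m) (gg F t i) (s, x) := by
  unfold jfield
  split_ifs with ha
  · subst ha; exact ff0_eq F hx hs m i
  · obtain rfl : a = 1 := by omega
    exact ff1_eq F hx hs m i

/-- The derivative of a family of functions agreeing near a point with a smooth slice. -/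
lemma deriv_slice {t : ℝ} {U : Set ((Fin n → ℝ) × (Fin n → ℝ))}
    {f : Fin n → ℝ × ((Fin n → ℝ) × (Fin n → ℝ)) → ℝ} (hf : ∀ i, Sm t U (f i))
    {x : (Fin n → ℝ) × (Fin n → ℝ)} (hx : x ∈ U) {u : ℝ → Fin n → ℝ} {V : Set ℝ} (hV : IsOpen V)
    {ρ : ℝ} (hρV : ρ ∈ V) (hρ : ρ ∈ Ioo 0 t)
    (hu : ∀ s ∈ V, s ∈ Ioo 0 t → ∀ i, u s i = f i (s, x)) (k : Fin n) :
    deriv u ρ k = dT t U (f k) (ρ, x) := by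
  have h1 : HasDerivAt (fun s i => f i (s, x)) (fun i => dT t U (f i) (ρ, x)) ρ :=
    hasDerivAt_pi.2 fun i => (hf i).hasTI hρ hx
  have h2 : HasDerivAt u (fun i => dT t U (f i) (ρ, x)) ρ := by
    refine h1.congr_of_eventuallyEq ?_
    filter_upwards [hV.mem_nhds hρV, isOpen_Ioo.mem_nhds hρ] with s hs hs'
    exact funext fun i => hu s hs hs' i
  rw [h2.deriv]

/-- The boundary-value derivative of a function agreeing with a smooth slice. -/
lemma fderiv_slice {t : ℝ} {U : Set ((Fin n → ℝ) × (Fin n → ℝ))} (hU : IsOpen U)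
    {f : ℝ × ((Fin n → ℝ) × (Fin n → ℝ)) → ℝ} (hf : Sm t U f)
    {x : (Fin n → ℝ) × (Fin n → ℝ)} (hx : x ∈ U) {τ : ℝ} (hτ : τ ∈ Icc 0 t)
    {u : (Fin n → ℝ) → (Fin n → ℝ) → ℝ} (hu : ∀ y ∈ U, u y.1 y.2 = f (τ, y))
    (a : Fin 2) (m : Fin n) :
    (if a = 0 then fderiv ℝ (fun q => u q x.2) x.1 (Pi.single m 1)
      else fderiv ℝ (fun q => u x.1 q) x.2 (Pi.single m 1)) = dE t U (ee a m) f (τ, x) := by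
  split_ifs with ha
  · subst ha
    rw [← part0 hU hf hτ hx m]
    have e : (fun q => u q x.2) =ᶠ[nhds x.1] fun q => f (τ, (q, x.2)) := by
      have hc : Continuous fun q : Fin n → ℝ => (q, x.2) := by fun_prop
      filter_upwards [hc.continuousAt (hU.mem_nhds (by simpa using hx))] with q hq
      exact hu (q, x.2) hq
    rw [e.fderiv_eq]
  · obtain rfl : a = 1 := by omega
    rw [← part1 hU hf hτ hx m]
    have e : (fun q => u x.1 q) =ᶠ[nhds x.2] fun q => f (τ, (x.1, q)) := by
      have hc : Continuous fun q : Fin n → ℝ => (x.1, q) := by fun_prop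
      filter_upwards [hc.continuousAt (hU.mem_nhds (by simpa using hx))] with q hq
      exact hu (x.1, q) hq
    rw [e.fderiv_eq]

/-- Splitting an integral in three pieces. -/
lemma split3 {f f1 f2 f3 : ℝ → ℝ} {t α β : ℝ} (h0 : 0 < α) (h1 : α < β) (h2 : β < t)
    (i1 : IntervalIntegrable f1 volume 0 α) (i2 : IntervalIntegrable f2 volume α β)
    (i3 : IntervalIntegrable f3 volume β t)
    (e1 : EqOn f f1 (Ioo 0 α)) (e2 : EqOn f f2 (Ioo α β)) (e3 : EqOn f f3 (Ioo β t)) :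
    ∫ ρ in (0:ℝ)..t, f ρ
      = (∫ ρ in (0:ℝ)..α, f1 ρ) + (∫ ρ in α..β, f2 ρ) + ∫ ρ in β..t, f3 ρ := by
  have j1 : IntervalIntegrable f volume 0 α :=
    i1.congr_uIoo (by rw [uIoo_of_le h0.le]; exact e1.symm)
  have j2 : IntervalIntegrable f volume α β :=
    i2.congr_uIoo (by rw [uIoo_of_le h1.le]; exact e2.symm)
  have j3 : IntervalIntegrable f volume β t :=
    i3.congr_uIoo (by rw [uIoo_of_le h2.le]; exact e3.symm)
  rw [← intervalIntegral.integral_add_adjacent_intervals (j1.trans j2) j3,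
    ← intervalIntegral.integral_add_adjacent_intervals j1 j2,
    intervalIntegral.integral_congr_Ioo_of_le h0.le e1,
    intervalIntegral.integral_congr_Ioo_of_le h1.le e2,
    intervalIntegral.integral_congr_Ioo_of_le h2.le e3]

end final

/-- the boundary-value derivative of the Green's kernel is given by
contracting the Green's kernel with the differentiated Jacobi operator. -/
theorem statement14 {n : ℕ} (hn : 1 ≤ n)
    (B : Fin n → (Fin n → ℝ) → ℝ) (C : (Fin n → ℝ) → ℝ)
    (hB : ∀ i, ContDiff ℝ (⊤ : ℕ∞) (B i)) (hC : ContDiff ℝ (⊤ : ℕ∞) C)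
    (O : Set (ℝ × (Fin n → ℝ) × (Fin n → ℝ))) (F : SmoothFamily B C O)
    (t : ℝ) (q0 q1 : Fin n → ℝ) (hmem : (t, q0, q1) ∈ O)
    (a : Fin 2) (m : Fin n) :
    ∀ ς ∈ Ioo (0:ℝ) t, ∀ τ ∈ Ioo (0:ℝ) t, ς ≠ τ → ∀ i j : Fin n,
      (if a = 0 then fderiv ℝ (fun q => Green F t q q1 ς τ i j) q0 (Pi.single m 1)
        else fderiv ℝ (fun q => Green F t q0 q ς τ i j) q1 (Pi.single m 1))
        = ∫ ρ in (0:ℝ)..t, ∑ l,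
            Green F t q0 q1 ς ρ i l *
            ((∑ p, ∑ r,
                pd (fun q => pd (B l) r q - pd (B r) l q) p (F.f ρ t q0 q1)
                  * jfield F t q0 q1 a m ρ p
                  * deriv (fun ρ' r' => Green F t q0 q1 ρ' τ r' j) ρ r)
              + ∑ r,
                ((∑ p, ∑ k,
                    pd (pd (fun q => pd (B l) k q - pd (B k) l q) p) r (F.f ρ t q0 q1)
                      * jfield F t q0 q1 a m ρ p
                      * deriv (fun σ => F.f σ t q0 q1) ρ k)
                  + (∑ k,
                      pd (fun q => pd (B l) k q - pd (B k) l q) r (F.f ρ t q0 q1)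
                        * deriv (jfield F t q0 q1 a m) ρ k)
                  + ∑ p, pd (pd (pd C p) l) r (F.f ρ t q0 q1)
                      * jfield F t q0 q1 a m ρ p)
                  * Green F t q0 q1 ρ τ r j) := by
  intro ς hς τ hτ hne i j
  have ht : 0 < t := F.pos _ hmem
  obtain ⟨x, hx0, hx1⟩ : ∃ x : (Fin n → ℝ) × (Fin n → ℝ), x.1 = q0 ∧ x.2 = q1 := ⟨(q0, q1), rfl, rfl⟩
  subst hx0 hx1
  have hx : x ∈ UU O t := hmem
  have h := isCl hB hC F ht
  have hF := isFund hB hC F ht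
  have hU := h.hU
  have hς' : ς ∈ Icc 0 t := Ioo_subset_Icc_self hς
  have hτ' : τ ∈ Icc 0 t := Ioo_subset_Icc_self hτ
  have hZ : IsGr B C t (UU O t) (gg F t) ς i (GP F t ς i) (GM F t ς i) := isGr h hF hς' i
  have hY : IsGr B C t (UU O t) (gg F t) τ j (GP F t τ j) (GM F t τ j) := isGr h hF hτ' j
  -- the integrand, off the kinks
  have key : ∀ (Y Z : Fin n → ℝ × ((Fin n → ℝ) × (Fin n → ℝ)) → ℝ) (V : Set ℝ), IsOpen V →
      (∀ i, Sm t (UU O t) (Y i)) →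
      (∀ s ∈ V, s ∈ Ioo 0 t → ∀ r, Green F t x.1 x.2 s τ r j = Y r (s, x)) →
      ∀ ρ ∈ V, ρ ∈ Ioo 0 t → (∀ l, Green F t x.1 x.2 ς ρ i l = Z l (ρ, x)) →
      (∑ l,
            Green F t x.1 x.2 ς ρ i l *
            ((∑ p, ∑ r,
                pd (fun q => pd (B l) r q - pd (B r) l q) p (F.f ρ t x.1 x.2)
                  * jfield F t x.1 x.2 a m ρ p
                  * deriv (fun ρ' r' => Green F t x.1 x.2 ρ' τ r' j) ρ r)
              + ∑ r,
                ((∑ p, ∑ k,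
                    pd (pd (fun q => pd (B l) k q - pd (B k) l q) p) r (F.f ρ t x.1 x.2)
                      * jfield F t x.1 x.2 a m ρ p
                      * deriv (fun σ => F.f σ t x.1 x.2) ρ k)
                  + (∑ k,
                      pd (fun q => pd (B l) k q - pd (B k) l q) r (F.f ρ t x.1 x.2)
                        * deriv (jfield F t x.1 x.2 a m) ρ k)
                  + ∑ p, pd (pd (pd C p) l) r (F.f ρ t x.1 x.2)
                      * jfield F t x.1 x.2 a m ρ p)
                  * Green F t x.1 x.2 ρ τ r j))
        = ∑ l, Z l (ρ, x) * dD B C t (UU O t) (gg F t) (ee a m) Y l (ρ, x) := by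
    intro Y Z V hV hYs hYe ρ hρV hρ hZe
    have hρ' : ρ ∈ Icc 0 t := Ioo_subset_Icc_self hρ
    have a1 : ∀ r, deriv (fun ρ' r' => Green F t x.1 x.2 ρ' τ r' j) ρ r
        = dT t (UU O t) (Y r) (ρ, x) := fun r =>
      deriv_slice hYs hx hV hρV hρ hYe r
    have a2 : ∀ k, deriv (jfield F t x.1 x.2 a m) ρ k
        = dT t (UU O t) (dE t (UU O t) (ee a m) (gg F t k)) (ρ, x) := fun k =>
      deriv_slice (f := fun k => dE t (UU O t) (ee a m) (gg F t k))
        (fun i => (h.sm i).dE ht hU _) hx isOpen_univ (mem_univ ρ) hρ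
        (fun s _ hs i => jfield_eq F hx (Ioo_subset_Icc_self hs) a m i) k
    have a3 : ∀ p, jfield F t x.1 x.2 a m ρ p = dE t (UU O t) (ee a m) (gg F t p) (ρ, x) :=
      fun p => jfield_eq F hx hρ' a m p
    have a4 : ∀ k, deriv (fun σ => F.f σ t x.1 x.2) ρ k = dT t (UU O t) (gg F t k) (ρ, x) :=
      fun k => (dT_gg F hx hρ' k).symm
    simp only [a1, a2, a3, a4, hZe, hYe ρ hρV hρ]
    rfl
  have gZlt : ∀ ρ ∈ Ioo 0 t, ρ < ς → ∀ l, Green F t x.1 x.2 ς ρ i l = GM F t ς i l (ρ, x) :=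
    fun ρ hρ hlt l => by
      rw [green_gt hB hC F hx hς' (Ioo_subset_Icc_self hρ) hlt, GM_symm]
  have gZgt : ∀ ρ ∈ Ioo 0 t, ς < ρ → ∀ l, Green F t x.1 x.2 ς ρ i l = GP F t ς i l (ρ, x) :=
    fun ρ hρ hlt l => by
      rw [green_lt hB hC F hx hς' (Ioo_subset_Icc_self hρ) hlt, GM_symm]
  have gYlt : ∀ s ∈ Iio τ, s ∈ Ioo 0 t → ∀ r, Green F t x.1 x.2 s τ r j = GM F t τ j r (s, x) :=
    fun s hs hs' r => green_lt hB hC F hx (Ioo_subset_Icc_self hs') hτ' hs r j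
  have gYgt : ∀ s ∈ Ioi τ, s ∈ Ioo 0 t → ∀ r, Green F t x.1 x.2 s τ r j = GP F t τ j r (s, x) :=
    fun s hs hs' r => green_gt hB hC F hx (Ioo_subset_Icc_self hs') hτ' hs r j
  rcases lt_or_gt_of_ne hne with hlt | hlt
  · rw [fderiv_slice hU (hY.jm.sm i) hx hς'
      (u := fun q0 q1 => Green F t q0 q1 ς τ i j)
      (fun y hy => green_lt hB hC F hy hς' hτ' hlt i j) a m,
      ← main_lt h hZ hY (ee a m) hx hς.1 hlt hτ.2]
    refine (split3 hς.1 hlt hτ.2 (intble_dD h hZ.jm hY.jm _ hx le_rfl hς.1.le hς.2.le)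
      (intble_dD h hZ.jp hY.jm _ hx hς.1.le hlt.le hτ.2.le)
      (intble_dD h hZ.jp hY.jp _ hx hτ.1.le hτ.2.le le_rfl) ?_ ?_ ?_).symm
    · intro ρ hρ
      have hρ' : ρ ∈ Ioo 0 t := ⟨hρ.1, hρ.2.trans hς.2⟩
      exact key _ _ _ isOpen_Iio hY.jm.sm gYlt ρ (hρ.2.trans hlt) hρ' (gZlt ρ hρ' hρ.2)
    · intro ρ hρ
      have hρ' : ρ ∈ Ioo 0 t := ⟨hς.1.trans hρ.1, hρ.2.trans hτ.2⟩
      exact key _ _ _ isOpen_Iio hY.jm.sm gYlt ρ hρ.2 hρ' (gZgt ρ hρ' hρ.1)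
    · intro ρ hρ
      have hρ' : ρ ∈ Ioo 0 t := ⟨hτ.1.trans hρ.1, hρ.2⟩
      exact key _ _ _ isOpen_Ioi hY.jp.sm gYgt ρ hρ.1 hρ' (gZgt ρ hρ' (hlt.trans hρ.1))
  · rw [fderiv_slice hU (hY.jp.sm i) hx hς'
      (u := fun q0 q1 => Green F t q0 q1 ς τ i j)
      (fun y hy => green_gt hB hC F hy hς' hτ' hlt i j) a m,
      ← main_gt h hZ hY (ee a m) hx hτ.1 hlt hς.2]
    refine (split3 hτ.1 hlt hς.2 (intble_dD h hZ.jm hY.jm _ hx le_rfl hτ.1.le hτ.2.le)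
      (intble_dD h hZ.jm hY.jp _ hx hτ.1.le hlt.le hς.2.le)
      (intble_dD h hZ.jp hY.jp _ hx hς.1.le hς.2.le le_rfl) ?_ ?_ ?_).symm
    · intro ρ hρ
      have hρ' : ρ ∈ Ioo 0 t := ⟨hρ.1, hρ.2.trans hτ.2⟩
      exact key _ _ _ isOpen_Iio hY.jm.sm gYlt ρ hρ.2 hρ' (gZlt ρ hρ' (hρ.2.trans hlt))
    · intro ρ hρ
      have hρ' : ρ ∈ Ioo 0 t := ⟨hτ.1.trans hρ.1, hρ.2.trans hς.2⟩
      exact key _ _ _ isOpen_Ioi hY.jp.sm gYgt ρ hρ.1 hρ' (gZlt ρ hρ' hρ.2)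
    · intro ρ hρ
      have hρ' : ρ ∈ Ioo 0 t := ⟨hς.1.trans hρ.1, hρ.2⟩
      exact key _ _ _ isOpen_Ioi hY.jp.sm gYgt ρ (hlt.trans hρ.1) hρ' (gZgt ρ hρ' hρ.1)
end
end

section
/- Let O_0 ⊆ ℝ^n be open with compact closure. Then there exists ε > 0 and a smooth family of nondegenerate classical paths over O = (0,ε) × O_0 × O_0; that is, a smooth map γ(τ;t,q_0,q_1), defined for (t,q_0,q_1) ∈ (0,ε) × O_0 × O_0 and τ ∈ [0,t], such that each γ(·;t,q_0,q_1) is a nondegenerate classical path of duration t with γ(0;t,q_0,q_1) = q_0 and γ(t;t,q_0,q_1) = q_1. Moreover, ε can be chosen so that for every q ∈ O_0 there is t_1 ∈ (0,ε] such that for all 0 < t < t_1 the solution of the equation of motion with initial conditions γ(0) = q and γ̇(0) = −B(q) is defined on [0,t], is nondegenerate, and coincides with the family member γ(·;t,q,q_1) whenever its endpoint q_1 := γ(t) lies in O_0. -/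
open MeasureTheory Set
open scoped BigOperators

noncomputable section

theorem aux_fixedPoint {P Y : Type} [NormedAddCommGroup P] [NormedSpace ℝ P] [CompleteSpace P]
    [NormedAddCommGroup Y] [NormedSpace ℝ Y] [CompleteSpace Y] (T : P × Y → Y) (U : Set P)
    (hU : IsOpen U) (hT : ∀ p ∈ U, ∀ y, ContDiffAt ℝ (⊤ : ℕ∞) T (p, y))
    (hL : ∀ p ∈ U, ∀ y y', ‖T (p, y) - T (p, y')‖ ≤ (1/2) * ‖y - y'‖) :
    ∃ φ : P → Y, (∀ p ∈ U, φ p = T (p, φ p)) ∧ (∀ p ∈ U, ∀ y, y = T (p, y) → y = φ p) ∧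
      ContDiffOn ℝ (⊤ : ℕ∞) φ U := by
  classical
  have hlip : ∀ p ∈ U, LipschitzWith (1/2) (fun y => T (p, y)) := by
    intro p hp
    refine LipschitzWith.of_dist_le_mul fun y y' => ?_
    simpa [dist_eq_norm] using hL p hp y y'
  have hcon : ∀ p ∈ U, ContractingWith (1/2) (fun y => T (p, y)) := fun p hp =>
    ⟨by
      rw [← NNReal.coe_lt_coe]; norm_num, hlip p hp⟩
  have hex : ∀ p, ∃ y, p ∈ U → y = T (p, y) := by
    intro p
    by_cases hp : p ∈ U
    · exact ⟨(hcon p hp).fixedPoint, fun _ => ((hcon p hp).fixedPoint_isFixedPt).symm⟩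
    · exact ⟨0, fun h => absurd h hp⟩
  choose φ hφ using hex
  have huniq : ∀ p ∈ U, ∀ y, y = T (p, y) → y = φ p := by
    intro p hp y hy
    have h := hL p hp y (φ p)
    rw [← hy, ← hφ p hp] at h
    have : ‖y - φ p‖ ≤ 0 := by linarith
    exact sub_eq_zero.mp (norm_le_zero_iff.mp this)
  refine ⟨φ, hφ, huniq, ?_⟩
  intro p hp
  apply ContDiffAt.contDiffWithinAt
  set f : P × Y → Y := fun x => x.2 - T x with hf
  have cdf : ContDiffAt ℝ (⊤ : ℕ∞) f (p, φ p) := contDiffAt_snd.sub (hT p hp _)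
  have hTd : HasFDerivAt T (fderiv ℝ T (p, φ p)) (p, φ p) :=
    ((hT p hp (φ p)).differentiableAt (by simp)).hasFDerivAt
  set A : Y →L[ℝ] Y := fderiv ℝ T (p, φ p) ∘L .inr ℝ P Y with hA
  have hfd : fderiv ℝ f (p, φ p) ∘L .inr ℝ P Y = 1 - A := by
    have : HasFDerivAt f (ContinuousLinearMap.snd ℝ P Y - fderiv ℝ T (p, φ p)) (p, φ p) :=
      hasFDerivAt_snd.sub hTd
    rw [this.fderiv]
    ext y
    simp [hA]
  have hAd : HasFDerivAt (fun y => T (p, y)) A (φ p) := by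
    have h2 : HasFDerivAt (fun y : Y => (p, y)) (ContinuousLinearMap.inr ℝ P Y) (φ p) :=
      hasFDerivAt_prodMk_right p (φ p)
    exact HasFDerivAt.comp (φ p) hTd h2
  have hAn : ‖A‖ < 1 := by
    have := hAd.le_of_lipschitz (hlip p hp)
    norm_num at this
    linarith
  have hinv : (fderiv ℝ f (p, φ p) ∘L .inr ℝ P Y).IsInvertible := by
    rw [hfd]
    exact ⟨ContinuousLinearEquiv.ofUnit (Units.oneSub A hAn), rfl⟩
  have h1 := cdf.contDiffAt_implicitFunction (by simp) hinv
  have h2 := cdf.eventually_apply_implicitFunction (by simp) hinv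
  refine ContDiffAt.congr_of_eventuallyEq h1 ?_
  filter_upwards [h2, hU.mem_nhds hp] with x hx hxU
  symm
  apply huniq x hxU
  have : f (p, φ p) = 0 := by simp only [hf]; rw [← hφ p hp, sub_self]
  rw [this] at hx
  exact sub_eq_zero.mp hx

/-- pointwise application -/
def auxApp (K E F : Type) [TopologicalSpace K] [CompactSpace K]
    [NormedAddCommGroup E] [NormedSpace ℝ E] [NormedAddCommGroup F] [NormedSpace ℝ F] :
    C(K, E →L[ℝ] F) →L[ℝ] (C(K, E) →L[ℝ] C(K, F)) :=
  LinearMap.mkContinuous₂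
    (LinearMap.mk₂ ℝ (fun (A : C(K, E →L[ℝ] F)) (h : C(K, E)) =>
      (⟨fun k => A k (h k), by fun_prop⟩ : C(K, F)))
      (by intros; ext; simp) (by intros; ext; simp) (by intros; ext; simp)
      (by intros; ext; simp)) 1
    (by
      intro A h
      rw [one_mul]
      refine (ContinuousMap.norm_le _ (by positivity)).2 fun k => ?_
      refine ((A k).le_opNorm (h k)).trans ?_
      gcongr
      · exact A.norm_coe_le_norm k
      · exact h.norm_coe_le_norm k)

theorem auxApp_apply (K E F : Type) [TopologicalSpace K] [CompactSpace K]
    [NormedAddCommGroup E] [NormedSpace ℝ E] [NormedAddCommGroup F] [NormedSpace ℝ F]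
    (A : C(K, E →L[ℝ] F)) (h : C(K, E)) (k : K) : auxApp K E F A h k = A k (h k) := rfl

theorem aux_nem_deriv {K E F : Type} [TopologicalSpace K] [CompactSpace K]
    [NormedAddCommGroup E] [NormedSpace ℝ E] [NormedAddCommGroup F] [NormedSpace ℝ F]
    (g : C(E, F)) (g' : C(E, E →L[ℝ] F)) (hg : ∀ x, HasFDerivAt g (g' x) x) (u : C(K, E)) :
    HasFDerivAt (fun u : C(K, E) => g.comp u) (auxApp K E F (g'.comp u)) u := by
  rw [hasFDerivAt_iff_isLittleO_nhds_zero, Asymptotics.isLittleO_iff]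
  intro c hc
  have hcont : Continuous (fun u : C(K, E) => g'.comp u) := g'.continuous_postcomp
  obtain ⟨δ, hδ, hball⟩ := (Metric.continuousAt_iff (f := fun u : C(K, E) => g'.comp u) (a := u)).1
    hcont.continuousAt c hc
  filter_upwards [Metric.ball_mem_nhds (0 : C(K, E)) hδ] with h hh
  rw [mem_ball_zero_iff] at hh
  refine (ContinuousMap.norm_le _ (by positivity)).2 fun k => ?_
  have key : ∀ y ∈ segment ℝ (u k) (u k + h k), ‖g' y - g' (u k)‖ ≤ c := by
    intro y hy
    rw [segment_eq_image'] at hy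
    obtain ⟨θ, hθ, rfl⟩ := hy
    have h1 : dist (u + θ • h) u < δ := by
      rw [dist_eq_norm, add_sub_cancel_left, norm_smul, Real.norm_of_nonneg hθ.1]
      nlinarith [hθ.2, norm_nonneg h]
    have h2 := hball h1
    have h3 := (ContinuousMap.dist_apply_le_dist (f := g'.comp (u + θ • h)) (g := g'.comp u) k)
    rw [dist_eq_norm] at h3
    simp only [ContinuousMap.comp_apply, ContinuousMap.add_apply, ContinuousMap.smul_apply] at h3
    simpa using (h3.trans h2.le)
  have := Convex.norm_image_sub_le_of_norm_hasFDerivWithin_le' (f := g) (f' := g') (φ := g' (u k))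
    (s := segment ℝ (u k) (u k + h k)) (x := u k) (y := u k + h k) (C := c)
    (fun x _ => (hg x).hasFDerivWithinAt) key (convex_segment _ _)
    (left_mem_segment _ _ _) (right_mem_segment _ _ _)
  simp only [add_sub_cancel_left] at this
  refine le_trans ?_ (this.trans (by gcongr; exact h.norm_coe_le_norm k))
  simp [auxApp_apply]

theorem aux_nem_nat {K E : Type} [TopologicalSpace K] [CompactSpace K]
    [NormedAddCommGroup E] [NormedSpace ℝ E] (m : ℕ) :
    ∀ (F : Type) [NormedAddCommGroup F] [NormedSpace ℝ F] (g : C(E, F)),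
      ContDiff ℝ m g → ContDiff ℝ m (fun u : C(K, E) => g.comp u) := by
  induction m with
  | zero =>
    intro F _ _ g hg
    exact contDiff_zero.2 g.continuous_postcomp
  | succ m ih =>
    intro F _ _ g hg
    push_cast at hg ⊢
    rw [contDiff_succ_iff_hasFDerivAt] at hg ⊢
    obtain ⟨g', hg', hd⟩ := hg
    refine ⟨fun u => auxApp K E F ((⟨g', hg'.continuous⟩ : C(E, E →L[ℝ] F)).comp u), ?_, ?_⟩
    · exact (auxApp K E F).contDiff.comp (ih _ ⟨g', hg'.continuous⟩ hg')
    · intro u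
      exact aux_nem_deriv g ⟨g', hg'.continuous⟩ hd u

theorem aux_nem {K E F : Type} [TopologicalSpace K] [CompactSpace K]
    [NormedAddCommGroup E] [NormedSpace ℝ E] [NormedAddCommGroup F] [NormedSpace ℝ F]
    (g : C(E, F)) (hg : ContDiff ℝ (⊤ : ℕ∞) g) :
    ContDiff ℝ (⊤ : ℕ∞) (fun u : C(K, E) => g.comp u) :=
  contDiff_infty.2 fun m => aux_nem_nat m F g (contDiff_infty.1 hg m)

/-- integration operator -/
theorem aux_intOp (E : Type) [NormedAddCommGroup E] [NormedSpace ℝ E] [CompleteSpace E] :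
    ∃ I : C(Icc (0:ℝ) 1, E) →L[ℝ] C(Icc (0:ℝ) 1, E),
      (∀ v r, I v r = ∫ x in (0:ℝ)..r, v (projIcc 0 1 zero_le_one x)) ∧ ∀ v, ‖I v‖ ≤ ‖v‖ := by
  have hc : ∀ v : C(Icc (0:ℝ) 1, E), Continuous fun x : ℝ => v (projIcc 0 1 zero_le_one x) :=
    fun v => v.continuous.comp continuous_projIcc
  let L : C(Icc (0:ℝ) 1, E) →ₗ[ℝ] C(Icc (0:ℝ) 1, E) :=
    { toFun := fun v => ⟨fun r => ∫ x in (0:ℝ)..r, v (projIcc 0 1 zero_le_one x),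
        (intervalIntegral.continuous_primitive (fun a b => (hc v).intervalIntegrable a b) 0).comp
          continuous_subtype_val⟩
      map_add' := by
        intro u v; ext r
        simp only [ContinuousMap.coe_mk, ContinuousMap.add_apply]
        exact intervalIntegral.integral_add ((hc u).intervalIntegrable _ _)
          ((hc v).intervalIntegrable _ _)
      map_smul' := by
        intro c v; ext r
        simp only [ContinuousMap.coe_mk, ContinuousMap.smul_apply, RingHom.id_apply]
        exact intervalIntegral.integral_smul _ _ }
  have hb : ∀ v, ‖L v‖ ≤ 1 * ‖v‖ := by
    intro v
    rw [one_mul]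
    refine (ContinuousMap.norm_le _ (by positivity)).2 fun r => ?_
    have := intervalIntegral.norm_integral_le_of_norm_le_const (a := (0:ℝ)) (b := r) (C := ‖v‖)
      (f := fun x => v (projIcc 0 1 zero_le_one x)) (fun x _ => v.norm_coe_le_norm _)
    refine this.trans ?_
    rw [sub_zero, abs_of_nonneg r.2.1]
    nlinarith [norm_nonneg v, r.2.2]
  exact ⟨L.mkContinuous 1 hb, fun v r => rfl, fun v => by simpa using hb v⟩

theorem aux_constOp (K E : Type) [TopologicalSpace K] [CompactSpace K]
    [NormedAddCommGroup E] [NormedSpace ℝ E] :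
    ∃ c : E →L[ℝ] C(K, E), (∀ x k, c x k = x) ∧ ∀ x, ‖c x‖ ≤ ‖x‖ := by
  let L : E →ₗ[ℝ] C(K, E) :=
    { toFun := fun x => ContinuousMap.const K x
      map_add' := by intros; ext; simp
      map_smul' := by intros; ext; simp }
  have hb : ∀ x, ‖L x‖ ≤ 1 * ‖x‖ := fun x => by
    rw [one_mul]
    exact (ContinuousMap.norm_le _ (by positivity)).2 fun k => le_rfl
  exact ⟨L.mkContinuous 1 hb, fun x k => rfl, fun x => by simpa using hb x⟩

/-- scaling of the integration operator -/
theorem aux_int_scale {E : Type} [NormedAddCommGroup E] [NormedSpace ℝ E]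
    (v u : C(Icc (0:ℝ) 1, E)) (l : ℝ) (hl : l ∈ Icc (0:ℝ) 1)
    (hu : ∀ r, u r = v (projIcc 0 1 zero_le_one (l * r))) (r : ℝ) (hr : r ∈ Icc (0:ℝ) 1) :
    l • ∫ x in (0:ℝ)..r, u (projIcc 0 1 zero_le_one x) =
      ∫ x in (0:ℝ)..(l * r), v (projIcc 0 1 zero_le_one x) := by
  have h1 := intervalIntegral.smul_integral_comp_mul_left (a := 0) (b := r)
    (f := fun x => v (projIcc 0 1 zero_le_one x)) l
  rw [mul_zero] at h1
  rw [← h1]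
  congr 1
  apply intervalIntegral.integral_congr
  intro x hx
  rw [uIcc_of_le hr.1] at hx
  have hx1 : x ∈ Icc (0:ℝ) 1 := ⟨hx.1, hx.2.trans hr.2⟩
  simp only [hu, projIcc_of_mem zero_le_one hx1]

theorem aux_flow {E : Type} [NormedAddCommGroup E] [NormedSpace ℝ E] [CompleteSpace E]
    (g : ℝ × E × E → E) (hg : ContDiff ℝ (⊤ : ℕ∞) g) (L : ℝ) (hL0 : 0 ≤ L)
    (hL : ∀ z z', ‖g z - g z'‖ ≤ L * ‖z - z'‖) (G : ℝ) (hG0 : 0 ≤ G) (hG : ∀ z, ‖g z‖ ≤ G) :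
    ∃ ε : ℝ, 0 < ε ∧ ∃ X W : ℝ × ℝ × E × E → E,
      ContDiffOn ℝ (⊤ : ℕ∞) X {a | |a.1| < 3 ∧ |a.2.1| < ε} ∧
      ContDiffOn ℝ (⊤ : ℕ∞) W {a | |a.1| < 3 ∧ |a.2.1| < ε} ∧
      ∀ s q w, |s| < ε →
        X (0, s, q, w) = q ∧ W (0, s, q, w) = w ∧
        (∀ σ, |σ| < 3 →
          HasDerivAt (fun σ => X (σ, s, q, w)) (W (σ, s, q, w)) σ ∧
          HasDerivAt (fun σ => W (σ, s, q, w))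
            (s • g (s, X (σ, s, q, w), W (σ, s, q, w))) σ ∧
          ‖W (σ, s, q, w) - w‖ ≤ 3 * |s| * G ∧
          ‖X (σ, s, q, w) - q - σ • w‖ ≤ 9 * |s| * G) ∧
        ∀ w', ‖(X (1, s, q, w) - w) - (X (1, s, q, w') - w')‖ ≤ (1/2) * ‖w - w'‖ := by
  obtain ⟨I, hI, hIn⟩ := aux_intOp E
  obtain ⟨cE, hcE, hcEn⟩ := aux_constOp (Icc (0:ℝ) 1) E
  obtain ⟨cZ, hcZ, hcZn⟩ := aux_constOp (Icc (0:ℝ) 1) (ℝ × E × E)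
  let i1 : C(Icc (0:ℝ) 1, E) →L[ℝ] C(Icc (0:ℝ) 1, ℝ × E × E) := ContinuousLinearMap.compLeftContinuous ℝ (Icc (0:ℝ) 1)
    ((ContinuousLinearMap.inr ℝ ℝ (E × E)).comp (ContinuousLinearMap.inl ℝ E E))
  let i2 : C(Icc (0:ℝ) 1, E) →L[ℝ] C(Icc (0:ℝ) 1, ℝ × E × E) := ContinuousLinearMap.compLeftContinuous ℝ (Icc (0:ℝ) 1)
    ((ContinuousLinearMap.inr ℝ ℝ (E × E)).comp (ContinuousLinearMap.inr ℝ E E))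
  have hi1 : ∀ v k, i1 v k = (0, v k, 0) := fun v k => rfl
  have hi2 : ∀ v k, i2 v k = (0, 0, v k) := fun v k => rfl
  let gC : C(ℝ × E × E, E) := ⟨g, hg.continuous⟩
  let pth : (ℝ × ℝ × E × E) × C(Icc (0:ℝ) 1, E) → C(Icc (0:ℝ) 1, ℝ × E × E) := fun p =>
    cZ (p.1.2.1, p.1.2.2.1, 0) + i1 (p.1.1 • I p.2) + i2 p.2
  have hpth : ∀ σ s q w v k, pth ((σ, s, q, w), v) k = (s, q + σ • I v k, v k) := by
    intro σ s q w v k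
    simp [pth, hcZ, hi1, hi2]
  have hpthc : ContDiff ℝ (⊤ : ℕ∞) pth := by
    have e1 : ContDiff ℝ (⊤ : ℕ∞) (fun p : (ℝ × ℝ × E × E) × C(Icc (0:ℝ) 1, E) =>
      cZ (p.1.2.1, p.1.2.2.1, 0)) := cZ.contDiff.comp (by fun_prop)
    have e2 : ContDiff ℝ (⊤ : ℕ∞) (fun p : (ℝ × ℝ × E × E) × C(Icc (0:ℝ) 1, E) =>
      i1 (p.1.1 • I p.2)) := i1.contDiff.comp
        (ContDiff.smul (contDiff_fst.comp contDiff_fst) (I.contDiff.comp contDiff_snd))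
    exact (e1.add e2).add (i2.contDiff.comp contDiff_snd)
  let S : (ℝ × ℝ × E × E) × C(Icc (0:ℝ) 1, E) → C(Icc (0:ℝ) 1, E) := fun p =>
    (p.1.1 * p.1.2.1) • I (gC.comp (pth p))
  have hss : ContDiff ℝ (⊤ : ℕ∞) (fun p : (ℝ × ℝ × E × E) × C(Icc (0:ℝ) 1, E) => p.1.1 * p.1.2.1) := by
    fun_prop
  have hSc : ContDiff ℝ (⊤ : ℕ∞) S :=
    hss.smul (I.contDiff.comp ((aux_nem gC hg).comp hpthc))
  let T : (ℝ × ℝ × E × E) × C(Icc (0:ℝ) 1, E) → C(Icc (0:ℝ) 1, E) := fun p => cE p.1.2.2.2 + S p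
  have hTc : ContDiff ℝ (⊤ : ℕ∞) T := (cE.contDiff.comp (by fun_prop)).add hSc
  set ε : ℝ := 1 / (36 * (L + 1)) with hε
  have hεpos : 0 < ε := by positivity
  have hεL : 9 * ε * L ≤ 1 / 4 := by
    rw [hε]; field_simp; linarith
  set U : Set (ℝ × ℝ × E × E) := {a | |a.1| < 3 ∧ |a.2.1| < ε} with hU
  have hUo : IsOpen U := by
    have o1 : IsOpen {a : ℝ × ℝ × E × E | |a.1| < 3} := isOpen_lt (by fun_prop) (by fun_prop)
    have o2 : IsOpen {a : ℝ × ℝ × E × E | |a.2.1| < ε} := isOpen_lt (by fun_prop) (by fun_prop)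
    exact o1.inter o2
  have hSw : ∀ σ s q w w' v, S ((σ, s, q, w), v) = S ((σ, s, q, w'), v) := by
    intro σ s q w w' v
    rfl
  have hSlip : ∀ a ∈ U, ∀ v v', ‖S (a, v) - S (a, v')‖ ≤ (1/4) * ‖v - v'‖ := by
    rintro ⟨σ, s, q, w⟩ ⟨h1, h2⟩ v v'
    simp only at h1 h2
    have hp : ‖gC.comp (pth ((σ, s, q, w), v)) - gC.comp (pth ((σ, s, q, w), v'))‖
        ≤ L * (3 * ‖v - v'‖) := by
      refine (ContinuousMap.norm_le _ (by positivity)).2 fun k => ?_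
      refine (hL _ _).trans ?_
      gcongr
      rw [hpth, hpth]
      have e1 : ‖σ • I v k - σ • I v' k‖ ≤ 3 * ‖v - v'‖ := by
        rw [← smul_sub, norm_smul]
        have : ‖I v k - I v' k‖ ≤ ‖v - v'‖ := by
          have := (I (v - v')).norm_coe_le_norm k
          rw [map_sub] at this
          refine this.trans ?_
          rw [← map_sub]
          exact hIn _
        gcongr
        exact h1.le
      have e2 : ‖v k - v' k‖ ≤ 3 * ‖v - v'‖ := by
        have := (v - v').norm_coe_le_norm k
        rw [ContinuousMap.sub_apply] at this
        linarith [norm_nonneg (v - v')]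
      simp only [Prod.mk_sub_mk, sub_self, add_sub_add_left_eq_sub, Prod.norm_mk, norm_zero]
      exact max_le (by positivity) (max_le e1 e2)
    have : S ((σ, s, q, w), v) - S ((σ, s, q, w), v') = (σ * s) •
        I (gC.comp (pth ((σ, s, q, w), v)) - gC.comp (pth ((σ, s, q, w), v'))) := by
      simp only [S, map_sub, smul_sub]
    rw [this, norm_smul, norm_mul, Real.norm_eq_abs, Real.norm_eq_abs]
    calc |σ| * |s| * ‖I (gC.comp (pth ((σ, s, q, w), v)) - gC.comp (pth ((σ, s, q, w), v')))‖
        ≤ 3 * ε * (L * (3 * ‖v - v'‖)) := by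
          gcongr
          exact (hIn _).trans hp
      _ = (9 * ε * L) * ‖v - v'‖ := by ring
      _ ≤ _ := by gcongr
  have hSb : ∀ a ∈ U, ∀ v, ‖S (a, v)‖ ≤ 3 * |a.2.1| * G := by
    rintro ⟨σ, s, q, w⟩ ⟨h1, h2⟩ v
    simp only at h1 h2
    have : ‖gC.comp (pth ((σ, s, q, w), v))‖ ≤ G :=
      (ContinuousMap.norm_le _ hG0).2 fun k => hG _
    simp only [S]
    rw [norm_smul, norm_mul, Real.norm_eq_abs, Real.norm_eq_abs]
    gcongr
    exact (hIn _).trans this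
  obtain ⟨φ, hφ, hφu, hφc⟩ := aux_fixedPoint T U hUo (fun p _ y => hTc.contDiffAt)
    (by
      intro p hp y y'
      have := hSlip p hp y y'
      simp only [T, add_sub_add_left_eq_sub]
      linarith [norm_nonneg (y - y')])
  have h1J : (1:ℝ) ∈ Icc (0:ℝ) 1 := ⟨zero_le_one, le_rfl⟩
  let ev : C(Icc (0:ℝ) 1, E) →L[ℝ] E := ContinuousMap.evalCLM ℝ ⟨1, h1J⟩
  have hev : ∀ v, ev v = v ⟨1, h1J⟩ := fun v => rfl
  let X : ℝ × ℝ × E × E → E := fun a => a.2.2.1 + a.1 • ev (I (φ a))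
  let W : ℝ × ℝ × E × E → E := fun a => ev (φ a)
  have hWc : ContDiffOn ℝ (⊤ : ℕ∞) W U := ev.contDiff.comp_contDiffOn hφc
  have hXc : ContDiffOn ℝ (⊤ : ℕ∞) X U := by
    refine ContDiffOn.add (by fun_prop) (ContDiffOn.smul (by fun_prop) ?_)
    exact ev.contDiff.comp_contDiffOn (I.contDiff.comp_contDiffOn hφc)
  have hIc : ∀ x : E, I (cE x) ⟨1, h1J⟩ = x := by
    intro x
    rw [hI]
    simp [hcE]
  refine ⟨ε, hεpos, X, W, hXc, hWc, ?_⟩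
  intro s q w hs
  have hUσ : ∀ σ w, |σ| < 3 → ((σ, s, q, w) : ℝ × ℝ × E × E) ∈ U := fun σ w h => ⟨h, hs⟩
  -- scaling
  have hscale : ∀ σ, |σ| < 3 → ∀ l (hl : l ∈ Icc (0:ℝ) 1),
      W (l * σ, s, q, w) = φ (σ, s, q, w) ⟨l, hl⟩ ∧
      X (l * σ, s, q, w) = q + σ • I (φ (σ, s, q, w)) ⟨l, hl⟩ := by
    intro σ hσ l hl
    set v := φ (σ, s, q, w) with hv
    have hlσ : |l * σ| < 3 := by
      rw [abs_mul, abs_of_nonneg hl.1]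
      nlinarith [hl.2, abs_nonneg σ]
    let u : C(Icc (0:ℝ) 1, E) := ⟨fun r => v (projIcc 0 1 zero_le_one (l * r)),
      v.continuous.comp (continuous_projIcc.comp (by fun_prop))⟩
    have hu : ∀ r, u r = v (projIcc 0 1 zero_le_one (l * r)) := fun r => rfl
    have hmem : ∀ r : Icc (0:ℝ) 1, l * r ∈ Icc (0:ℝ) 1 := fun r =>
      ⟨mul_nonneg hl.1 r.2.1, mul_le_one₀ hl.2 r.2.1 r.2.2⟩
    have hIu : ∀ r : Icc (0:ℝ) 1, l • I u r = I v ⟨l * r, hmem r⟩ := by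
      intro r
      rw [hI, hI]
      exact aux_int_scale v u l hl hu r r.2
    have hfix := hφ (σ, s, q, w) (hUσ σ w hσ)
    rw [← hv] at hfix
    have huf : u = φ (l * σ, s, q, w) := by
      apply hφu _ (hUσ _ w hlσ)
      ext1 r
      have e1 : u r = v ⟨l * r, hmem r⟩ := by rw [hu, projIcc_of_mem zero_le_one (hmem r)]
      have e2 : v ⟨l * r, hmem r⟩ = w + (σ * s) • I (gC.comp (pth ((σ, s, q, w), v))) ⟨l * r, hmem r⟩ := by
        conv_lhs => rw [hfix]
        simp [T, S, hcE]
      have e3 : T ((l * σ, s, q, w), u) r =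
          w + (l * σ * s) • I (gC.comp (pth ((l * σ, s, q, w), u))) r := by
        simp [T, S, hcE]
      rw [e1, e2, e3]
      congr 1
      rw [show l * σ * s = (σ * s) * l by ring, mul_smul (σ * s) l]
      congr 1
      rw [hI, hI]
      symm
      apply aux_int_scale _ _ l hl _ r r.2
      intro r'
      rw [projIcc_of_mem zero_le_one (hmem r')]
      simp only [ContinuousMap.comp_apply, hpth]
      rw [← hIu r', hu r', projIcc_of_mem zero_le_one (hmem r'), mul_comm l σ, mul_smul]
    constructor
    · simp only [W]
      rw [← huf, hev, hu, projIcc_of_mem zero_le_one (hmem ⟨1, h1J⟩)]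
      congr 2
      simp
    · simp only [X]
      rw [← huf, hev, mul_comm l σ, mul_smul, hIu]
      simp
  have hX0 : X (0, s, q, w) = q := by simp [X]
  have hW0 : W (0, s, q, w) = w := by
    simp only [W]
    rw [hφ _ (hUσ 0 w (by norm_num)), hev]
    simp [T, S, hcE]
  refine ⟨hX0, hW0, ?_, ?_⟩
  · -- integral equations
    have hXcσ : ContinuousOn (fun σ => X (σ, s, q, w)) (Ioo (-3) 3) :=
      hXc.continuousOn.comp (by fun_prop) fun σ hσ => hUσ σ w (abs_lt.2 hσ)
    have hWcσ : ContinuousOn (fun σ => W (σ, s, q, w)) (Ioo (-3) 3) :=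
      hWc.continuousOn.comp (by fun_prop) fun σ hσ => hUσ σ w (abs_lt.2 hσ)
    have hXint : ∀ σ, |σ| < 3 → X (σ, s, q, w) = q + ∫ x in (0:ℝ)..σ, W (x, s, q, w) := by
      intro σ hσ
      have h := (hscale σ hσ 1 h1J).2
      rw [one_mul] at h
      rw [h, hI]
      congr 1
      have h1 := intervalIntegral.smul_integral_comp_mul_right (a := 0) (b := 1)
        (f := fun x => W (x, s, q, w)) σ
      rw [zero_mul, one_mul] at h1
      rw [← h1]
      congr 1
      apply intervalIntegral.integral_congr
      intro x hx
      rw [uIcc_of_le zero_le_one] at hx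
      simp only [projIcc_of_mem zero_le_one hx]
      exact (hscale σ hσ x hx).1.symm
    have hWint : ∀ σ, |σ| < 3 → W (σ, s, q, w) =
        w + ∫ x in (0:ℝ)..σ, s • g (s, X (x, s, q, w), W (x, s, q, w)) := by
      intro σ hσ
      have h := (hscale σ hσ 1 h1J).1
      rw [one_mul] at h
      rw [h, hφ _ (hUσ σ w hσ)]
      have e3 : T ((σ, s, q, w), φ (σ, s, q, w)) ⟨1, h1J⟩ =
          w + (σ * s) • I (gC.comp (pth ((σ, s, q, w), φ (σ, s, q, w)))) ⟨1, h1J⟩ := by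
        simp [T, S, hcE]
      rw [e3, hI]
      congr 1
      have h1 := intervalIntegral.smul_integral_comp_mul_right (a := 0) (b := 1)
        (f := fun x => s • g (s, X (x, s, q, w), W (x, s, q, w))) σ
      rw [zero_mul, one_mul] at h1
      rw [← h1, mul_smul]
      congr 1
      rw [← intervalIntegral.integral_smul]
      apply intervalIntegral.integral_congr
      intro x hx
      rw [uIcc_of_le zero_le_one] at hx
      simp only [projIcc_of_mem zero_le_one hx, ContinuousMap.comp_apply, hpth]
      rw [(hscale σ hσ x hx).1, (hscale σ hσ x hx).2]
      rfl
    have hftc : ∀ (f : ℝ → E) (F : ℝ → E) (c : E), ContinuousOn f (Ioo (-3) 3) →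
        (∀ σ, |σ| < 3 → F σ = c + ∫ x in (0:ℝ)..σ, f x) → ∀ σ, |σ| < 3 →
        HasDerivAt F (f σ) σ := by
      intro f F c hf hF σ hσ
      have hσ' : σ ∈ Ioo (-3:ℝ) 3 := abs_lt.1 hσ
      have hn : Ioo (-3:ℝ) 3 ∈ nhds σ := isOpen_Ioo.mem_nhds hσ'
      have hsub : uIcc 0 σ ⊆ Ioo (-3:ℝ) 3 := by
        intro x hx
        exact (ordConnected_Ioo.uIcc_subset (by constructor <;> norm_num) hσ') hx
      have h := intervalIntegral.integral_hasDerivAt_right (a := 0) (b := σ) (f := f)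
        ((hf.mono hsub).intervalIntegrable)
        (hf.stronglyMeasurableAtFilter isOpen_Ioo σ hσ') (hf.continuousAt hn)
      refine (h.const_add c).congr_of_eventuallyEq ?_
      filter_upwards [hn] with x hx
      exact hF x (abs_lt.2 hx)
    have hbW : ∀ σ, |σ| < 3 → ‖φ (σ, s, q, w) - cE w‖ ≤ 3 * |s| * G := by
      intro σ hσ
      have := hSb _ (hUσ σ w hσ) (φ (σ, s, q, w))
      have h2 : φ (σ, s, q, w) - cE w = S ((σ, s, q, w), φ (σ, s, q, w)) := by
        conv_lhs => rw [hφ _ (hUσ σ w hσ)]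
        simp [T]
      rw [h2]; exact this
    intro σ hσ
    refine ⟨hftc _ _ q hWcσ hXint σ hσ, hftc (fun x => s • g (s, X (x, s, q, w), W (x, s, q, w)))
      _ w ?_ hWint σ hσ, ?_, ?_⟩
    · apply ContinuousOn.const_smul
      exact hg.continuous.comp_continuousOn (continuousOn_const.prodMk (hXcσ.prodMk hWcσ))
    · have := (φ (σ, s, q, w) - cE w).norm_coe_le_norm ⟨1, h1J⟩
      rw [ContinuousMap.sub_apply, hcE] at this
      exact this.trans (hbW σ hσ)
    · have e : X (σ, s, q, w) - q - σ • w = σ • (I (φ (σ, s, q, w) - cE w) ⟨1, h1J⟩) := by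
        rw [map_sub, ContinuousMap.sub_apply, hIc, smul_sub]
        simp only [X, hev]
        abel
      rw [e, norm_smul, Real.norm_eq_abs]
      have h3 := (I (φ (σ, s, q, w) - cE w)).norm_coe_le_norm ⟨1, h1J⟩
      calc |σ| * ‖(I (φ (σ, s, q, w) - cE w)) ⟨1, h1J⟩‖ ≤ 3 * (3 * |s| * G) := by
            gcongr
            exact h3.trans ((hIn _).trans (hbW σ hσ))
        _ = _ := by ring
  · intro w'
    have h1U : ∀ w, ((1, s, q, w) : ℝ × ℝ × E × E) ∈ U := fun w => hUσ 1 w (by norm_num)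
    set v := φ (1, s, q, w) with hv
    set v' := φ (1, s, q, w') with hv'
    have e1 : v - cE w = S ((1, s, q, w), v) := by
      conv_lhs => rw [hv, hφ _ (h1U w), ← hv]
      simp [T]
    have e2 : v' - cE w' = S ((1, s, q, w), v') := by
      conv_lhs => rw [hv', hφ _ (h1U w'), ← hv']
      rw [hSw 1 s q w w']
      simp [T]
    have e3 := hSlip _ (h1U w) v v'
    rw [← e1, ← e2] at e3
    have e4 : ‖v - v'‖ ≤ ‖v - cE w - (v' - cE w')‖ + ‖cE (w - w')‖ := by
      refine le_trans (le_of_eq ?_) (norm_add_le _ _)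
      rw [map_sub]; congr 1; abel
    have e5 : ‖cE (w - w')‖ ≤ ‖w - w'‖ := hcEn _
    have e6 : X (1, s, q, w) - w - (X (1, s, q, w') - w') =
        I (v - cE w - (v' - cE w')) ⟨1, h1J⟩ := by
      simp only [map_sub, ContinuousMap.sub_apply, hIc]
      simp only [X, hev, one_smul]
      abel
    rw [e6]
    have e7 := (I (v - cE w - (v' - cE w'))).norm_coe_le_norm ⟨1, h1J⟩
    have e8 := hIn (v - cE w - (v' - cE w'))
    have := norm_nonneg (v - v')
    linarith

theorem aux_pd_contDiff {n : ℕ} {f : (Fin n → ℝ) → ℝ} (hf : ContDiff ℝ (⊤ : ℕ∞) f) (j : Fin n) :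
    ContDiff ℝ (⊤ : ℕ∞) (pd f j) := by
  have h : ContDiff ℝ (⊤ : ℕ∞) (fderiv ℝ f) := hf.fderiv_right (by simp)
  exact h.clm_apply contDiff_const

theorem aux_bdd {n : ℕ} (f : (Fin n → ℝ) → ℝ) (hf : Continuous f) (R : ℝ) :
    ∃ K, 0 ≤ K ∧ ∀ x, ‖x‖ ≤ R → f x ≤ K := by
  obtain ⟨K, hK⟩ := (isCompact_closedBall (0 : Fin n → ℝ) R).bddAbove_image hf.continuousOn
  refine ⟨max K 0, le_max_right _ _, fun x hx => le_max_of_le_left (hK ⟨x, ?_, rfl⟩)⟩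
  simpa using hx

theorem aux_nondeg {n : ℕ} (B : Fin n → (Fin n → ℝ) → ℝ) (C : (Fin n → ℝ) → ℝ)
    (hB : ∀ i, ContDiff ℝ (⊤ : ℕ∞) (B i)) (hC : ContDiff ℝ (⊤ : ℕ∞) C) (R : ℝ) (hR : 0 ≤ R) :
    ∃ ε : ℝ, 0 < ε ∧ ∀ t, 0 < t → t < ε → ∀ γ : ℝ → Fin n → ℝ,
      (∀ τ ∈ Icc (0:ℝ) t, ‖γ τ‖ ≤ R ∧ ‖deriv γ τ‖ ≤ R / t) → Nondegenerate B C t γ := by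
  have hF : ∀ i k, ContDiff ℝ (⊤ : ℕ∞) (fun q => pd (B i) k q - pd (B k) i q) := fun i k =>
    (aux_pd_contDiff (hB i) k).sub (aux_pd_contDiff (hB k) i)
  obtain ⟨K, hK0, hK⟩ := aux_bdd (fun x => ∑ i, ((∑ j, |pd (B i) j x - pd (B j) i x|) +
    (∑ j, ∑ k, |pd (fun q => pd (B i) k q - pd (B k) i q) j x|) + ∑ j, |pd (pd C i) j x|))
    (by
      have h1 : ∀ i j, Continuous (fun x => pd (B i) j x - pd (B j) i x) :=
        fun i j => (hF i j).continuous
      have h2 : ∀ i j k, Continuous (fun x => pd (fun q => pd (B i) k q - pd (B k) i q) j x) :=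
        fun i j k => (aux_pd_contDiff (hF i k) j).continuous
      have h3 : ∀ i j, Continuous (fun x => pd (pd C i) j x) :=
        fun i j => (aux_pd_contDiff (aux_pd_contDiff hC i) j).continuous
      refine continuous_finsetSum _ fun i _ => ?_
      refine (Continuous.add ?_ ?_).add ?_
      · exact continuous_finsetSum _ fun j _ => (h1 i j).abs
      · exact continuous_finsetSum _ fun j _ => continuous_finsetSum _ fun k _ => (h2 i j k).abs
      · exact continuous_finsetSum _ fun j _ => (h3 i j).abs) R
  have hKi : ∀ x, ‖x‖ ≤ R → ∀ i, (∑ j, |pd (B i) j x - pd (B j) i x|) +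
    (∑ j, ∑ k, |pd (fun q => pd (B i) k q - pd (B k) i q) j x|) + ∑ j, |pd (pd C i) j x| ≤ K := by
    intro x hx i
    refine le_trans ?_ (hK x hx)
    exact Finset.single_le_sum (f := fun i => (∑ j, |pd (B i) j x - pd (B j) i x|) +
      (∑ j, ∑ k, |pd (fun q => pd (B i) k q - pd (B k) i q) j x|) + ∑ j, |pd (pd C i) j x|)
      (fun i _ => by positivity) (Finset.mem_univ i)
  refine ⟨min 1 (1 / (K * (2 + R) + 1)), by positivity, ?_⟩
  intro t ht0 ht γ hγ ξ hξ hξ0 hξt hJ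
  have ht1 : t < 1 := lt_of_lt_of_le ht (min_le_left _ _)
  have ht2 : t * (K * (2 + R)) < 1 := by
    have h := lt_of_lt_of_le ht (min_le_right _ _)
    rw [lt_div_iff₀ (by positivity)] at h
    linarith
  have hξ1 : ContDiff ℝ (⊤ : ℕ∞) (deriv ξ) := by
    have := (contDiff_infty_iff_deriv.1 hξ).2
    exact this
  have hd : ∀ τ, HasDerivAt ξ (deriv ξ τ) τ := fun τ =>
    ((hξ.differentiable (by simp)) τ).hasDerivAt
  have hdd : ∀ τ, HasDerivAt (deriv ξ) (deriv (deriv ξ) τ) τ := fun τ =>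
    ((hξ1.differentiable (by simp)) τ).hasDerivAt
  obtain ⟨τm, hτm, hmax⟩ := (isCompact_Icc (a := (0:ℝ)) (b := t)).exists_isMaxOn
    ⟨0, ⟨le_rfl, ht0.le⟩⟩ (hξ1.continuous.norm.continuousOn)
  set m := ‖deriv ξ τm‖ with hm
  have hm0 : 0 ≤ m := norm_nonneg _
  have hbound : ∀ τ ∈ Icc (0:ℝ) t, ‖deriv ξ τ‖ ≤ m := fun τ hτ => hmax hτ
  have hξb : ∀ τ ∈ Icc (0:ℝ) t, ‖ξ τ‖ ≤ m * t := by
    intro τ hτ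
    have h := Convex.norm_image_sub_le_of_norm_hasDerivWithin_le (f := ξ) (f' := deriv ξ)
      (s := Icc (0:ℝ) t) (x := 0) (y := τ) (C := m) (fun x _ => (hd x).hasDerivWithinAt) hbound
      (convex_Icc _ _) ⟨le_rfl, ht0.le⟩ hτ
    rw [hξ0, sub_zero, sub_zero, Real.norm_of_nonneg hτ.1] at h
    exact h.trans (by gcongr; exact hτ.2)
  have hsec : ∀ i, ∀ τ ∈ Icc (0:ℝ) t, |deriv (deriv ξ) τ i| ≤ K * (2 + R) * m := by
    intro i τ hτ
    have h := hJ τ hτ i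
    unfold Jacobi at h
    obtain ⟨hγ1, hγ2⟩ := hγ τ hτ
    set a := ∑ j, |pd (B i) j (γ τ) - pd (B j) i (γ τ)| with ha
    set b := ∑ j, ∑ k, |pd (fun q => pd (B i) k q - pd (B k) i q) j (γ τ)| with hb
    set c := ∑ j, |pd (pd C i) j (γ τ)| with hc
    have hab : a + b + c ≤ K := hKi _ hγ1 i
    have ha0 : 0 ≤ a := by positivity
    have hb0 : 0 ≤ b := by positivity
    have hc0 : 0 ≤ c := by positivity
    have e1 : |∑ j, (pd (B i) j (γ τ) - pd (B j) i (γ τ)) * deriv ξ τ j| ≤ a * m := by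
      rw [ha, Finset.sum_mul]
      refine (Finset.abs_sum_le_sum_abs _ _).trans (Finset.sum_le_sum fun j _ => ?_)
      rw [abs_mul]
      gcongr
      exact (norm_le_pi_norm (deriv ξ τ) j).trans (hbound τ hτ)
    have e2 : |∑ j, ((∑ k, pd (fun q => pd (B i) k q - pd (B k) i q) j (γ τ) * deriv γ τ k)
        + pd (pd C i) j (γ τ)) * ξ τ j| ≤ (b * (R / t) + c) * (m * t) := by
      rw [hb, hc, Finset.sum_mul, ← Finset.sum_add_distrib, Finset.sum_mul]
      refine (Finset.abs_sum_le_sum_abs _ _).trans (Finset.sum_le_sum fun j _ => ?_)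
      rw [abs_mul]
      gcongr
      · refine (abs_add_le _ _).trans ?_
        gcongr
        rw [Finset.sum_mul]
        refine (Finset.abs_sum_le_sum_abs _ _).trans (Finset.sum_le_sum fun k _ => ?_)
        rw [abs_mul]
        gcongr
        exact (norm_le_pi_norm (deriv γ τ) k).trans hγ2
      · exact (norm_le_pi_norm (ξ τ) j).trans (hξb τ hτ)
    have e3 : (b * (R / t) + c) * (m * t) = b * R * m + c * t * m := by field_simp
    rw [e3] at e2
    have e4 : |deriv (deriv ξ) τ i| ≤ a * m + (b * R * m + c * t * m) := by
      have : deriv (deriv ξ) τ i = -((∑ j, (pd (B i) j (γ τ) - pd (B j) i (γ τ)) * deriv ξ τ j)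
        + ∑ j, ((∑ k, pd (fun q => pd (B i) k q - pd (B k) i q) j (γ τ) * deriv γ τ k)
        + pd (pd C i) j (γ τ)) * ξ τ j) := by linarith
      rw [this, abs_neg]
      exact (abs_add_le _ _).trans (add_le_add e1 e2)
    have e5 : a + (b * R + c * t) ≤ K * (2 + R) := by
      have f1 : a ≤ K := by linarith
      have f2 : b * R ≤ K * R := by gcongr; linarith
      have f3 : c * t ≤ K * 1 := by gcongr; linarith
      linarith
    calc _ ≤ a * m + (b * R * m + c * t * m) := e4
      _ = (a + (b * R + c * t)) * m := by ring
      _ ≤ _ := by gcongr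
  have hfirst : ∀ i, ∀ τ ∈ Icc (0:ℝ) t, |deriv ξ τ i| ≤ K * (2 + R) * m * t := by
    intro i τ hτ
    have hdi : ∀ τ, HasDerivAt (fun τ => ξ τ i) (deriv ξ τ i) τ := fun τ =>
      (hasDerivAt_pi.1 (hd τ)) i
    have hddi : ∀ τ, HasDerivAt (fun τ => deriv ξ τ i) (deriv (deriv ξ) τ i) τ := fun τ =>
      (hasDerivAt_pi.1 (hdd τ)) i
    obtain ⟨c, hc, hc0⟩ := exists_hasDerivAt_eq_zero (f := fun τ => ξ τ i)
      (f' := fun τ => deriv ξ τ i) ht0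
      (fun x _ => (hdi x).continuousAt.continuousWithinAt) (by simp [hξ0, hξt])
      (fun x _ => hdi x)
    have h := Convex.norm_image_sub_le_of_norm_hasDerivWithin_le (f := fun τ => deriv ξ τ i)
      (f' := fun τ => deriv (deriv ξ) τ i)
      (s := Icc (0:ℝ) t) (x := c) (y := τ) (C := K * (2 + R) * m)
      (fun x _ => (hddi x).hasDerivWithinAt) (hsec i)
      (convex_Icc _ _) ⟨hc.1.le, hc.2.le⟩ hτ
    rw [hc0, sub_zero] at h
    refine h.trans ?_
    gcongr
    rw [Real.norm_eq_abs, abs_le]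
    constructor <;> linarith [hc.1, hc.2, hτ.1, hτ.2]
  have hmle : m ≤ K * (2 + R) * m * t := by
    rw [hm]
    exact (pi_norm_le_iff_of_nonneg (by positivity)).2 fun i => hfirst i τm hτm
  have hmz : m = 0 := by
    by_contra hne
    have : 0 < m := lt_of_le_of_ne hm0 (Ne.symm hne)
    nlinarith
  intro τ hτ
  have := hξb τ hτ
  rw [hmz, zero_mul] at this
  exact norm_le_zero_iff.1 this

theorem aux_eta : ∃ η : ℝ → ℝ, ContDiff ℝ (⊤ : ℕ∞) η ∧ (∀ x, |x| < 2 → η x = x) ∧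
    ∀ x, |η x| < 3 := by
  let b : ContDiffBump (0:ℝ) := ⟨2, 5/2, by norm_num, by norm_num⟩
  refine ⟨fun x => b x * x, b.contDiff.mul contDiff_id, ?_, ?_⟩
  · intro x hx
    have : b x = 1 := b.one_of_mem_closedBall (by simpa [b] using hx.le)
    simp [this]
  · intro x
    by_cases h : |x| < 5/2
    · rw [abs_mul, abs_of_nonneg b.nonneg]
      have := b.le_one (x := x)
      have := b.nonneg (x := x)
      nlinarith [abs_nonneg x]
    · have : b x = 0 := b.zero_of_le_dist (by simpa [b] using h)
      simp [this]

/-- the cut-off rescaled force -/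
theorem aux_force {n : ℕ} (B : Fin n → (Fin n → ℝ) → ℝ) (C : (Fin n → ℝ) → ℝ)
    (hB : ∀ i, ContDiff ℝ (⊤ : ℕ∞) (B i)) (hC : ContDiff ℝ (⊤ : ℕ∞) C) (R : ℝ) (hR : 0 < R) :
    ∃ g : ℝ × (Fin n → ℝ) × (Fin n → ℝ) → (Fin n → ℝ), ContDiff ℝ (⊤ : ℕ∞) g ∧
      (∃ L : ℝ, 0 ≤ L ∧ ∀ z z', ‖g z - g z'‖ ≤ L * ‖z - z'‖) ∧
      (∃ G : ℝ, 0 ≤ G ∧ ∀ z, ‖g z‖ ≤ G) ∧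
      ∀ s x w, |s| ≤ R → ‖x‖ ≤ R → ‖w‖ ≤ R → ∀ i, g (s, x, w) i =
        -((∑ j, (pd (B i) j x - pd (B j) i x) * w j) + s * pd C i x) := by
  let b : ContDiffBump (0 : ℝ × (Fin n → ℝ) × (Fin n → ℝ)) := ⟨R, 2 * R, hR, by linarith⟩
  let g0 : ℝ × (Fin n → ℝ) × (Fin n → ℝ) → (Fin n → ℝ) := fun z i =>
    -((∑ j, (pd (B i) j z.2.1 - pd (B j) i z.2.1) * z.2.2 j) + z.1 * pd C i z.2.1)
  have hp : ∀ f : (Fin n → ℝ) → ℝ, ContDiff ℝ (⊤ : ℕ∞) f → ∀ j, ContDiff ℝ (⊤ : ℕ∞)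
      (fun z : ℝ × (Fin n → ℝ) × (Fin n → ℝ) => pd f j z.2.1) := fun f hf j =>
    (aux_pd_contDiff hf j).comp (contDiff_fst.comp contDiff_snd)
  have hg0 : ContDiff ℝ (⊤ : ℕ∞) g0 := by
    refine contDiff_pi.2 fun i => ?_
    refine (ContDiff.add (ContDiff.sum fun j _ => ?_) (contDiff_fst.mul (hp C hC i))).neg
    refine ((hp _ (hB i) j).sub (hp _ (hB j) i)).mul ?_
    exact (contDiff_apply ℝ ℝ j).comp (contDiff_snd.comp contDiff_snd)
  have hg : ContDiff ℝ (⊤ : ℕ∞) (fun z => b z • g0 z) := b.contDiff.smul hg0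
  have hcs : HasCompactSupport (fun z => b z • g0 z) := b.hasCompactSupport.smul_right
  refine ⟨fun z => b z • g0 z, hg, ?_, ?_, ?_⟩
  · obtain ⟨L, hL⟩ := hg.lipschitzWith_of_hasCompactSupport hcs (by simp)
    exact ⟨L, L.2, fun z z' => by simpa [dist_eq_norm] using hL.dist_le_mul z z'⟩
  · obtain ⟨G, hG⟩ := hg.continuous.bounded_above_of_compact_support hcs
    exact ⟨G, (norm_nonneg _).trans (hG 0), hG⟩
  · intro s x w hs hx hw i
    have : b (s, x, w) = 1 := b.one_of_mem_closedBall (by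
      rw [mem_closedBall_zero_iff, Prod.norm_mk, Prod.norm_mk]
      exact max_le hs (max_le hx hw))
    simp [this, g0]

/-- rescaled paths -/
theorem aux_path {E : Type} [NormedAddCommGroup E] [NormedSpace ℝ E]
    (g : ℝ × E × E → E) (X W : ℝ × ℝ × E × E → E) (η : ℝ → ℝ)
    (hη : ContDiff ℝ (⊤ : ℕ∞) η) (hη1 : ∀ x, |x| < 2 → η x = x) (hη2 : ∀ x, |η x| < 3)
    (ε : ℝ) (hX : ContDiffOn ℝ (⊤ : ℕ∞) X {a | |a.1| < 3 ∧ |a.2.1| < ε})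
    (t : ℝ) (ht : 0 < t) (htε : t < ε) (q w : E)
    (hXd : ∀ σ, |σ| < 3 → HasDerivAt (fun σ => X (σ, t, q, w)) (W (σ, t, q, w)) σ)
    (hWd : ∀ σ, |σ| < 3 → HasDerivAt (fun σ => W (σ, t, q, w))
            (t • g (t, X (σ, t, q, w), W (σ, t, q, w))) σ)
    (γ : ℝ → E) (hγ : γ = fun τ => X (η (τ / t), t, q, w)) :
    ContDiff ℝ (⊤ : ℕ∞) γ ∧ (∀ τ ∈ Icc (0:ℝ) t, γ τ = X (τ / t, t, q, w) ∧
      deriv γ τ = t⁻¹ • W (τ / t, t, q, w) ∧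
      deriv (deriv γ) τ = t⁻¹ • g (t, X (τ / t, t, q, w), W (τ / t, t, q, w))) := by
  have hsm : ContDiff ℝ (⊤ : ℕ∞) γ := by
    rw [hγ]
    refine hX.comp_contDiff (f := fun τ : ℝ => (η (τ / t), t, q, w)) ?_ ?_
    · exact (hη.comp (contDiff_id.div_const t)).prodMk contDiff_const
    · intro τ
      exact ⟨hη2 _, by rw [abs_of_pos ht]; exact htε⟩
  refine ⟨hsm, ?_⟩
  have hnear : ∀ τ ∈ Ioo (-(2 * t)) (2 * t), |τ / t| < 2 := by
    intro τ hτ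
    rw [abs_div, abs_of_pos ht, div_lt_iff₀ ht]
    exact abs_lt.2 hτ
  have hval : ∀ τ ∈ Ioo (-(2 * t)) (2 * t), γ τ = X (τ / t, t, q, w) := by
    intro τ hτ
    rw [hγ]
    simp only [hη1 _ (hnear τ hτ)]
  have hdiv : ∀ τ, HasDerivAt (fun τ : ℝ => τ / t) t⁻¹ τ := by
    intro τ
    simpa using (hasDerivAt_id τ).div_const t
  have hd1 : ∀ τ ∈ Ioo (-(2 * t)) (2 * t), deriv γ τ = t⁻¹ • W (τ / t, t, q, w) := by
    intro τ hτ
    have h3 : |τ / t| < 3 := (hnear τ hτ).trans (by norm_num)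
    have h := HasDerivAt.scomp τ (hXd _ h3) (hdiv τ)
    apply HasDerivAt.deriv
    refine h.congr_of_eventuallyEq ?_
    filter_upwards [isOpen_Ioo.mem_nhds hτ] with x hx
    exact hval x hx
  have hd2 : ∀ τ ∈ Ioo (-(2 * t)) (2 * t), deriv (deriv γ) τ =
      t⁻¹ • g (t, X (τ / t, t, q, w), W (τ / t, t, q, w)) := by
    intro τ hτ
    have h3 : |τ / t| < 3 := (hnear τ hτ).trans (by norm_num)
    have h := (HasDerivAt.scomp τ (hWd _ h3) (hdiv τ)).const_smul t⁻¹
    rw [inv_smul_smul₀ ht.ne'] at h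
    apply HasDerivAt.deriv
    refine h.congr_of_eventuallyEq ?_
    filter_upwards [isOpen_Ioo.mem_nhds hτ] with x hx
    exact hd1 x hx
  intro τ hτ
  have hτ' : τ ∈ Ioo (-(2 * t)) (2 * t) := ⟨by linarith [hτ.1], by linarith [hτ.2]⟩
  exact ⟨hval τ hτ', hd1 τ hτ', hd2 τ hτ'⟩

/-- over a set `O₀` with compact closure there is, for sufficiently
small durations, a smooth family of nondegenerate classical paths, containing all
short-duration solutions with initial velocity `-B`. -/
theorem statement17 {n : ℕ} (hn : 1 ≤ n)
    (B : Fin n → (Fin n → ℝ) → ℝ) (C : (Fin n → ℝ) → ℝ)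
    (hB : ∀ i, ContDiff ℝ (⊤ : ℕ∞) (B i)) (hC : ContDiff ℝ (⊤ : ℕ∞) C)
    (O0 : Set (Fin n → ℝ)) (hO0 : IsOpen O0) (hO0c : IsCompact (closure O0)) :
    ∃ ε : ℝ, 0 < ε ∧
      ∃ F : SmoothFamily B C (Ioo (0:ℝ) ε ×ˢ O0 ×ˢ O0),
        ∀ q ∈ O0, ∃ t1 : ℝ, 0 < t1 ∧ t1 ≤ ε ∧
          ∀ t : ℝ, 0 < t → t < t1 →
            ∃ γsol : ℝ → Fin n → ℝ,
              ContDiff ℝ (⊤ : ℕ∞) γsol ∧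
              IsClassical B C t γsol ∧
              Nondegenerate B C t γsol ∧
              γsol 0 = q ∧
              deriv γsol 0 = (fun i => -(B i q)) ∧
              (γsol t ∈ O0 → ∀ τ ∈ Icc (0:ℝ) t, F.f τ t q (γsol t) = γsol τ) := by

  obtain ⟨M0, hM0⟩ := hO0c.isBounded.subset_closedBall (0 : Fin n → ℝ)
  set M : ℝ := max M0 0 with hMdef
  have hMnn : 0 ≤ M := le_max_right _ _
  have hM : ∀ q ∈ O0, ‖q‖ ≤ M := by
    intro q hq
    have := hM0 (subset_closure hq)
    rw [mem_closedBall_zero_iff] at this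
    exact this.trans (le_max_left _ _)
  set R : ℝ := 3 * M + 3 with hRdef
  have hRpos : 0 < R := by positivity
  obtain ⟨g, hg, ⟨L, hL0, hL⟩, ⟨G, hG0, hG⟩, hgval⟩ := aux_force B C hB hC R hRpos
  obtain ⟨ε0, hε0, X, W, hXc, hWc, hflow⟩ := aux_flow g hg L hL0 hL G hG0 hG
  obtain ⟨ε1, hε1, hnd⟩ := aux_nondeg B C hB hC R hRpos.le
  obtain ⟨η, hη, hη1, hη2⟩ := aux_eta
  -- shooting
  have hU2o : IsOpen {p : ℝ × (Fin n → ℝ) × (Fin n → ℝ) | |p.1| < ε0} :=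
    isOpen_lt (by fun_prop) (by fun_prop)
  have hUo : IsOpen {a : ℝ × ℝ × (Fin n → ℝ) × (Fin n → ℝ) | |a.1| < 3 ∧ |a.2.1| < ε0} := by
    have o1 : IsOpen {a : ℝ × ℝ × (Fin n → ℝ) × (Fin n → ℝ) | |a.1| < 3} :=
      isOpen_lt (by fun_prop) (by fun_prop)
    have o2 : IsOpen {a : ℝ × ℝ × (Fin n → ℝ) × (Fin n → ℝ) | |a.2.1| < ε0} :=
      isOpen_lt (by fun_prop) (by fun_prop)
    exact o1.inter o2
  obtain ⟨φ, hφ, hφu, hφc⟩ := aux_fixedPoint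
    (fun p : (ℝ × (Fin n → ℝ) × (Fin n → ℝ)) × (Fin n → ℝ) =>
      p.1.2.2 - (X (1, p.1.1, p.1.2.1, p.2) - p.2))
    {p : ℝ × (Fin n → ℝ) × (Fin n → ℝ) | |p.1| < ε0} hU2o
    (by
      rintro ⟨s, q0, q1⟩ hp w
      have h1 : ContDiffAt ℝ (⊤ : ℕ∞) X (1, s, q0, w) :=
        hXc.contDiffAt (hUo.mem_nhds ⟨by norm_num, hp⟩)
      have h2 : ContDiffAt ℝ (⊤ : ℕ∞) (fun p : (ℝ × (Fin n → ℝ) × (Fin n → ℝ)) × (Fin n → ℝ) =>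
        ((1 : ℝ), p.1.1, p.1.2.1, p.2)) ((s, q0, q1), w) := by fun_prop
      have h3 : ContDiffAt ℝ (⊤ : ℕ∞) (fun p : (ℝ × (Fin n → ℝ) × (Fin n → ℝ)) × (Fin n → ℝ) =>
        X (1, p.1.1, p.1.2.1, p.2)) ((s, q0, q1), w) :=
        ContDiffAt.comp (g := X) ((s, q0, q1), w) h1 h2
      exact ContDiffAt.sub (by fun_prop) (h3.sub contDiffAt_snd))
    (by
      rintro ⟨s, q0, q1⟩ hp w w'
      have h := (hflow s q0 w hp).2.2.2 w'
      simp only [sub_sub_sub_cancel_left]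
      rw [norm_sub_rev]
      exact h)
  have hφX : ∀ t q0 q1, |t| < ε0 → X (1, t, q0, φ (t, q0, q1)) = q1 := by
    intro t q0 q1 ht
    have h := hφ (t, q0, q1) ht
    simp only at h
    have h' : q1 - X (1, t, q0, φ (t, q0, q1)) = 0 := by
      have e : q1 - X (1, t, q0, φ (t, q0, q1)) =
        (q1 - (X (1, t, q0, φ (t, q0, q1)) - φ (t, q0, q1))) - φ (t, q0, q1) := by abel
      rw [e, ← h, sub_self]
    exact (sub_eq_zero.1 h').symm
  set ε : ℝ := min (min ε0 ε1) (min 1 (1 / (9 * G + 1))) with hεdef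
  have hεpos : 0 < ε := by positivity
  have hεε0 : ε ≤ ε0 := (min_le_left _ _).trans (min_le_left _ _)
  have hεε1 : ε ≤ ε1 := (min_le_left _ _).trans (min_le_right _ _)
  have hε1' : ε ≤ 1 := (min_le_right _ _).trans (min_le_left _ _)
  have hεG : ∀ t, 0 < t → t < ε → 9 * |t| * G ≤ 1 := by
    intro t ht0 ht
    rw [abs_of_pos ht0]
    have h := ht.trans_le ((min_le_right _ _).trans (min_le_right _ _))
    rw [lt_div_iff₀ (by positivity)] at h
    linarith
  -- properties of individual paths
  have hpath : ∀ t, 0 < t → t < ε → ∀ q w, ‖q‖ ≤ M → ‖w‖ ≤ 2 * M + 1 →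
      ∀ γ : ℝ → Fin n → ℝ, (γ = fun τ => X (η (τ / t), t, q, w)) →
      ContDiff ℝ (⊤ : ℕ∞) γ ∧ IsClassical B C t γ ∧ Nondegenerate B C t γ ∧ γ 0 = q ∧
      deriv γ 0 = t⁻¹ • w ∧ γ t = X (1, t, q, w) := by
    intro t ht0 htε q w hq hw γ hγ
    have habs : |t| = t := abs_of_pos ht0
    have htε0 : |t| < ε0 := by rw [habs]; exact htε.trans_le hεε0
    obtain ⟨hX0, hW0, hfl, -⟩ := hflow t q w htε0
    obtain ⟨hsm, hp⟩ := aux_path g X W η hη hη1 hη2 ε0 hXc t ht0 (htε.trans_le hεε0) q w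
      (fun σ h => (hfl σ h).1) (fun σ h => (hfl σ h).2.1) γ hγ
    have hG1 := hεG t ht0 htε
    have hσ : ∀ τ ∈ Icc (0:ℝ) t, 0 ≤ τ / t ∧ τ / t ≤ 1 := fun τ hτ =>
      ⟨div_nonneg hτ.1 ht0.le, (div_le_one ht0).2 hτ.2⟩
    have hσ3 : ∀ τ ∈ Icc (0:ℝ) t, |τ / t| < 3 := fun τ hτ => by
      rw [abs_of_nonneg (hσ τ hτ).1]; linarith [(hσ τ hτ).2]
    have hWb : ∀ τ ∈ Icc (0:ℝ) t, ‖W (τ / t, t, q, w)‖ ≤ R := by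
      intro τ hτ
      have h1 := (hfl _ (hσ3 τ hτ)).2.2.1
      have h2 := norm_le_norm_add_norm_sub' (W (τ / t, t, q, w)) w
      have h3 : 0 ≤ |t| * G := by positivity
      linarith
    have hXb : ∀ τ ∈ Icc (0:ℝ) t, ‖X (τ / t, t, q, w)‖ ≤ R := by
      intro τ hτ
      have h1 := (hfl _ (hσ3 τ hτ)).2.2.2
      have h2 : X (τ / t, t, q, w) = (X (τ / t, t, q, w) - q - (τ / t) • w) + (q + (τ / t) • w) := by
        abel
      have h3 : ‖(τ / t) • w‖ ≤ 1 * (2 * M + 1) := by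
        rw [norm_smul, Real.norm_of_nonneg (hσ τ hτ).1]
        gcongr
        exact (hσ τ hτ).2
      rw [h2]
      have h4 := norm_add_le (X (τ / t, t, q, w) - q - (τ / t) • w) (q + (τ / t) • w)
      have h5 := norm_add_le q ((τ / t) • w)
      linarith
    have h0 : (0:ℝ) ∈ Icc (0:ℝ) t := ⟨le_rfl, ht0.le⟩
    have h1 : t ∈ Icc (0:ℝ) t := ⟨ht0.le, le_rfl⟩
    refine ⟨hsm, ?_, ?_, ?_, ?_, ?_⟩
    · intro τ hτ i
      obtain ⟨p1, p2, p3⟩ := hp τ hτ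
      rw [p1, p2, p3]
      have hv := hgval t _ _ (by rw [habs]; linarith) (hXb τ hτ) (hWb τ hτ) i
      simp only [Pi.smul_apply, smul_eq_mul]
      rw [hv]
      have e : ∑ j, (pd (B i) j (X (τ / t, t, q, w)) - pd (B j) i (X (τ / t, t, q, w))) *
          (t⁻¹ * W (τ / t, t, q, w) j) = t⁻¹ *
          ∑ j, (pd (B i) j (X (τ / t, t, q, w)) - pd (B j) i (X (τ / t, t, q, w))) *
          W (τ / t, t, q, w) j := by
        rw [Finset.mul_sum]
        exact Finset.sum_congr rfl fun j _ => by ring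
      rw [e]
      field_simp
      ring
    · apply hnd t ht0 (htε.trans_le hεε1)
      intro τ hτ
      obtain ⟨p1, p2, p3⟩ := hp τ hτ
      rw [p1, p2]
      refine ⟨hXb τ hτ, ?_⟩
      rw [norm_smul, norm_inv, Real.norm_of_nonneg ht0.le, div_eq_inv_mul R t]
      exact mul_le_mul_of_nonneg_left (hWb τ hτ) (inv_nonneg.2 ht0.le)
    · rw [(hp 0 h0).1, zero_div, hX0]
    · rw [(hp 0 h0).2.1, zero_div, hW0]
    · rw [(hp t h1).1, div_self ht0.ne']
  have hφb : ∀ t, 0 < t → t < ε → ∀ q0 ∈ O0, ∀ q1 ∈ O0, ‖φ (t, q0, q1)‖ ≤ 2 * M + 1 := by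
    intro t ht0 htε q0 hq0 q1 hq1
    have htε0 : |t| < ε0 := by rw [abs_of_pos ht0]; exact htε.trans_le hεε0
    have h := ((hflow t q0 (φ (t, q0, q1)) htε0).2.2.1 1 (by norm_num)).2.2.2
    rw [hφX t q0 q1 htε0, one_smul] at h
    have h1 := hεG t ht0 htε
    have h2 : φ (t, q0, q1) = (q1 - q0) - (q1 - q0 - φ (t, q0, q1)) := by abel
    rw [h2]
    have h3 := norm_sub_le (q1 - q0) (q1 - q0 - φ (t, q0, q1))
    have h4 := norm_sub_le q1 q0
    linarith [hM q0 hq0, hM q1 hq1]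
  have hmain : ∀ p ∈ Ioo (0:ℝ) ε ×ˢ O0 ×ˢ O0, _ := fun p hp =>
    hpath p.1 hp.1.1 hp.1.2 p.2.1 (φ (p.1, p.2.1, p.2.2)) (hM _ hp.2.1)
      (hφb p.1 hp.1.1 hp.1.2 p.2.1 hp.2.1 p.2.2 hp.2.2)
      (fun τ => X (η (τ / p.1), p.1, p.2.1, φ (p.1, p.2.1, p.2.2))) rfl
  have hpabs : ∀ t, 0 < t → t < ε → |t| < ε0 := fun t h0 h1 => by
    rw [abs_of_pos h0]; exact h1.trans_le hεε0
  let F : SmoothFamily B C (Ioo (0:ℝ) ε ×ˢ O0 ×ˢ O0) :=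
    { f := fun τ t q0 q1 => X (η (τ / t), t, q0, φ (t, q0, q1))
      isOpen := isOpen_Ioo.prod (hO0.prod hO0)
      pos := fun p hp => hp.1.1
      smooth := by
        refine hXc.comp (f := fun p : ℝ × ℝ × (Fin n → ℝ) × (Fin n → ℝ) =>
          (η (p.1 / p.2.1), p.2.1, p.2.2.1, φ (p.2.1, p.2.2.1, p.2.2.2))) ?_ ?_
        · refine ContDiffOn.prodMk ?_ (ContDiffOn.prodMk (by fun_prop)
            (ContDiffOn.prodMk (by fun_prop) ?_))
          · refine hη.comp_contDiffOn (ContDiffOn.div (by fun_prop) (by fun_prop) ?_)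
            intro p hp
            exact hp.1.1.1.ne'
          · refine hφc.comp (f := fun p : ℝ × ℝ × (Fin n → ℝ) × (Fin n → ℝ) =>
              (p.2.1, p.2.2.1, p.2.2.2)) (by fun_prop) ?_
            intro p hp
            exact hpabs _ hp.1.1.1 hp.1.1.2
        · intro p hp
          exact ⟨hη2 _, hpabs _ hp.1.1.1 hp.1.1.2⟩
      pathSmooth := fun p hp => (hmain p hp).1
      isClassical := fun p hp => (hmain p hp).2.1
      nondeg := fun p hp => (hmain p hp).2.2.1
      bdry0 := fun p hp => (hmain p hp).2.2.2.1
      bdry1 := fun p hp => ((hmain p hp).2.2.2.2.2).trans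
        (hφX p.1 p.2.1 p.2.2 (hpabs _ hp.1.1 hp.1.2)) }
  refine ⟨ε, hεpos, F, ?_⟩
  intro q hq
  set b : Fin n → ℝ := fun i => -(B i q) with hb
  refine ⟨min ε (1 / (‖b‖ + 1)), by positivity, min_le_left _ _, ?_⟩
  intro t ht0 ht
  have htε : t < ε := ht.trans_le (min_le_left _ _)
  have htb : ‖t • b‖ ≤ 2 * M + 1 := by
    have h := ht.trans_le (min_le_right _ _)
    rw [lt_div_iff₀ (by positivity)] at h
    rw [norm_smul, Real.norm_of_nonneg ht0.le]
    linarith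
  obtain ⟨c1, c2, c3, c4, c5, c6⟩ := hpath t ht0 htε q (t • b) (hM q hq) htb
    (fun τ => X (η (τ / t), t, q, t • b)) rfl
  refine ⟨fun τ => X (η (τ / t), t, q, t • b), c1, c2, c3, c4, ?_, ?_⟩
  · rw [c5, inv_smul_smul₀ ht0.ne']
  · intro hend τ hτ
    have hw : t • b = φ (t, q, X (η (t / t), t, q, t • b)) := by
      apply hφu (t, q, X (η (t / t), t, q, t • b)) (hpabs t ht0 htε)
      simp only at c6 ⊢
      rw [c6]
      abel
    change X (η (τ / t), t, q, φ (t, q, X (η (t / t), t, q, t • b))) = X (η (τ / t), t, q, t • b)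
    rw [← hw]
end
end
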